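/- arXiv:1809.05684 — 3 statements merged into one kernel-verified Lean document; each statement's English description precedes it below -/
import Mathlib

section
/- (A priori bound for the Hénon–Lane–Emden problem.) Let Ω ⊂ ℝ² be a bounded, simply connected open set with smooth boundary containing 0, α > -1, p₀ > 1, and K ∈ C¹(Ω̄) with K > 0 on Ω̄. Then there exists C₀ > 0, depending only on Ω, α, K and p₀, such that every solution u of -Δu = |x|^{2α} K(x) u^{p} in Ω, u > 0 in Ω, u = 0 on ∂Ω, with p ≥ p₀ satisfies sup_Ω u = ‖u‖_{L^∞(Ω)} ≤ C₀. -/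
open MeasureTheory Real Set Metric

noncomputable section

abbrev Plane := EuclideanSpace ℝ (Fin 2)

/-- The Laplace operator on ℝ² (acting on real-valued functions). -/
def lap (u : Plane → ℝ) (x : Plane) : ℝ :=
  ∑ i, fderiv ℝ (fun y => fderiv ℝ u y (EuclideanSpace.single i 1)) x
    (EuclideanSpace.single i 1)

/-- `Ω` has smooth boundary: near each boundary point, `Ω` is a sublevel set of a smooth
function with nonvanishing differential, whose zero set is the boundary. -/
def SmoothBoundary (Ω : Set Plane) : Prop :=
  ∀ x ∈ frontier Ω, ∃ (U : Set Plane) (f : Plane → ℝ),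
    IsOpen U ∧ x ∈ U ∧ ContDiffOn ℝ (⊤ : ℕ∞) f U ∧
    (∀ y ∈ U, fderiv ℝ f y ≠ 0) ∧
    Ω ∩ U = {y ∈ U | f y < 0} ∧ frontier Ω ∩ U = {y ∈ U | f y = 0}

open Filter Topology

lemma lap_eq_of_hasFDerivAt {u : Plane → ℝ} {x : Plane} {u' : Plane → Plane →L[ℝ] ℝ}
    (h1 : ∀ᶠ y in 𝓝 x, HasFDerivAt u (u' y) y) {u'' : Fin 2 → Plane →L[ℝ] ℝ}
    (h2 : ∀ i, HasFDerivAt (fun y => u' y (EuclideanSpace.single i 1)) (u'' i) x) :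
    lap u x = ∑ i, u'' i (EuclideanSpace.single i 1) := by
  unfold lap
  refine Finset.sum_congr rfl fun i _ => ?_
  have : (fun y => fderiv ℝ u y (EuclideanSpace.single i 1)) =ᶠ[𝓝 x]
      fun y => u' y (EuclideanSpace.single i 1) := by
    filter_upwards [h1] with y hy using by rw [hy.fderiv]
  rw [this.fderiv_eq, (h2 i).fderiv]

lemma ContDiffAt.eventually_differentiableAt {E F : Type*} [NormedAddCommGroup E]
    [NormedSpace ℝ E] [NormedAddCommGroup F] [NormedSpace ℝ F] {u : E → F} {x : E}
    (h : ContDiffAt ℝ 2 u x) : ∀ᶠ y in 𝓝 x, DifferentiableAt ℝ u y := by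
  filter_upwards [h.eventually (by simp)] with y hy using hy.differentiableAt (by norm_num)

lemma ContDiffAt.differentiableAt_fderiv {E F : Type*} [NormedAddCommGroup E]
    [NormedSpace ℝ E] [NormedAddCommGroup F] [NormedSpace ℝ F] {u : E → F} {x : E}
    (h : ContDiffAt ℝ 2 u x) : DifferentiableAt ℝ (fderiv ℝ u) x :=
  (h.fderiv_right (m := 1) (by norm_num)).differentiableAt (by norm_num)

lemma lap_eq_sum_fderiv_fderiv {u : Plane → ℝ} {x : Plane} (h : ContDiffAt ℝ 2 u x) :
    lap u x = ∑ i, fderiv ℝ (fderiv ℝ u) x (EuclideanSpace.single i 1)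
      (EuclideanSpace.single i 1) := by
  unfold lap
  refine Finset.sum_congr rfl fun i _ => ?_
  have := h.differentiableAt_fderiv.hasFDerivAt.clm_apply
    (hasFDerivAt_const (EuclideanSpace.single i (1:ℝ) : Plane) x)
  rw [this.fderiv]
  simp

lemma lap_add {u v : Plane → ℝ} {x : Plane} (hu : ContDiffAt ℝ 2 u x)
    (hv : ContDiffAt ℝ 2 v x) : lap (fun y => u y + v y) x = lap u x + lap v x := by
  rw [lap_eq_of_hasFDerivAt (u' := fun y => fderiv ℝ u y + fderiv ℝ v y)
    (u'' := fun i => (fderiv ℝ (fderiv ℝ u) x + fderiv ℝ (fderiv ℝ v) x).flip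
      (EuclideanSpace.single i 1)), lap_eq_sum_fderiv_fderiv hu, lap_eq_sum_fderiv_fderiv hv,
      ← Finset.sum_add_distrib]
  · rfl
  · filter_upwards [hu.eventually_differentiableAt, hv.eventually_differentiableAt] with y h1 h2
    exact h1.hasFDerivAt.add h2.hasFDerivAt
  · intro i
    have := (hu.differentiableAt_fderiv.hasFDerivAt.add
      hv.differentiableAt_fderiv.hasFDerivAt).clm_apply
      (hasFDerivAt_const (EuclideanSpace.single i (1:ℝ) : Plane) x)
    simpa using this

lemma lap_const_mul {u : Plane → ℝ} {x : Plane} (hu : ContDiffAt ℝ 2 u x) (c : ℝ) :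
    lap (fun y => c * u y) x = c * lap u x := by
  rw [lap_eq_of_hasFDerivAt (u' := fun y => c • fderiv ℝ u y)
    (u'' := fun i => (c • fderiv ℝ (fderiv ℝ u) x).flip
      (EuclideanSpace.single i 1)), lap_eq_sum_fderiv_fderiv hu, Finset.mul_sum]
  · rfl
  · filter_upwards [hu.eventually_differentiableAt] with y h1
    exact h1.hasFDerivAt.const_smul c
  · intro i
    have := (hu.differentiableAt_fderiv.hasFDerivAt.const_smul c).clm_apply
      (hasFDerivAt_const (EuclideanSpace.single i (1:ℝ) : Plane) x)
    simpa using this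

lemma lap_const (c : ℝ) (x : Plane) : lap (fun _ => c) x = 0 := by
  simp [lap]

lemma lap_sub {u v : Plane → ℝ} {x : Plane} (hu : ContDiffAt ℝ 2 u x)
    (hv : ContDiffAt ℝ 2 v x) : lap (fun y => u y - v y) x = lap u x - lap v x := by
  have := lap_add hu (contDiffAt_const (c := (-1:ℝ)).mul hv)
  rw [lap_const_mul hv] at this
  calc _ = lap (fun y => u y + -1 * v y) x := by congr 1; ext y; ring
    _ = _ := by rw [this]; ring

/-- Laplacian of a function of the squared distance to `a`. -/
lemma lap_comp_sq_dist {φ φ' : ℝ → ℝ} {φ'' : ℝ} {a x : Plane}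
    (h1 : ∀ᶠ s in 𝓝 (‖x - a‖ ^ 2), HasDerivAt φ (φ' s) s)
    (h2 : HasDerivAt φ' φ'' (‖x - a‖ ^ 2)) :
    lap (fun y => φ (‖y - a‖ ^ 2)) x = 4 * φ'' * ‖x - a‖ ^ 2 + 4 * φ' (‖x - a‖ ^ 2) := by
  have hq : ∀ y : Plane, HasFDerivAt (fun y : Plane => ‖y - a‖ ^ 2)
      ((2:ℝ) • innerSL ℝ (y - a)) y := by
    intro y
    have := ((hasFDerivAt_id y).sub_const a).norm_sq
    refine this.congr_fderiv ?_
    ext v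
    simp
  have hqc : Tendsto (fun y : Plane => ‖y - a‖ ^ 2) (𝓝 x) (𝓝 (‖x - a‖ ^ 2)) :=
    (hq x).continuousAt
  have hci : ∀ i : Fin 2, ∀ y : Plane, innerSL ℝ y (EuclideanSpace.single i 1) = y i := by
    intro i y
    simp [innerSL_apply_apply, EuclideanSpace.inner_single_right]
  have hcd : ∀ i : Fin 2, HasFDerivAt (fun y : Plane => 2 * (y - a) i)
      ((2:ℝ) • (EuclideanSpace.proj i : Plane →L[ℝ] ℝ)) x := by
    intro i
    have := (((EuclideanSpace.proj i : Plane →L[ℝ] ℝ).hasFDerivAt (x := x)).sub_const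
      (a i)).const_mul (2:ℝ)
    refine this.congr_of_eventuallyEq (Eventually.of_forall fun y => ?_)
    simp
  rw [lap_eq_of_hasFDerivAt (u' := fun y => φ' (‖y - a‖ ^ 2) • ((2:ℝ) • innerSL ℝ (y - a)))
    (u'' := fun i => φ' (‖x - a‖ ^ 2) • ((2:ℝ) • (EuclideanSpace.proj i : Plane →L[ℝ] ℝ)) +
      (2 * (x - a) i) • (φ'' • ((2:ℝ) • innerSL ℝ (x - a))))]
  · have := EuclideanSpace.real_norm_sq_eq (x - a)
    simp only [Fin.sum_univ_two, _root_.add_apply, _root_.smul_apply,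
      hci, smul_eq_mul, PiLp.proj_apply] at this ⊢
    rw [this]
    simp
    ring
  · filter_upwards [hqc.eventually h1] with y hy
    exact hy.comp_hasFDerivAt y (hq y)
  · intro i
    have h3 : HasFDerivAt (fun y => φ' (‖y - a‖ ^ 2)) (φ'' • ((2:ℝ) • innerSL ℝ (x - a))) x :=
      h2.comp_hasFDerivAt x (hq x)
    have := h3.mul (hcd i)
    refine this.congr_of_eventuallyEq (Eventually.of_forall fun y => ?_)
    simp only [_root_.smul_apply, hci i (y - a), smul_eq_mul, Pi.mul_apply]

/-- The standard identification of the plane with `ℂ`. -/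
def planeToC : Plane ≃ₗᵢ[ℝ] ℂ := Complex.orthonormalBasisOneI.repr.symm

lemma planeToC_single_zero : planeToC (EuclideanSpace.single 0 1) = 1 := by
  simp [planeToC]

lemma planeToC_single_one : planeToC (EuclideanSpace.single 1 1) = Complex.I := by
  simp [planeToC]

lemma hasFDerivAt_comp_planar {F : ℂ → ℂ} {g : ℂ} {ι : Plane →L[ℝ] ℂ} {y z : Plane}
    (h : HasDerivAt F g (ι (y - z))) :
    HasFDerivAt (fun y => F (ι (y - z))) ((g • (1 : ℂ →L[ℝ] ℂ)).comp ι) y := by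
  have h1 : HasFDerivAt (fun y => ι (y - z)) ι y :=
    ι.hasFDerivAt.comp y ((hasFDerivAt_id y).sub_const z)
  exact HasFDerivAt.comp (f := fun y => ι (y - z)) y h.complexToReal_fderiv h1

lemma lap_comp_conformal_aux {u : Plane → ℝ} {F F' : ℂ → ℂ} {F'' : ℂ} {l : ℂ →L[ℝ] Plane}
    {ι : Plane →L[ℝ] ℂ} (hι0 : ι (EuclideanSpace.single 0 1) = 1)
    (hι1 : ι (EuclideanSpace.single 1 1) = Complex.I)
    {z b x : Plane} (hl1 : l 1 = EuclideanSpace.single 0 1)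
    (hlI : l Complex.I = EuclideanSpace.single 1 1 ∨ l Complex.I = -EuclideanSpace.single 1 1)
    (hF1 : ∀ᶠ ζ in 𝓝 (ι (x - z)), HasDerivAt F (F' ζ) ζ)
    (hF2 : HasDerivAt F' F'' (ι (x - z)))
    (hu : ContDiffAt ℝ 2 u (b + l (F (ι (x - z))))) :
    lap (fun y => u (b + l (F (ι (y - z))))) x =
      ‖F' (ι (x - z))‖ ^ 2 * lap u (b + l (F (ι (x - z)))) := by
  have hφd : ∀ {y : Plane}, HasDerivAt F (F' (ι (y - z))) (ι (y - z)) →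
      HasFDerivAt (fun y => b + l (F (ι (y - z))))
        (l.comp ((F' (ι (y - z)) • (1 : ℂ →L[ℝ] ℂ)).comp ι)) y := by
    intro y h
    exact (HasFDerivAt.comp (f := fun y => F (ι (y - z))) y l.hasFDerivAt
      (hasFDerivAt_comp_planar h)).const_add b
  have hιc : Tendsto (fun y => ι (y - z)) (𝓝 x) (𝓝 (ι (x - z))) := by
    have : Continuous (fun y => ι (y - z)) := by fun_prop
    exact this.continuousAt
  have hφx := hφd hF1.self_of_nhds
  have hφc : Tendsto (fun y => b + l (F (ι (y - z)))) (𝓝 x) (𝓝 (b + l (F (ι (x - z))))) :=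
    hφx.continuousAt
  have hmain := lap_eq_of_hasFDerivAt (x := x) (u := fun y => u (b + l (F (ι (y - z)))))
      (u' := fun y => (fderiv ℝ u (b + l (F (ι (y - z))))).comp
        (l.comp ((F' (ι (y - z)) • (1 : ℂ →L[ℝ] ℂ)).comp ι)))
      (u'' := fun i => (fderiv ℝ u (b + l (F (ι (x - z))))).comp
        (l.comp ((ι (EuclideanSpace.single i 1) • (F'' • (1 : ℂ →L[ℝ] ℂ)).comp ι))) +
        ((fderiv ℝ (fderiv ℝ u) (b + l (F (ι (x - z))))).comp
        (l.comp ((F' (ι (x - z)) • (1 : ℂ →L[ℝ] ℂ)).comp ι))).flip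
        (l (F' (ι (x - z)) * ι (EuclideanSpace.single i 1)))) ?_ ?_
  · rw [hmain, lap_eq_sum_fderiv_fderiv hu]
    have hdec : ∀ w : ℂ, l w = w.re • l 1 + w.im • l Complex.I := by
      intro w
      rw [← map_smul, ← map_smul, ← map_add]
      congr 1
      apply Complex.ext <;> simp
    set P := F' (ι (x - z))
    have hP : ‖P‖ ^ 2 = P.re ^ 2 + P.im ^ 2 := by
      rw [← Complex.normSq_eq_norm_sq, Complex.normSq_apply]; ring
    have hII : l (Complex.I * (F'' * Complex.I)) = - l F'' := by
      rw [← map_neg]; congr 1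
      rw [show Complex.I * (F'' * Complex.I) = F'' * (Complex.I * Complex.I) by ring,
        Complex.I_mul_I]; ring
    simp [Fin.sum_univ_two, hι0, hι1, hP, hII]
    rw [hdec P, hdec (P * Complex.I)]
    rcases hlI with h | h <;> simp [hl1, h] <;> ring
  · filter_upwards [hφc.eventually hu.eventually_differentiableAt, hιc.eventually hF1] with y h1 h2
    exact HasFDerivAt.comp (f := fun y => b + l (F (ι (y - z)))) y h1.hasFDerivAt (hφd h2)
  · intro i
    have h1 := HasFDerivAt.comp (f := fun y => b + l (F (ι (y - z)))) x
      hu.differentiableAt_fderiv.hasFDerivAt hφx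
    have h2 := HasFDerivAt.comp
      (f := fun y => F' (ι (y - z)) * ι (EuclideanSpace.single i 1)) x l.hasFDerivAt
      ((hasFDerivAt_comp_planar hF2).mul_const (ι (EuclideanSpace.single i 1)))
    exact h1.clm_apply h2

/-- Conformal covariance of the Laplacian under holomorphic and antiholomorphic maps. -/
lemma lap_comp_conformal {u : Plane → ℝ} {F F' : ℂ → ℂ} {F'' : ℂ} {l : ℂ →L[ℝ] Plane}
    {z b x : Plane} (hl1 : l 1 = EuclideanSpace.single 0 1)
    (hlI : l Complex.I = EuclideanSpace.single 1 1 ∨ l Complex.I = -EuclideanSpace.single 1 1)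
    (hF1 : ∀ᶠ ζ in 𝓝 (planeToC (x - z)), HasDerivAt F (F' ζ) ζ)
    (hF2 : HasDerivAt F' F'' (planeToC (x - z)))
    (hu : ContDiffAt ℝ 2 u (b + l (F (planeToC (x - z))))) :
    lap (fun y => u (b + l (F (planeToC (y - z))))) x =
      ‖F' (planeToC (x - z))‖ ^ 2 * lap u (b + l (F (planeToC (x - z)))) :=
  lap_comp_conformal_aux (ι := planeToC.toContinuousLinearEquiv.toContinuousLinearMap)
    planeToC_single_zero planeToC_single_one hl1 hlI hF1 hF2 hu

/-- The identity map `ℂ → ℝ²`. -/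
def cToPlane : ℂ →L[ℝ] Plane := planeToC.symm.toContinuousLinearEquiv.toContinuousLinearMap

lemma cToPlane_one : cToPlane 1 = EuclideanSpace.single 0 1 := by
  rw [← planeToC_single_zero]; exact planeToC.symm_apply_apply _

lemma cToPlane_I : cToPlane Complex.I = EuclideanSpace.single 1 1 := by
  rw [← planeToC_single_one]; exact planeToC.symm_apply_apply _

lemma cToPlane_planeToC (x : Plane) : cToPlane (planeToC x) = x := planeToC.symm_apply_apply _

lemma planeToC_cToPlane (ζ : ℂ) : planeToC (cToPlane ζ) = ζ := planeToC.apply_symm_apply _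

lemma cToPlane_apply_zero (ζ : ℂ) : cToPlane ζ 0 = ζ.re := by
  have : cToPlane ζ = Complex.orthonormalBasisOneI.repr ζ := rfl
  rw [this]; simp

/-- The real part of an entire function is harmonic. -/
lemma contDiff_re_entire {F : ℂ → ℂ} (hF : Differentiable ℂ F) :
    ContDiff ℝ 2 (fun y : Plane => (F (planeToC y)).re) := by
  have h1 : ContDiff ℂ 2 F := hF.contDiff
  have h2 : ContDiff ℝ 2 F := h1.restrict_scalars ℝ
  exact Complex.reCLM.contDiff.comp (h2.comp planeToC.toContinuousLinearEquiv.contDiff)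

lemma lap_re_entire {F : ℂ → ℂ} (hF : Differentiable ℂ F) (x : Plane) :
    lap (fun y : Plane => (F (planeToC y)).re) x = 0 := by
  have hF' : Differentiable ℂ (deriv F) := by
    have h1 : ContDiff ℂ 2 F := hF.contDiff
    exact ((contDiff_succ_iff_deriv (n := 1)).1 h1).2.2.differentiable (by norm_num)
  have hcoord : ∀ y, HasFDerivAt (fun y : Plane => y 0) (EuclideanSpace.proj 0 : Plane →L[ℝ] ℝ) y :=
    fun y => (EuclideanSpace.proj 0 : Plane →L[ℝ] ℝ).hasFDerivAt
  have h0 : ∀ y, lap (fun y : Plane => y 0) y = 0 := by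
    intro y
    rw [lap_eq_of_hasFDerivAt (u' := fun _ => (EuclideanSpace.proj 0 : Plane →L[ℝ] ℝ))
      (u'' := fun _ => 0) (Eventually.of_forall hcoord) (fun i => hasFDerivAt_const _ _)]
    simp
  have := lap_comp_conformal (u := fun y : Plane => y 0) (F := F) (F' := deriv F)
    (F'' := deriv (deriv F) (planeToC (x - 0))) (l := cToPlane) (z := 0) (b := 0) (x := x)
    cToPlane_one (Or.inl cToPlane_I) (Eventually.of_forall fun ζ => (hF ζ).hasDerivAt)
    (hF' _).hasDerivAt (EuclideanSpace.proj 0 : Plane →L[ℝ] ℝ).contDiff.contDiffAt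
  rw [h0, mul_zero] at this
  simpa [cToPlane_apply_zero] using this

lemma second_deriv_nonneg_of_isLocalMin {u : Plane → ℝ} {x : Plane} (hu : ContDiffAt ℝ 2 u x)
    (h : IsLocalMin u x) (e : Plane) : 0 ≤ fderiv ℝ (fderiv ℝ u) x e e := by
  by_contra! hneg
  have hline : ∀ t : ℝ, HasDerivAt (fun t : ℝ => x + t • e) e t := by
    intro t
    simpa using ((hasDerivAt_id t).smul_const e).const_add x
  have hc : Tendsto (fun t : ℝ => x + t • e) (𝓝 0) (𝓝 x) := by
    have : ContinuousAt (fun t : ℝ => x + t • e) 0 := (hline 0).continuousAt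
    simpa [ContinuousAt] using this
  have hd1 : ∀ᶠ t in 𝓝 (0:ℝ), HasDerivAt (fun t : ℝ => u (x + t • e))
      (fderiv ℝ u (x + t • e) e) t := by
    filter_upwards [hc.eventually hu.eventually_differentiableAt] with t ht
    exact HasFDerivAt.comp_hasDerivAt (f := fun t : ℝ => x + t • e) t ht.hasFDerivAt (hline t)
  have hd2 : HasDerivAt (fun t : ℝ => fderiv ℝ u (x + t • e) e)
      (fderiv ℝ (fderiv ℝ u) x e e) 0 := by
    have h0 : HasFDerivAt (fderiv ℝ u) (fderiv ℝ (fderiv ℝ u) x) (x + (0:ℝ) • e) := by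
      rw [zero_smul, add_zero]
      exact hu.differentiableAt_fderiv.hasFDerivAt
    have h1 : HasDerivAt (fun t : ℝ => fderiv ℝ u (x + t • e)) (fderiv ℝ (fderiv ℝ u) x e) 0 :=
      HasFDerivAt.comp_hasDerivAt (f := fun t : ℝ => x + t • e) 0 h0 (hline 0)
    have h2 := h1.clm_apply (hasDerivAt_const (0:ℝ) e)
    simpa using h2
  generalize hg : (fun t : ℝ => u (x + t • e)) = g at hd1
  have hgt : ∀ t, g t = u (x + t • e) := fun t => by rw [← hg]
  have hd1' : deriv g =ᶠ[𝓝 0] fun t => fderiv ℝ u (x + t • e) e := by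
    filter_upwards [hd1] with t ht using ht.deriv
  have hd2 : deriv (deriv g) 0 = fderiv ℝ (fderiv ℝ u) x e e := by
    rw [hd1'.deriv_eq, hd2.deriv]
  have hmin : IsLocalMin g 0 := by
    filter_upwards [hc.eventually h] with t ht
    simpa [hgt] using ht
  have hmax : IsLocalMax g 0 := isLocalMax_of_deriv_deriv_neg (by rw [hd2]; exact hneg)
    hmin.deriv_eq_zero hd1.self_of_nhds.continuousAt
  have hconst : g =ᶠ[𝓝 0] fun _ => g 0 := by
    filter_upwards [hmin, hmax] with t h1 h2 using le_antisymm h2 h1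
  have hz : deriv g =ᶠ[𝓝 0] fun _ => 0 := by
    filter_upwards [hconst.eventuallyEq_nhds] with t ht
    rw [ht.deriv_eq]; simp
  have : deriv (deriv g) 0 = 0 := by rw [hz.deriv_eq]; simp
  rw [hd2] at this
  exact hneg.ne this

lemma lap_nonneg_of_isLocalMin {u : Plane → ℝ} {x : Plane} (hu : ContDiffAt ℝ 2 u x)
    (h : IsLocalMin u x) : 0 ≤ lap u x := by
  rw [lap_eq_sum_fderiv_fderiv hu]
  refine Finset.sum_nonneg fun i _ => ?_
  exact second_deriv_nonneg_of_isLocalMin hu h _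

lemma contDiffAt_sq_dist (a x : Plane) : ContDiffAt ℝ 2 (fun y => ‖y - a‖ ^ 2) x :=
  ((contDiff_id.sub contDiff_const).norm_sq ℝ).contDiffAt

lemma sq_dist_pos {a x : Plane} (h : x ≠ a) : 0 < ‖x - a‖ ^ 2 := by
  have := norm_pos_iff.2 (sub_ne_zero.2 h)
  positivity

/-- Weak minimum principle for superharmonic functions, with one exceptional point. -/
lemma min_principle {D : Set Plane} (hD : IsOpen D) (hDb : Bornology.IsBounded D)
    {w : Plane → ℝ} (hw : ContinuousOn w (closure D)) (e : Plane)
    (hC : ∀ x ∈ D, x ≠ e → ContDiffAt ℝ 2 w x) (hlap : ∀ x ∈ D, x ≠ e → lap w x ≤ 0)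
    {m : ℝ} (hb : ∀ x ∈ frontier D, m ≤ w x) : ∀ x ∈ D, m ≤ w x := by
  have hcomp : IsCompact (closure D) := hDb.isCompact_closure
  obtain ⟨R, hR⟩ := hcomp.isBounded.subset_ball_lt 1 e
  obtain ⟨hR1, hR⟩ := hR
  obtain ⟨N, hN⟩ := hcomp.bddBelow_image hw
  have hN : ∀ x ∈ closure D, N ≤ w x := fun x hx => hN (mem_image_of_mem w hx)
  set ψ : Plane → ℝ := fun y => R ^ 2 - ‖y - e‖ ^ 2 + Real.log (R ^ 2) - Real.log (‖y - e‖ ^ 2)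
    with hψ
  have hψC : ∀ x, x ≠ e → ContDiffAt ℝ 2 ψ x := by
    intro x hx
    exact (((contDiffAt_const.sub (contDiffAt_sq_dist e x)).add contDiffAt_const).sub
      ((contDiffAt_sq_dist e x).log (sq_dist_pos hx).ne'))
  have hψlap : ∀ x, x ≠ e → lap ψ x = -4 := by
    intro x hx
    have hp := sq_dist_pos hx
    have := lap_comp_sq_dist (φ := fun s => R ^ 2 - s + Real.log (R ^ 2) - Real.log s)
      (φ' := fun s => -1 - s⁻¹) (φ'' := ((‖x - e‖ ^ 2) ^ 2)⁻¹) (a := e) (x := x) ?_ ?_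
    · rw [hψ, this]; field_simp; ring
    · filter_upwards [lt_mem_nhds hp] with s hs
      have := (((hasDerivAt_id s).const_sub (R ^ 2)).add_const (Real.log (R ^ 2))).sub
        (Real.hasDerivAt_log hs.ne')
      exact (this.congr_deriv (by simp)).congr_of_eventuallyEq (Eventually.of_forall fun _ => rfl)
    · have := (hasDerivAt_inv hp.ne').const_sub (-1)
      simpa using this
  have hψpos : ∀ x ∈ closure D, x ≠ e → 0 ≤ ψ x := by
    intro x hx hxe
    have h1 := hR hx
    rw [mem_ball, dist_eq_norm] at h1
    have hp := sq_dist_pos hxe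
    have h2 : ‖x - e‖ ^ 2 ≤ R ^ 2 := by gcongr
    have h3 := Real.log_le_log hp h2
    simp only [hψ]; linarith
  have key : ∀ x ∈ D, x ≠ e → m ≤ w x := by
    intro x hx hxe
    have hlim : Tendsto (fun ε : ℝ => w x + ε * ψ x) (𝓝[>] 0) (𝓝 (w x)) := by
      have : Continuous (fun ε : ℝ => w x + ε * ψ x) := by fun_prop
      have := (this.tendsto 0).mono_left (nhdsWithin_le_nhds (s := Ioi 0))
      simpa using this
    refine ge_of_tendsto hlim ?_
    filter_upwards [self_mem_nhdsWithin] with ε hε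
    have hε : 0 < ε := hε
    have hxp : 0 < ‖x - e‖ := norm_pos_iff.2 (sub_ne_zero.2 hxe)
    -- choose a small exceptional radius
    obtain ⟨δ, hδ0, hδx, hδ⟩ : ∃ δ > 0, δ < ‖x - e‖ ∧ m ≤ N - ε * Real.log (δ ^ 2) := by
      have ht : Tendsto (fun δ : ℝ => N - ε * Real.log (δ ^ 2)) (𝓝[>] 0) atTop := by
        have h1 : Tendsto (fun δ : ℝ => Real.log (δ ^ 2)) (𝓝[>] 0) atBot := by
          have : (fun δ : ℝ => Real.log (δ ^ 2)) = fun δ => 2 * Real.log δ := by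
            ext δ; simp
          rw [this]
          exact Tendsto.const_mul_atBot (by norm_num) Real.tendsto_log_nhdsGT_zero
        have h2 : Tendsto (fun δ : ℝ => -(ε * Real.log (δ ^ 2))) (𝓝[>] 0) atTop :=
          tendsto_neg_atBot_atTop.comp (h1.const_mul_atBot hε)
        simpa [sub_eq_add_neg] using tendsto_atTop_add_const_left _ N h2
      have h1 : ∀ᶠ δ in 𝓝[>] (0:ℝ), 0 < δ := self_mem_nhdsWithin
      have h2 : ∀ᶠ δ in 𝓝[>] (0:ℝ), δ < ‖x - e‖ := nhdsWithin_le_nhds (gt_mem_nhds hxp)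
      have h3 := (ht.eventually_ge_atTop m).and (h1.and h2)
      obtain ⟨δ, h4, h5, h6⟩ := h3.exists
      exact ⟨δ, h5, h6, h4⟩
    set Q := closure D \ ball e δ
    have hQ : IsCompact Q := hcomp.diff isOpen_ball
    have hQe : ∀ y ∈ Q, y ≠ e := by
      rintro y hy rfl
      exact hy.2 (mem_ball_self hδ0)
    have hxQ : x ∈ Q := ⟨subset_closure hx, by simp [dist_eq_norm, hδx.le]⟩
    have hcont : ContinuousOn (fun y => w y + ε * ψ y) Q := by
      refine (hw.mono sdiff_subset).add (continuousOn_const.mul fun y hy => ?_)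
      exact (hψC y (hQe y hy)).continuousAt.continuousWithinAt
    obtain ⟨y, hyQ, hy⟩ := hQ.exists_isMinOn ⟨x, hxQ⟩ hcont
    refine le_trans ?_ (hy hxQ)
    have hye := hQe y hyQ
    by_cases hyD : y ∈ D
    · have hyδ : δ ≤ ‖y - e‖ := by
        have := hyQ.2; rw [mem_ball, dist_eq_norm] at this; exact not_lt.1 this
      rcases hyδ.eq_or_lt with h | h
      · have h1 := hR hyQ.1
        rw [mem_ball, dist_eq_norm] at h1
        have h2 : ‖y - e‖ ^ 2 ≤ R ^ 2 := by gcongr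
        have h3 : 0 ≤ Real.log (R ^ 2) := Real.log_nonneg (by nlinarith)
        have h4 := hN y hyQ.1
        have h5 : ε * -Real.log (δ ^ 2) ≤ ε * ψ y := by
          apply mul_le_mul_of_nonneg_left _ hε.le
          simp only [hψ, ← h] at h2 ⊢; linarith
        show m ≤ w y + ε * ψ y
        linarith
      · exfalso
        have hCw := hC y hyD hye
        have hCψ := hψC y hye
        have hloc : IsLocalMin (fun y => w y + ε * ψ y) y := by
          have h1 : D \ closedBall e δ ∈ 𝓝 y :=
            (hD.sdiff isClosed_closedBall).mem_nhds ⟨hyD, by simp [dist_eq_norm, h]⟩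
          filter_upwards [h1] with v hv
          exact hy ⟨subset_closure hv.1, fun h => hv.2 (ball_subset_closedBall h)⟩
        have h1 := lap_nonneg_of_isLocalMin (hCw.add (contDiffAt_const.mul hCψ)) hloc
        have h2 := lap_add hCw ((contDiffAt_const (c := ε)).mul hCψ)
        rw [lap_const_mul hCψ, hψlap y hye] at h2
        have h3 := hlap y hyD hye
        have h4 : lap (fun y => w y + ε * ψ y) y < 0 := by rw [h2]; linarith
        exact absurd h1 (not_le.2 h4)
    · have hf : y ∈ frontier D := ⟨hyQ.1, by rwa [hD.interior_eq]⟩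
      have h1 := hb y hf
      have h2 := mul_nonneg hε.le (hψpos y hyQ.1 hye)
      show m ≤ w y + ε * ψ y
      linarith
  intro x hx
  by_cases hxe : x = e
  · subst hxe
    have hcx : Tendsto w (𝓝[≠] x) (𝓝 (w x)) :=
      ((hw.mono subset_closure).continuousAt (hD.mem_nhds hx)).tendsto.mono_left nhdsWithin_le_nhds
    refine ge_of_tendsto hcx ?_
    filter_upwards [self_mem_nhdsWithin, nhdsWithin_le_nhds (hD.mem_nhds hx)] with y h1 h2
    exact key y h2 h1
  · exact key x hx hxe

/-- Minimum principle in the presence of a positive strict supersolution. -/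
lemma narrow_principle {D : Set Plane} (hD : IsOpen D) (hDb : Bornology.IsBounded D)
    {w φ : Plane → ℝ} {A : ℝ} (hw : ContinuousOn w (closure D)) (hφ : ContinuousOn φ (closure D))
    (hwC : ∀ x ∈ D, ContDiffAt ℝ 2 w x) (hφC : ∀ x ∈ D, ContDiffAt ℝ 2 φ x)
    (hφpos : ∀ x ∈ closure D, 0 < φ x) (hb : ∀ x ∈ frontier D, 0 ≤ w x)
    (hφlap : ∀ x ∈ D, lap φ x < -A * φ x) (hwlap : ∀ x ∈ D, w x < 0 → lap w x ≤ -A * w x) :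
    ∀ x ∈ D, 0 ≤ w x := by
  by_contra! hcon
  obtain ⟨x, hx, hxw⟩ := hcon
  obtain ⟨y, hyD, hy⟩ := hDb.isCompact_closure.exists_isMinOn ⟨x, subset_closure hx⟩
    (hw.div hφ fun x hx => (hφpos x hx).ne')
  set m := w y / φ y with hm
  have hm0 : m < 0 := lt_of_le_of_lt (hy (subset_closure hx))
    (div_neg_of_neg_of_pos hxw (hφpos x (subset_closure hx)))
  have hφy := hφpos y hyD
  have hwy : w y = m * φ y := by rw [hm]; field_simp
  have hwy0 : w y < 0 := by rw [hwy]; exact mul_neg_of_neg_of_pos hm0 hφy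
  have hyD' : y ∈ D := by
    by_contra hn
    exact absurd (hb y ⟨hyD, by rwa [hD.interior_eq]⟩) (not_le.2 hwy0)
  have hloc : IsLocalMin (fun v => w v - m * φ v) y := by
    filter_upwards [hD.mem_nhds hyD'] with v hv
    have h1 : m ≤ w v / φ v := hy (subset_closure hv)
    rw [le_div_iff₀ (hφpos v (subset_closure hv))] at h1
    rw [hwy]; linarith
  have h1 := lap_nonneg_of_isLocalMin ((hwC y hyD').sub (contDiffAt_const.mul (hφC y hyD'))) hloc
  have h2 := lap_sub (hwC y hyD') ((contDiffAt_const (c := m)).mul (hφC y hyD'))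
  rw [lap_const_mul (hφC y hyD')] at h2
  have h3 : lap (fun v => w v - m * φ v) y < 0 := by
    rw [h2]
    have h4 := hwlap y hyD' hwy0
    have h5 := mul_lt_mul_of_neg_left (hφlap y hyD') hm0
    rw [hwy] at h4
    nlinarith
  exact absurd h1 (not_le.2 h3)

lemma exists_entire_of_mem_span_fourier {φ : C(AddCircle (2 * π), ℂ)}
    (h : φ ∈ Submodule.span ℂ (range (@fourier (2 * π)))) :
    ∃ F G : ℂ → ℂ, Differentiable ℂ F ∧ Differentiable ℂ G ∧
      ∀ θ, φ θ = F (AddCircle.toCircle θ) + starRingEnd ℂ (G (AddCircle.toCircle θ)) := by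
  induction h using Submodule.span_induction with
  | mem x hx =>
    obtain ⟨n, rfl⟩ := hx
    obtain ⟨k, rfl | rfl⟩ := n.eq_nat_or_neg
    · refine ⟨fun ζ => ζ ^ k, fun _ => 0, by fun_prop, by fun_prop, fun θ => ?_⟩
      rw [fourier_apply, AddCircle.toCircle_zsmul]
      simp
    · refine ⟨fun _ => 0, fun ζ => ζ ^ k, by fun_prop, by fun_prop, fun θ => ?_⟩
      rw [fourier_neg, fourier_apply, AddCircle.toCircle_zsmul]
      simp
  | zero => exact ⟨0, 0, differentiable_const _, differentiable_const _, by simp⟩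
  | add x y _ _ hx hy =>
    obtain ⟨F, G, hF, hG, h⟩ := hx
    obtain ⟨F', G', hF', hG', h'⟩ := hy
    refine ⟨fun ζ => F ζ + F' ζ, fun ζ => G ζ + G' ζ, hF.add hF', hG.add hG', fun θ => ?_⟩
    simp only [ContinuousMap.add_apply, h, h', map_add]
    ring
  | smul c x _ hx =>
    obtain ⟨F, G, hF, hG, h⟩ := hx
    refine ⟨fun ζ => c * F ζ, fun ζ => starRingEnd ℂ c * G ζ, hF.const_mul _, hG.const_mul _,
      fun θ => ?_⟩
    simp only [ContinuousMap.smul_apply, h, map_mul, smul_eq_mul, Complex.conj_conj]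
    ring

/-- Continuous functions on a circle are uniform limits of real parts of entire functions. -/
lemma exists_entire_re_approx {f : Plane → ℝ} {a : Plane} {R ε : ℝ} (hR : 0 < R)
    (hf : ContinuousOn f (sphere a R)) (hε : 0 < ε) :
    ∃ F : ℂ → ℂ, Differentiable ℂ F ∧ ∀ x ∈ sphere a R, |(F (planeToC x)).re - f x| ≤ ε := by
  have : Fact (0 < 2 * π) := ⟨by positivity⟩
  have hmem : ∀ θ : AddCircle (2 * π),
      a + R • cToPlane (AddCircle.toCircle θ : ℂ) ∈ sphere a R := by
    intro θ
    have : ‖cToPlane (AddCircle.toCircle θ : ℂ)‖ = 1 := by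
      rw [← planeToC.norm_map, planeToC_cToPlane]; exact Circle.norm_coe _
    simp [norm_smul, this, abs_of_pos hR]
  have hcont : Continuous fun θ : AddCircle (2 * π) =>
      (f (a + R • cToPlane (AddCircle.toCircle θ : ℂ)) : ℂ) := by
    refine Complex.continuous_ofReal.comp (hf.comp_continuous ?_ hmem)
    have : Continuous fun θ : AddCircle (2 * π) => (AddCircle.toCircle θ : ℂ) :=
      continuous_subtype_val.comp AddCircle.continuous_toCircle
    fun_prop
  set φ₀ : C(AddCircle (2 * π), ℂ) := ⟨_, hcont⟩ with hφ₀
  have hcl : φ₀ ∈ closure (Submodule.span ℂ (range (@fourier (2 * π))) : Set _) := by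
    rw [← Submodule.topologicalClosure_coe, span_fourier_closure_eq_top]
    trivial
  obtain ⟨φ, hφ, hd⟩ := Metric.mem_closure_iff.1 hcl ε hε
  obtain ⟨F, G, hF, hG, h⟩ := exists_entire_of_mem_span_fourier hφ
  refine ⟨fun ζ => F ((ζ - planeToC a) / R) + G ((ζ - planeToC a) / R), ?_, ?_⟩
  · exact (hF.comp (by fun_prop)).add (hG.comp (by fun_prop))
  · intro x hx
    have hxR : ‖x - a‖ = R := by simpa [dist_eq_norm] using hx
    have hnorm : ‖(planeToC x - planeToC a) / R‖ = 1 := by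
      rw [← map_sub, norm_div, planeToC.norm_map, hxR, Complex.norm_real, Real.norm_eq_abs,
        abs_of_pos hR, div_self hR.ne']
    obtain ⟨θ, hθ'⟩ : ∃ θ : AddCircle (2 * π),
        (AddCircle.toCircle θ : ℂ) = (planeToC x - planeToC a) / R := by
      refine ⟨((Complex.arg ((planeToC x - planeToC a) / R) : ℝ) : AddCircle (2 * π)), ?_⟩
      rw [AddCircle.toCircle_apply_mk, div_self (by positivity), one_mul, Circle.coe_exp]
      have := Complex.norm_mul_exp_arg_mul_I ((planeToC x - planeToC a) / R)
      rwa [hnorm, Complex.ofReal_one, one_mul] at this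
    have hx' : a + R • cToPlane (AddCircle.toCircle θ : ℂ) = x := by
      rw [hθ', ← map_smul, Complex.real_smul, mul_div_cancel₀ _ (by exact_mod_cast hR.ne'),
        ← map_sub, cToPlane_planeToC]
      abel
    have h1 : dist (φ₀ θ) (φ θ) ≤ ε := (ContinuousMap.dist_apply_le_dist θ).trans hd.le
    rw [dist_comm, dist_eq_norm] at h1
    have h2 := (Complex.abs_re_le_norm _).trans h1
    rw [h, hθ'] at h2
    simp only [hφ₀, ContinuousMap.coe_mk, hx'] at h2
    simpa using h2

/-- Harnack inequality for real parts of entire functions. -/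
lemma harnack_re_entire {F : ℂ → ℂ} (hF : Differentiable ℂ F) {c : ℂ} {R : ℝ} (hR : 0 < R)
    (hpos : ∀ ζ ∈ sphere c R, 0 ≤ (F ζ).re) {z w : ℂ} (hz : z ∈ closedBall c (R / 2))
    (hw : w ∈ closedBall c (R / 2)) : (F z).re ≤ 9 * (F w).re := by
  have habs : |R| = R := abs_of_pos hR
  have key : ∀ z ∈ closedBall c (R / 2),
      (F z).re ≤ 3 * Real.circleAverage (fun ζ => (F ζ).re) c R ∧
      1 / 3 * Real.circleAverage (fun ζ => (F ζ).re) c R ≤ (F z).re := by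
    intro z hz
    have hz' : ‖z - c‖ ≤ R / 2 := by simpa [dist_eq_norm] using hz
    have hzb : z ∈ ball c R := by rw [mem_ball, dist_eq_norm]; linarith
    have hd : DiffContOnCl ℂ F (ball c R) := hF.diffContOnCl
    have h1 := hd.circleAverage_re_herglotzRieszKernel_smul hzb
    have hcF : ContinuousOn F (sphere c |R|) := hF.continuous.continuousOn
    have hck : ContinuousOn (fun ζ => (herglotzRieszKernel c z ζ).re) (sphere c |R|) :=
      Complex.continuous_re.comp_continuousOn (continuousOn_herglotzRieszKernel_sphere hzb)
    have hcirc : CircleIntegrable ((Complex.re ∘ herglotzRieszKernel c z) • F) c R :=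
      (ContinuousOn.smul hck hcF).circleIntegrable'
    have h2 := Complex.reCLM.circleAverage_comp_comm hcirc
    rw [h1] at h2
    have h3 : (F z).re = Real.circleAverage
        (fun ζ => (herglotzRieszKernel c z ζ).re * (F ζ).re) c R := by
      rw [← Complex.reCLM_apply, ← h2]
      congr 1
      ext ζ
      simp
    have hreF : ContinuousOn (fun ζ => (F ζ).re) (sphere c |R|) :=
      Complex.continuous_re.comp_continuousOn hcF
    have hi1 : CircleIntegrable (fun ζ => (herglotzRieszKernel c z ζ).re * (F ζ).re) c R :=
      (hck.mul hreF).circleIntegrable'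
    have hbd : ∀ ζ ∈ sphere c R, 1 / 3 ≤ (herglotzRieszKernel c z ζ).re ∧
        (herglotzRieszKernel c z ζ).re ≤ 3 := by
      intro ζ hζ
      have hn := norm_nonneg (z - c)
      refine ⟨le_trans ?_ (le_re_herglotzRieszKernel hζ hzb),
        (re_herglotzRieszKernel_le hζ hzb).trans ?_⟩
      · rw [div_le_div_iff₀ (by norm_num) (by linarith)]; linarith
      · rw [div_le_iff₀ (by linarith)]; linarith
    constructor
    · rw [h3, ← smul_eq_mul, ← circleAverage_fun_smul]
      refine Real.circleAverage_mono hi1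
        (ContinuousOn.circleIntegrable' (by fun_prop)) fun ζ hζ => ?_
      rw [habs] at hζ
      exact mul_le_mul_of_nonneg_right (hbd ζ hζ).2 (hpos ζ hζ)
    · rw [h3, ← smul_eq_mul, ← circleAverage_fun_smul]
      refine Real.circleAverage_mono
        (ContinuousOn.circleIntegrable' (by fun_prop)) hi1 fun ζ hζ => ?_
      rw [habs] at hζ
      exact mul_le_mul_of_nonneg_right (hbd ζ hζ).1 (hpos ζ hζ)
  linarith [(key z hz).1, (key w hw).2]

/-- A radial function with Laplacian a power of the distance. -/
lemma lap_rpow_dist {a x : Plane} (hx : x ≠ a) (b : ℝ) :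
    ContDiffAt ℝ 2 (fun y : Plane => (‖y - a‖ ^ 2) ^ (b / 2)) x ∧
    lap (fun y : Plane => (‖y - a‖ ^ 2) ^ (b / 2)) x = b ^ 2 * ‖x - a‖ ^ (b - 2) := by
  have hp := sq_dist_pos hx
  refine ⟨(contDiffAt_sq_dist a x).rpow_const_of_ne hp.ne', ?_⟩
  rw [lap_comp_sq_dist (φ := fun s => s ^ (b / 2)) (φ' := fun s => b / 2 * s ^ (b / 2 - 1))
    (φ'' := b / 2 * ((b / 2 - 1) * (‖x - a‖ ^ 2) ^ (b / 2 - 1 - 1)))]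
  · have h1 : (‖x - a‖ ^ 2) ^ (b / 2 - 1 - 1) * ‖x - a‖ ^ 2 = (‖x - a‖ ^ 2) ^ (b / 2 - 1) := by
      rw [Real.rpow_sub_one hp.ne' (b / 2 - 1), div_mul_cancel₀ _ hp.ne']
    have h2 : (‖x - a‖ ^ 2) ^ (b / 2 - 1) = ‖x - a‖ ^ (b - 2) := by
      rw [← Real.rpow_natCast, ← Real.rpow_mul (norm_nonneg _)]; congr 1; push_cast; ring
    rw [← h2, show 4 * (b / 2 * ((b / 2 - 1) * (‖x - a‖ ^ 2) ^ (b / 2 - 1 - 1))) * ‖x - a‖ ^ 2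
      = 2 * b * (b / 2 - 1) * ((‖x - a‖ ^ 2) ^ (b / 2 - 1 - 1) * ‖x - a‖ ^ 2) by ring, h1]
    ring
  · filter_upwards [lt_mem_nhds hp] with s hs
    exact Real.hasDerivAt_rpow_const (Or.inl hs.ne')
  · exact (Real.hasDerivAt_rpow_const (Or.inl hp.ne')).const_mul _

lemma sq_dist_rpow (x a : Plane) (b : ℝ) : (‖x - a‖ ^ 2) ^ (b / 2) = ‖x - a‖ ^ b := by
  rw [← Real.rpow_natCast, ← Real.rpow_mul (norm_nonneg _)]; congr 1; push_cast; ring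

lemma closure_diff_closedBall_subset (a : Plane) (r d : ℝ) :
    closure (ball a d \ closedBall a r) ⊆ closedBall a d \ ball a r := by
  refine closure_minimal (fun x hx => ⟨ball_subset_closedBall hx.1,
    fun h => hx.2 (ball_subset_closedBall h)⟩) (isClosed_closedBall.sdiff isOpen_ball)

/-- A Harnack-type estimate for subharmonic functions with a zero and controlled Laplacian. -/
lemma le_of_lap_le_of_zero {v : Plane → ℝ} {a x₀ : Plane} {R κ b : ℝ} (hR : 0 < R) (hb : 0 < b)
    (hκ : 0 ≤ κ) (hv : ContinuousOn v (closedBall a R))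
    (hC : ∀ x ∈ ball a R, x ≠ a → ContDiffAt ℝ 2 v x)
    (hlap : ∀ x ∈ ball a R, x ≠ a → 0 ≤ lap v x ∧ lap v x ≤ κ * ‖x - a‖ ^ (b - 2))
    (hpos : ∀ x ∈ closedBall a R, 0 ≤ v x)
    (hx₀ : x₀ ∈ closedBall a (R / 2)) (hv₀ : v x₀ = 0) :
    ∀ x ∈ closedBall a (R / 2), v x ≤ 9 * κ * R ^ b / b ^ 2 := by
  intro x hx
  refine le_of_forall_pos_le_add fun ε' hε' => ?_
  obtain ⟨ε, hε, rfl⟩ : ∃ ε > 0, 18 * ε = ε' := ⟨ε' / 18, by positivity, by ring⟩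
  obtain ⟨F, hF, hFv⟩ := exists_entire_re_approx hR (hv.mono sphere_subset_closedBall) hε
  have hHC := contDiff_re_entire hF
  have hHlap := lap_re_entire hF
  generalize hH : (fun y : Plane => (F (planeToC y)).re) = H at hHC hHlap
  have hHx : ∀ y, H y = (F (planeToC y)).re := fun y => by rw [← hH]
  have hcl : closure (ball a R) = closedBall a R := closure_ball a hR.ne'
  have hfr : frontier (ball a R) = sphere a R := frontier_ball a hR.ne'
  have hsub : closedBall a (R / 2) ⊆ ball a R := closedBall_subset_ball (by linarith)
  have hHv : ∀ y ∈ sphere a R, |H y - v y| ≤ ε := fun y hy => by rw [hHx]; exact hFv y hy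
  have hle : ∀ y ∈ ball a R, v y ≤ H y + ε := by
    intro y hy
    have := min_principle (w := fun y => H y - v y) isOpen_ball isBounded_ball
      (by rw [hcl]; exact hHC.continuous.continuousOn.sub hv) a
      (fun z hz hza => hHC.contDiffAt.sub (hC z hz hza)) (m := -ε)
      (fun z hz hza => by
        rw [lap_sub hHC.contDiffAt (hC z hz hza), hHlap]; linarith [(hlap z hz hza).1])
      (fun z hz => by rw [hfr] at hz; exact (abs_le.1 (hHv z hz)).1) y hy
    linarith
  have hge : ∀ y ∈ ball a R, H y + κ / b ^ 2 * ‖y - a‖ ^ b - v y ≤ ε + κ / b ^ 2 * R ^ b := by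
    intro y hy
    have hS : ∀ z : Plane, z ≠ a →
        ContDiffAt ℝ 2 (fun y : Plane => κ / b ^ 2 * (‖y - a‖ ^ 2) ^ (b / 2)) z :=
      fun z hz => contDiffAt_const.mul (lap_rpow_dist hz b).1
    have hcS : Continuous fun y : Plane => κ / b ^ 2 * (‖y - a‖ ^ 2) ^ (b / 2) :=
      continuous_const.mul (Continuous.rpow_const (by fun_prop) fun _ => Or.inr (by positivity))
    have := min_principle
      (w := fun y => (v y - κ / b ^ 2 * (‖y - a‖ ^ 2) ^ (b / 2)) - H y) isOpen_ball
      isBounded_ball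
      (by rw [hcl]; exact (hv.sub hcS.continuousOn).sub hHC.continuous.continuousOn) a
      (fun z hz hza => ((hC z hz hza).sub (hS z hza)).sub hHC.contDiffAt)
      (m := -(ε + κ / b ^ 2 * R ^ b))
      (fun z hz hza => by
        rw [lap_sub ((hC z hz hza).sub (hS z hza)) hHC.contDiffAt, hHlap,
          lap_sub (hC z hz hza) (hS z hza), lap_const_mul (lap_rpow_dist hza b).1,
          (lap_rpow_dist hza b).2]
        have h1 := (hlap z hz hza).2
        have h2 : κ / b ^ 2 * (b ^ 2 * ‖z - a‖ ^ (b - 2)) = κ * ‖z - a‖ ^ (b - 2) := by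
          field_simp
        rw [h2]; linarith)
      (fun z hz => by
        rw [hfr] at hz
        have h1 := (abs_le.1 (hHv z hz)).2
        have h2 : ‖z - a‖ = R := by simpa [dist_eq_norm] using hz
        rw [sq_dist_rpow, h2]
        linarith) y hy
    simp only [sq_dist_rpow] at this
    linarith
  have hmem : ∀ {y r}, y ∈ closedBall a r → planeToC y ∈ closedBall (planeToC a) r := by
    intro y r hy
    rw [mem_closedBall, planeToC.dist_map]
    exact hy
  have hharn := harnack_re_entire (F := fun ζ => F ζ + (ε : ℂ)) (hF.add_const _)
    (c := planeToC a) hR ?_ (hmem hx) (hmem hx₀)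
  · simp only [Complex.add_re, Complex.ofReal_re, ← hHx] at hharn
    have h1 := hle x (hsub hx)
    have h2 := hge x₀ (hsub hx₀)
    rw [hv₀] at h2
    have h3 : 0 ≤ κ / b ^ 2 * ‖x₀ - a‖ ^ b := by positivity
    have h4 : 9 * κ * R ^ b / b ^ 2 = 9 * (κ / b ^ 2 * R ^ b) := by ring
    rw [h4]
    linarith
  · intro ζ hζ
    have hy : cToPlane ζ ∈ sphere a R := by
      rw [mem_sphere, ← planeToC.dist_map, planeToC_cToPlane]; exact hζ
    have h1 := (abs_le.1 (hHv _ hy)).1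
    have h2 := hpos _ (sphere_subset_closedBall hy)
    rw [hHx, planeToC_cToPlane] at h1
    simp only [Complex.add_re, Complex.ofReal_re]
    linarith

/-- The radius of a ball on which the rescaled equation is nondegenerate, around a maximum
point, cannot be too small. -/
lemma log_radius_le {g H : Plane → ℝ} {a x₀ : Plane} {d r η b κ₀ κ₁ p : ℝ} (hp : 1 < p)
    (hb : 0 < b) (hr : 0 < r) (hrd : 2 * r ≤ d) (hη : 0 < η) (hη1 : η < 1)
    (hκ₀ : 0 < κ₀) (hg : ContinuousOn g (closedBall a d))
    (hg01 : ∀ x ∈ closedBall a d, 0 ≤ g x ∧ g x ≤ 1)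
    (hC : ∀ x ∈ ball a d, x ≠ 0 → ContDiffAt ℝ 2 g x)
    (heq : ∀ x ∈ ball a d, x ≠ 0 → -lap g x = H x * g x ^ p)
    (hH0 : ∀ x ∈ ball a d, x ≠ 0 → 0 ≤ H x)
    (hH : ∀ x ∈ ball a (2 * r), x ≠ a →
      κ₀ * ‖x - a‖ ^ (b - 2) ≤ H x ∧ H x ≤ κ₁ * ‖x - a‖ ^ (b - 2))
    (hne : ∀ x ∈ ball a (2 * r), x ≠ a → x ≠ 0)
    (hx₀ : ‖x₀ - a‖ ≤ η * r) (hgx₀ : g x₀ = 1) (hκ01 : κ₀ ≤ κ₁)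
    (h18 : 18 * p * κ₁ * (2 * r) ^ b ≤ b ^ 2) (h72 : 72 * κ₁ * (2 * η) ^ b ≤ κ₀) :
    κ₀ * r ^ b * Real.log (d / r) ≤ 8 * b ^ 2 * Real.log (1 / η) := by
  have hκ₁ : 0 < κ₁ := hκ₀.trans_le hκ01
  have hηr : 0 < η * r := by positivity
  have hηr' : η * r < r := by nlinarith
  have hd : 0 < d := by linarith
  -- the function `1 - g` on balls around `a`
  have harn : ∀ ρ, 0 < ρ → ρ ≤ 2 * r → η * r ≤ ρ / 2 →
      ∀ x ∈ closedBall a (ρ / 2), 1 - 9 * κ₁ * ρ ^ b / b ^ 2 ≤ g x := by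
    intro ρ hρ hρr hρη x hx
    have hsb : ball a ρ ⊆ ball a (2 * r) := ball_subset_ball hρr
    have hsd : ball a (2 * r) ⊆ ball a d := ball_subset_ball hrd
    have hcd : closedBall a ρ ⊆ closedBall a d := closedBall_subset_closedBall (by linarith)
    have hlap : ∀ y ∈ ball a ρ, y ≠ a → ContDiffAt ℝ 2 g y ∧ lap (fun y => 1 - g y) y =
        H y * g y ^ p := by
      intro y hy hya
      have h0 := hne y (hsb hy) hya
      have h1 := hC y (hsd (hsb hy)) h0
      refine ⟨h1, ?_⟩
      rw [lap_sub contDiffAt_const h1, lap_const, ← heq y (hsd (hsb hy)) h0]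
      ring
    have := le_of_lap_le_of_zero (v := fun y => 1 - g y) (x₀ := x₀) hρ hb hκ₁.le
      (continuousOn_const.sub (hg.mono hcd))
      (fun y hy hya => contDiffAt_const.sub (hlap y hy hya).1)
      (fun y hy hya => by
        rw [(hlap y hy hya).2]
        have h0 := hne y (hsb hy) hya
        have h1 := hg01 y (hcd (ball_subset_closedBall hy))
        have h2 := hH0 y (hsd (hsb hy)) h0
        have h3 : 0 ≤ g y ^ p := Real.rpow_nonneg h1.1 p
        have h4 : g y ^ p ≤ 1 := Real.rpow_le_one h1.1 h1.2 (by linarith)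
        refine ⟨by positivity, ?_⟩
        calc H y * g y ^ p ≤ H y * 1 := by gcongr
          _ ≤ _ := by rw [mul_one]; exact (hH y (hsb hy) hya).2)
      (fun y hy => by linarith [(hg01 y (hcd hy)).2])
      (by rw [mem_closedBall, dist_eq_norm]; linarith) (by simp [hgx₀]) x hx
    linarith
  have hhalf : ∀ x ∈ closedBall a r, 1 / 2 ≤ g x ^ p := by
    intro x hx
    have h1 := harn (2 * r) (by linarith) le_rfl (by linarith) x (by
      rwa [mul_div_cancel_left₀ _ (two_ne_zero)])
    have h2 : 9 * κ₁ * (2 * r) ^ b / b ^ 2 ≤ 1 / (2 * p) := by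
      rw [div_le_div_iff₀ (by positivity) (by positivity)]
      linarith
    have h3 : 1 / (2 * p) ≤ 1 := by
      rw [div_le_one (by positivity)]; linarith
    have h4 := one_add_mul_self_le_rpow_one_add (s := -(1 / (2 * p))) (by linarith) hp.le
    have h5 : (1 + -(1 / (2 * p))) ^ p ≤ g x ^ p :=
      Real.rpow_le_rpow (by linarith) (by linarith) (by linarith)
    have h6 : 1 + p * -(1 / (2 * p)) = 1 / 2 := by field_simp; norm_num
    linarith
  have hηb : η ^ b ≤ 1 / 2 := by
    have h1 : (2 * η) ^ b = 2 ^ b * η ^ b := Real.mul_rpow (by norm_num) hη.le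
    have h2 : (1:ℝ) ≤ 2 ^ b := Real.one_le_rpow (by norm_num) hb.le
    have h3 : 0 < η ^ b := by positivity
    have h4 : η ^ b ≤ (2 * η) ^ b := by rw [h1]; nlinarith
    have h5 : 72 * κ₁ * η ^ b ≤ κ₁ := by
      calc 72 * κ₁ * η ^ b ≤ 72 * κ₁ * (2 * η) ^ b := by gcongr
        _ ≤ κ₁ := h72.trans hκ01
    nlinarith
  have hrb : 0 < r ^ b := by positivity
  -- a point on the circle of radius `r` where `g` is definitely less than one
  obtain ⟨x₁, hx₁, hgx₁⟩ : ∃ x₁ ∈ sphere a r, g x₁ ≤ 1 - κ₀ * r ^ b / (4 * b ^ 2) := by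
    have hsne : (sphere a r).Nonempty := NormedSpace.sphere_nonempty.2 hr.le
    have hsd : sphere a r ⊆ closedBall a d :=
      sphere_subset_closedBall.trans (closedBall_subset_closedBall (by linarith))
    obtain ⟨x₁, hx₁, hmin⟩ := (isCompact_sphere a r).exists_isMinOn hsne (hg.mono hsd)
    refine ⟨x₁, hx₁, ?_⟩
    have hS : ∀ z : Plane, z ≠ a →
        ContDiffAt ℝ 2 (fun y : Plane => κ₀ / (2 * b ^ 2) * (‖y - a‖ ^ 2) ^ (b / 2)) z :=
      fun z hz => contDiffAt_const.mul (lap_rpow_dist hz b).1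
    have hcS : Continuous fun y : Plane => κ₀ / (2 * b ^ 2) * (‖y - a‖ ^ 2) ^ (b / 2) :=
      continuous_const.mul (Continuous.rpow_const (by fun_prop) fun _ => Or.inr (by positivity))
    have hsb : ball a r ⊆ ball a (2 * r) := ball_subset_ball (by linarith)
    have hsbd : ball a r ⊆ ball a d := ball_subset_ball (by linarith)
    have hcl : closure (ball a r) = closedBall a r := closure_ball a hr.ne'
    have := min_principle
      (w := fun y => g y + κ₀ / (2 * b ^ 2) * (‖y - a‖ ^ 2) ^ (b / 2)) (D := ball a r)
      isOpen_ball isBounded_ball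
      (by
        rw [hcl]
        exact (hg.mono (closedBall_subset_closedBall (by linarith))).add hcS.continuousOn) a
      (fun z hz hza => (hC z (hsbd hz) (hne z (hsb hz) hza)).add
        (hS z hza))
      (m := g x₁ + κ₀ / (2 * b ^ 2) * r ^ b)
      (fun z hz hza => by
        have hz0 := hne z (hsb hz) hza
        rw [lap_add (hC z (hsbd hz) hz0) (hS z hza), lap_const_mul (lap_rpow_dist hza b).1,
          (lap_rpow_dist hza b).2]
        have h1 := heq z (hsbd hz) hz0
        have h2 := (hH z (hsb hz) hza).1
        have h3 := hhalf z (ball_subset_closedBall hz)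
        have h4 : κ₀ / (2 * b ^ 2) * (b ^ 2 * ‖z - a‖ ^ (b - 2)) =
          κ₀ * ‖z - a‖ ^ (b - 2) * (1 / 2) := by field_simp
        have h5 : κ₀ * ‖z - a‖ ^ (b - 2) * (1 / 2) ≤ H z * g z ^ p := by
          have := hH0 z (hsbd hz) hz0
          gcongr
        rw [h4]; linarith)
      (fun z hz => by
        rw [frontier_ball a hr.ne'] at hz
        have h2 : ‖z - a‖ = r := by simpa [dist_eq_norm] using hz
        rw [sq_dist_rpow, h2]
        have : g x₁ ≤ g z := hmin hz
        linarith) x₀ (by rw [mem_ball, dist_eq_norm]; linarith)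
    simp only [sq_dist_rpow, hgx₀] at this
    have h1 : ‖x₀ - a‖ ^ b ≤ 1 / 2 * r ^ b := by
      calc ‖x₀ - a‖ ^ b ≤ (η * r) ^ b := by gcongr
        _ = η ^ b * r ^ b := Real.mul_rpow hη.le hr.le
        _ ≤ _ := by gcongr
    have h2 : κ₀ / (2 * b ^ 2) * ‖x₀ - a‖ ^ b ≤ κ₀ / (2 * b ^ 2) * (1 / 2 * r ^ b) := by gcongr
    have h3 : κ₀ * r ^ b / (4 * b ^ 2) = κ₀ / (2 * b ^ 2) * (1 / 2 * r ^ b) := by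
      field_simp; norm_num
    have h4 : κ₀ / (2 * b ^ 2) * r ^ b = 2 * (κ₀ / (2 * b ^ 2) * (1 / 2 * r ^ b)) := by ring
    rw [h3]
    linarith
  set c := κ₀ * r ^ b / (8 * b ^ 2) with hc
  have hc0 : 0 < c := by positivity
  have hgx₁ : g x₁ ≤ 1 - 2 * c := by
    rw [hc]; convert hgx₁ using 2; field_simp; norm_num
  -- near `x₀`, `g` is closer to one
  have hin : ∀ x ∈ closedBall a (η * r), 1 - c ≤ g x := by
    intro x hx
    have h1 := harn (2 * (η * r)) (by positivity) (by linarith) (by linarith) x (by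
      rwa [mul_div_cancel_left₀ _ (two_ne_zero)])
    have h2 : (2 * (η * r)) ^ b = (2 * η) ^ b * r ^ b := by
      rw [← mul_assoc, Real.mul_rpow (by positivity) hr.le]
    have h3 : 9 * κ₁ * (2 * (η * r)) ^ b / b ^ 2 ≤ c := by
      rw [h2, hc, div_le_div_iff₀ (by positivity) (by positivity)]
      have : 72 * κ₁ * (2 * η) ^ b * (r ^ b * b ^ 2) ≤ κ₀ * (r ^ b * b ^ 2) := by gcongr
      linarith
    linarith
  -- comparison with the logarithm in an annulus
  set L := Real.log (d ^ 2) - Real.log ((η * r) ^ 2) with hL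
  have hL0 : 0 < L := by
    have : Real.log ((η * r) ^ 2) < Real.log (d ^ 2) :=
      Real.log_lt_log (by positivity) (by
        have : η * r < d := by linarith
        gcongr)
    linarith
  have hlogC : ∀ z : Plane, z ≠ a → ContDiffAt ℝ 2 (fun y => Real.log (‖y - a‖ ^ 2)) z :=
    fun z hz => (contDiffAt_sq_dist a z).log (sq_dist_pos hz).ne'
  have hloglap : ∀ z : Plane, z ≠ a → lap (fun y => Real.log (‖y - a‖ ^ 2)) z = 0 := by
    intro z hz
    have hp := sq_dist_pos hz
    rw [lap_comp_sq_dist (φ := Real.log) (φ' := fun s => s⁻¹) (φ'' := -((‖z - a‖ ^ 2) ^ 2)⁻¹)]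
    · field_simp; ring
    · filter_upwards [lt_mem_nhds hp] with s hs using Real.hasDerivAt_log hs.ne'
    · exact hasDerivAt_inv hp.ne'
  have hclD := closure_diff_closedBall_subset a (η * r) d
  have hDa : ∀ z ∈ closedBall a d \ ball a (η * r), z ≠ a := by
    rintro z hz rfl
    exact hz.2 (mem_ball_self hηr)
  have hann := min_principle (D := ball a d \ closedBall a (η * r))
      (w := fun y => L * g y - (1 - c) * (Real.log (d ^ 2) - Real.log (‖y - a‖ ^ 2)))
      (isOpen_ball.sdiff isClosed_closedBall) (isBounded_ball.subset sdiff_subset)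
      (by
        refine (continuousOn_const.mul (hg.mono (hclD.trans sdiff_subset))).sub
          (continuousOn_const.mul (continuousOn_const.sub fun z hz => ?_))
        exact (hlogC z (hDa z (hclD hz))).continuousAt.continuousWithinAt) 0
      (fun z hz hz0 => (contDiffAt_const.mul (hC z hz.1 hz0)).sub
        (contDiffAt_const.mul (contDiffAt_const.sub
          (hlogC z (hDa z (hclD (subset_closure hz)))))))
      (m := 0)
      (fun z hz hz0 => by
        have hza := hDa z (hclD (subset_closure hz))
        rw [lap_sub (contDiffAt_const.mul (hC z hz.1 hz0))
          (contDiffAt_const.mul (contDiffAt_const.sub (hlogC z hza))),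
          lap_const_mul (hC z hz.1 hz0), lap_const_mul (contDiffAt_const.sub (hlogC z hza)),
          lap_sub contDiffAt_const (hlogC z hza), lap_const, hloglap z hza]
        have h1 := heq z hz.1 hz0
        have h2 := hH0 z hz.1 hz0
        have h3 : 0 ≤ g z ^ p := Real.rpow_nonneg (hg01 z (ball_subset_closedBall hz.1)).1 p
        have h4 : lap g z ≤ 0 := by nlinarith
        nlinarith)
      (fun z hz => by
        have hz1 := hclD hz.1
        have hz2 : z ∉ ball a d \ closedBall a (η * r) := by
          have := hz.2
          rwa [(isOpen_ball.sdiff isClosed_closedBall).interior_eq] at this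
        by_cases hzd : z ∈ ball a d
        · have h1 : z ∈ closedBall a (η * r) := by
            by_contra h
            exact hz2 ⟨hzd, h⟩
          have h2 : ‖z - a‖ = η * r := by
            rw [mem_closedBall, dist_eq_norm] at h1
            have := hz1.2
            rw [mem_ball, dist_eq_norm, not_lt] at this
            exact le_antisymm h1 this
          have h3 := hin z h1
          simp only [h2, ← hL]
          nlinarith
        · have h2 : ‖z - a‖ = d := by
            have h1 := hz1.1
            rw [mem_closedBall, dist_eq_norm] at h1
            rw [mem_ball, dist_eq_norm, not_lt] at hzd
            exact le_antisymm h1 hzd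
          have h3 := (hg01 z hz1.1).1
          simp only [h2]
          nlinarith)
      x₁ ⟨by rw [mem_ball, mem_sphere.1 hx₁]; linarith,
        by rw [mem_closedBall, mem_sphere.1 hx₁]; linarith⟩
  have hx₁' : ‖x₁ - a‖ = r := by simpa [dist_eq_norm] using hx₁
  simp only [hx₁'] at hann
  have hlr : Real.log (d ^ 2) - Real.log (r ^ 2) = 2 * Real.log (d / r) := by
    rw [Real.log_pow, Real.log_pow, Real.log_div hd.ne' hr.ne']; push_cast; ring
  have hLe : L = 2 * Real.log (d / r) + 2 * Real.log (1 / η) := by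
    rw [hL, Real.log_pow, Real.log_pow, Real.log_mul hη.ne' hr.ne', Real.log_div hd.ne' hr.ne',
      Real.log_div one_ne_zero hη.ne', Real.log_one]
    push_cast; ring
  rw [hlr] at hann
  have hE : 0 ≤ Real.log (1 / η) := Real.log_nonneg (by rw [le_div_iff₀ hη]; linarith)
  have h1 : L * g x₁ ≤ L * (1 - 2 * c) := mul_le_mul_of_nonneg_left hgx₁ hL0.le
  rw [hLe] at hann h1
  have h2 : c * Real.log (d / r) ≤ Real.log (1 / η) := by
    have := mul_nonneg hc0.le hE
    nlinarith
  have h3 : κ₀ * r ^ b = c * (8 * b ^ 2) := by rw [hc]; field_simp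
  rw [h3]
  calc c * (8 * b ^ 2) * Real.log (d / r) = 8 * b ^ 2 * (c * Real.log (d / r)) := by ring
    _ ≤ _ := by gcongr

lemma exists_small_rpow {b k₀ k₁ : ℝ} (hb : 0 < b) (hk₀ : 0 < k₀) (hk₁ : 0 < k₁) :
    ∃ η, 0 < η ∧ η < 1 ∧ 72 * k₁ * (2 * η) ^ b ≤ k₀ := by
  have hm : 0 < min (k₀ / (72 * k₁)) 1 := lt_min (by positivity) one_pos
  refine ⟨(min (k₀ / (72 * k₁)) 1) ^ (1 / b) / 2, by positivity, ?_, ?_⟩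
  · have : (min (k₀ / (72 * k₁)) 1) ^ (1 / b) ≤ 1 :=
      Real.rpow_le_one hm.le (min_le_right _ _) (by positivity)
    linarith
  · rw [mul_div_cancel₀ _ two_ne_zero, ← Real.rpow_mul hm.le, one_div_mul_cancel hb.ne',
      Real.rpow_one]
    calc 72 * k₁ * min (k₀ / (72 * k₁)) 1 ≤ 72 * k₁ * (k₀ / (72 * k₁)) := by
          gcongr; exact min_le_left _ _
      _ = k₀ := by field_simp

lemma exp_le_of_log_div_le {d r p C : ℝ} (hd : 0 < d) (hr : 0 < r) (hp : 0 < p) (hC : 0 ≤ C)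
    (h : 2 * r ≤ d → Real.log (d / r) ≤ p * C) : d / 2 * Real.exp (-(p * C)) ≤ r := by
  have h1 : Real.exp (-(p * C)) ≤ 1 := Real.exp_le_one_iff.2 (by
    have := mul_nonneg hp.le hC
    linarith)
  by_cases h2 : 2 * r ≤ d
  · have h3 := (Real.log_le_iff_le_exp (by positivity)).1 (h h2)
    rw [div_le_iff₀ hr] at h3
    have h4 : d * Real.exp (-(p * C)) ≤ r := by
      rw [Real.exp_neg, ← div_eq_mul_inv, div_le_iff₀ (Real.exp_pos _)]
      linarith
    have := mul_pos hd (Real.exp_pos (-(p * C)))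
    linarith
  · have : d / 2 * Real.exp (-(p * C)) ≤ d / 2 * 1 := by gcongr
    linarith

/-- Bound for the rescaled nonlinearity when the maximum is attained near the origin. -/
lemma exists_bound_near_origin {α k₀ k₁ d : ℝ} (hα : -1 < α) (hk₀ : 0 < k₀) (hk : k₀ ≤ k₁)
    (hd : 0 < d) : ∃ σ > 0, ∃ A B : ℝ, 1 ≤ A ∧ 0 ≤ B ∧ ∀ (p μ : ℝ) (g K : Plane → ℝ) (x₀ : Plane),
      1 < p → 0 < μ → ContinuousOn g (closedBall 0 d) →
      (∀ x ∈ closedBall 0 d, 0 ≤ g x ∧ g x ≤ 1) →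
      (∀ x ∈ ball 0 d, x ≠ 0 → ContDiffAt ℝ 2 g x) →
      (∀ x ∈ ball 0 d, x ≠ 0 → -lap g x = μ * ‖x‖ ^ (2 * α) * K x * g x ^ p) →
      (∀ x ∈ ball 0 d, k₀ ≤ K x ∧ K x ≤ k₁) →
      ‖x₀‖ ^ (2 + 2 * α) * (p * μ) ≤ σ → g x₀ = 1 → p * μ ≤ A * Real.exp (B * p) := by
  have hk₁ : 0 < k₁ := hk₀.trans_le hk
  obtain ⟨b, hbdef⟩ : ∃ b, b = 2 + 2 * α := ⟨_, rfl⟩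
  have hb : 0 < b := by linarith
  obtain ⟨η, hη, hη1, h72⟩ := exists_small_rpow hb hk₀ hk₁
  set σ := b ^ 2 / (18 * k₁ * 2 ^ b) with hσ
  have hσ0 : 0 < σ := by positivity
  set C := 8 * b ^ 2 * Real.log (1 / η) / (k₀ * σ) with hC
  have hC0 : 0 ≤ C := by
    have : 0 ≤ Real.log (1 / η) := Real.log_nonneg (by rw [le_div_iff₀ hη]; linarith)
    positivity
  refine ⟨η ^ b * σ, by positivity, max 1 (σ * (2 / d) ^ b), b * C, le_max_left _ _,
    by positivity, ?_⟩
  rw [← hbdef]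
  intro p μ g K x₀ hp hμ hg hg01 hgC heq hK hx₀ hgx₀
  have hpμ : 0 < p * μ := by positivity
  set r := (σ / (p * μ)) ^ (1 / b) with hr
  have hr0 : 0 < r := by positivity
  have hrb : r ^ b = σ / (p * μ) := by
    rw [hr, ← Real.rpow_mul (by positivity), one_div_mul_cancel hb.ne', Real.rpow_one]
  have hlow := exp_le_of_log_div_le (p := p) hd hr0 (by linarith) hC0 (fun h2r => by
    have hsub : ball (0 : Plane) (2 * r) ⊆ ball 0 d := ball_subset_ball h2r
    have hexp : 2 * α = b - 2 := by linarith
    have := log_radius_le (g := g) (H := fun x => μ * ‖x‖ ^ (2 * α) * K x) (a := 0) (x₀ := x₀)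
      (κ₀ := μ * k₀) (κ₁ := μ * k₁) hp hb hr0 h2r hη hη1 (by positivity) hg hg01 hgC heq
      (fun x hx _ => by have : 0 < K x := hk₀.trans_le (hK x hx).1; positivity)
      (fun x hx _ => by
        have h1 := hK x (hsub hx)
        have h0 : 0 < K x := hk₀.trans_le h1.1
        rw [sub_zero, hexp]
        constructor
        · calc μ * k₀ * ‖x‖ ^ (b - 2) = μ * ‖x‖ ^ (b - 2) * k₀ := by ring
            _ ≤ _ := by gcongr; exact h1.1
        · calc _ ≤ μ * ‖x‖ ^ (b - 2) * k₁ := by gcongr; exact h1.2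
            _ = _ := by ring)
      (fun x _ h => h)
      (by
        rw [sub_zero, ← Real.rpow_le_rpow_iff (norm_nonneg _) (by positivity) hb,
          Real.mul_rpow hη.le hr0.le, hrb, ← mul_div_assoc, le_div_iff₀ hpμ]
        exact hx₀)
      hgx₀ (by gcongr)
      (by
        rw [Real.mul_rpow (by norm_num) hr0.le, hrb, hσ]
        apply le_of_eq
        field_simp)
      (by
        calc 72 * (μ * k₁) * (2 * η) ^ b = μ * (72 * k₁ * (2 * η) ^ b) := by ring
          _ ≤ _ := by gcongr)
    rw [hrb] at this
    have h3 : μ * k₀ * (σ / (p * μ)) = k₀ * σ / p := by field_simp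
    rw [h3] at this
    rw [hC, ← mul_div_assoc, le_div_iff₀ (by positivity)]
    rw [div_mul_eq_mul_div, div_le_iff₀ (by linarith)] at this
    linarith)
  have h1 : (d / 2 * Real.exp (-(p * C))) ^ b ≤ σ / (p * μ) := by
    rw [← hrb]; gcongr
  rw [Real.mul_rpow (by positivity) (Real.exp_pos _).le, ← Real.exp_mul, le_div_iff₀ hpμ] at h1
  have h2 : p * μ ≤ σ * (2 / d) ^ b * Real.exp (b * C * p) := by
    have h3 : (2 / d) ^ b * (d / 2) ^ b = 1 := by
      rw [← Real.mul_rpow (by positivity) (by positivity)]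
      have : 2 / d * (d / 2) = 1 := by field_simp
      rw [this, Real.one_rpow]
    have h4 : Real.exp (b * C * p) * Real.exp (-(p * C) * b) = 1 := by
      rw [← Real.exp_add, ← Real.exp_zero]; congr 1; ring
    calc p * μ = ((2 / d) ^ b * (d / 2) ^ b) * (Real.exp (b * C * p) * Real.exp (-(p * C) * b))
          * (p * μ) := by rw [h3, h4]; ring
      _ = (2 / d) ^ b * Real.exp (b * C * p) *
          ((d / 2) ^ b * Real.exp (-(p * C) * b) * (p * μ)) := by ring
      _ ≤ (2 / d) ^ b * Real.exp (b * C * p) * σ := by gcongr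
      _ = _ := by ring
  refine h2.trans ?_
  gcongr
  exact le_max_right _ _

lemma rpow_comparable {s t α : ℝ} (hs : 0 < s) (h1 : s / 2 ≤ t) (h2 : t ≤ 2 * s) :
    (2:ℝ) ^ (-|2 * α|) * s ^ (2 * α) ≤ t ^ (2 * α) ∧
    t ^ (2 * α) ≤ (2:ℝ) ^ |2 * α| * s ^ (2 * α) := by
  have ht : 0 < t := by linarith
  have hq : t ^ (2 * α) = (t / s) ^ (2 * α) * s ^ (2 * α) := by
    rw [← Real.mul_rpow (by positivity) hs.le, div_mul_cancel₀ _ hs.ne']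
  have hq1 : 2⁻¹ ≤ t / s := by rw [le_div_iff₀ hs]; linarith
  have hq2 : t / s ≤ 2 := by rw [div_le_iff₀ hs]; linarith
  have hqp : 0 < t / s := by positivity
  generalize t / s = q at *
  generalize 2 * α = c at *
  rw [hq]
  have hinv : ∀ e : ℝ, (2⁻¹ : ℝ) ^ e = 2 ^ (-e) := fun e => by
    rw [Real.inv_rpow (by norm_num), Real.rpow_neg (by norm_num)]
  have main : (2:ℝ) ^ (-|c|) ≤ q ^ c ∧ q ^ c ≤ (2:ℝ) ^ |c| := by
    rcases le_total 0 c with hc | hc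
    · rw [abs_of_nonneg hc, ← hinv]
      exact ⟨by gcongr, by gcongr⟩
    · rw [abs_of_nonpos hc, neg_neg, ← hinv]
      exact ⟨Real.rpow_le_rpow_of_nonpos hqp hq2 hc,
        Real.rpow_le_rpow_of_nonpos (by norm_num) hq1 hc⟩
  exact ⟨by gcongr; exact main.1, by gcongr; exact main.2⟩

/-- Bound for the rescaled nonlinearity when the maximum is attained away from the origin. -/
lemma exists_bound_away_origin {α k₀ k₁ d D σ : ℝ} (hk₀ : 0 < k₀) (hα : -1 < α)
    (hk : k₀ ≤ k₁) (hd : 0 < d) (hD : 0 < D) (hσ : 0 < σ) :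
    ∃ A B : ℝ, 1 ≤ A ∧ 0 ≤ B ∧ ∀ (p μ : ℝ) (g K : Plane → ℝ) (x₀ : Plane),
      1 < p → 0 < μ → ContinuousOn g (closedBall x₀ d) →
      (∀ x ∈ closedBall x₀ d, 0 ≤ g x ∧ g x ≤ 1) →
      (∀ x ∈ ball x₀ d, x ≠ 0 → ContDiffAt ℝ 2 g x) →
      (∀ x ∈ ball x₀ d, x ≠ 0 → -lap g x = μ * ‖x‖ ^ (2 * α) * K x * g x ^ p) →
      (∀ x ∈ ball x₀ d, k₀ ≤ K x ∧ K x ≤ k₁) →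
      σ ≤ ‖x₀‖ ^ (2 + 2 * α) * (p * μ) → ‖x₀‖ ≤ D → g x₀ = 1 →
      p * μ ≤ A * Real.exp (B * p) := by
  have hk₁ : 0 < k₁ := hk₀.trans_le hk
  set c := (2:ℝ) ^ (-|2 * α|) with hc
  set C' := (2:ℝ) ^ |2 * α| with hC'
  have hc0 : 0 < c := by positivity
  have hC'0 : 0 < C' := by positivity
  have hcC : c ≤ C' := by
    rw [hc, hC']
    exact Real.rpow_le_rpow_of_exponent_le (by norm_num) (by linarith [abs_nonneg (2 * α)])
  obtain ⟨η, hη, hη1, h72⟩ := exists_small_rpow (b := 2) two_pos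
    (mul_pos hk₀ hc0) (mul_pos hk₁ hC'0)
  set σ₁ := min (4 / (72 * (k₁ * C'))) (σ / 16) with hσ₁
  have hσ₁0 : 0 < σ₁ := lt_min (by positivity) (by positivity)
  set C := 32 * Real.log (1 / η) / (k₀ * c * σ₁) with hC
  have hC0 : 0 ≤ C := by
    have : 0 ≤ Real.log (1 / η) := Real.log_nonneg (by rw [le_div_iff₀ hη]; linarith)
    positivity
  set e := |2 * α| with he
  have he0 : 0 ≤ e := abs_nonneg _
  refine ⟨max 1 (σ₁ * D ^ (e - 2 * α) * (2 / d) ^ (2 + e)), (2 + e) * C, le_max_left _ _,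
    by positivity, ?_⟩
  intro p μ g K x₀ hp hμ hg hg01 hgC heq hK hx₀ hxD hgx₀
  have hpμ : 0 < p * μ := by positivity
  obtain ⟨s, hs⟩ : ∃ s, s = ‖x₀‖ := ⟨_, rfl⟩
  rw [← hs] at hx₀ hxD
  have hs0 : 0 < s := by
    rcases (hs ▸ norm_nonneg x₀ : 0 ≤ s).eq_or_lt with h | h
    · rw [← h, Real.zero_rpow (by linarith), zero_mul] at hx₀
      linarith
    · exact h
  have hsα : 0 < s ^ (2 * α) := by positivity
  set r := √(σ₁ / (p * μ * s ^ (2 * α))) with hr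
  have hr0 : 0 < r := Real.sqrt_pos.2 (by positivity)
  have hr2 : r ^ 2 = σ₁ / (p * μ * s ^ (2 * α)) := Real.sq_sqrt (by positivity)
  have hsb : s ^ (2 + 2 * α) = s ^ 2 * s ^ (2 * α) := by
    rw [Real.rpow_add hs0, ← Real.rpow_natCast s 2]; norm_cast
  have hrs : r ≤ s / 4 := by
    apply le_of_sq_le_sq _ (by positivity)
    rw [hr2, div_le_iff₀ (by positivity)]
    have h1 : σ₁ ≤ σ / 16 := min_le_right _ _
    rw [hsb] at hx₀
    nlinarith
  have hlow := exp_le_of_log_div_le (p := p) hd hr0 (by linarith) hC0 (fun h2r => by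
    have hsub : ball x₀ (2 * r) ⊆ ball x₀ d := ball_subset_ball h2r
    have hnorm : ∀ x ∈ ball x₀ (2 * r), s / 2 ≤ ‖x‖ ∧ ‖x‖ ≤ 2 * s := by
      intro x hx
      rw [mem_ball, dist_eq_norm] at hx
      have h1 := abs_le.1 ((abs_norm_sub_norm_le x x₀).trans hx.le)
      rw [← hs] at h1
      exact ⟨by linarith [h1.1], by linarith [h1.2]⟩
    have := log_radius_le (g := g) (H := fun x => μ * ‖x‖ ^ (2 * α) * K x) (a := x₀) (x₀ := x₀)
      (b := 2) (κ₀ := μ * s ^ (2 * α) * (k₀ * c)) (κ₁ := μ * s ^ (2 * α) * (k₁ * C')) hp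
      two_pos hr0 h2r hη hη1 (by positivity) hg hg01 hgC heq
      (fun x hx _ => by have : 0 < K x := hk₀.trans_le (hK x hx).1; positivity)
      (fun x hx _ => by
        have h1 := hK x (hsub hx)
        have h0 : 0 < K x := hk₀.trans_le h1.1
        have h2 := rpow_comparable (α := α) hs0 (hnorm x hx).1 (hnorm x hx).2
        rw [sub_self, Real.rpow_zero, mul_one, mul_one]
        constructor
        · calc μ * s ^ (2 * α) * (k₀ * c) = μ * (c * s ^ (2 * α)) * k₀ := by ring
            _ ≤ _ := by gcongr; exacts [h2.1, h1.1]
        · calc _ ≤ μ * (C' * s ^ (2 * α)) * k₁ := by gcongr; exacts [h2.2, h1.2]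
            _ = _ := by ring)
      (fun x hx _ => by
        have := (hnorm x hx).1
        exact norm_pos_iff.1 (by linarith))
      (by rw [sub_self, norm_zero]; positivity)
      hgx₀ (by gcongr)
      (by
        rw [Real.rpow_two, mul_pow, hr2]
        have h1 : σ₁ * (72 * (k₁ * C')) ≤ 4 := (le_div_iff₀ (by positivity)).1 (min_le_left _ _)
        calc 18 * p * (μ * s ^ (2 * α) * (k₁ * C')) * (2 ^ 2 * (σ₁ / (p * μ * s ^ (2 * α))))
            = σ₁ * (72 * (k₁ * C')) := by field_simp; ring
          _ ≤ 2 ^ 2 := by linarith)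
      (by
        calc 72 * (μ * s ^ (2 * α) * (k₁ * C')) * (2 * η) ^ (2:ℝ)
            = μ * s ^ (2 * α) * (72 * (k₁ * C') * (2 * η) ^ (2:ℝ)) := by ring
          _ ≤ _ := by gcongr)
    rw [Real.rpow_two, hr2] at this
    have h3 : μ * s ^ (2 * α) * (k₀ * c) * (σ₁ / (p * μ * s ^ (2 * α))) = k₀ * c * σ₁ / p := by
      field_simp
    rw [h3] at this
    rw [hC, ← mul_div_assoc, le_div_iff₀ (by positivity)]
    rw [div_mul_eq_mul_div, div_le_iff₀ (by linarith)] at this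
    linarith)
  have hsD : D ^ (2 * α) * (r / D) ^ e ≤ s ^ (2 * α) := by
    have h1 : s ^ (2 * α) = D ^ (2 * α) * (s / D) ^ (2 * α) := by
      rw [← Real.mul_rpow hD.le (by positivity), mul_div_cancel₀ _ hD.ne']
    rw [h1]
    have h2 : (r / D) ^ e ≤ (s / D) ^ e := by gcongr; linarith
    have h3 : (s / D) ^ e ≤ (s / D) ^ (2 * α) :=
      Real.rpow_le_rpow_of_exponent_ge (by positivity) (by rw [div_le_one hD]; exact hxD)
        (le_abs_self _)
    gcongr
    exact h2.trans h3
  have hre : D ^ (2 * α - e) * r ^ (2 + e) * (p * μ) ≤ σ₁ := by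
    have h1 : r ^ 2 * (p * μ * s ^ (2 * α)) = σ₁ := by rw [hr2]; field_simp
    calc D ^ (2 * α - e) * r ^ (2 + e) * (p * μ)
        = r ^ 2 * (p * μ * (D ^ (2 * α) * (r / D) ^ e)) := by
          rw [Real.rpow_sub hD, Real.rpow_add hr0, Real.div_rpow hr0.le hD.le, Real.rpow_two]
          ring
      _ ≤ r ^ 2 * (p * μ * s ^ (2 * α)) := by gcongr
      _ = σ₁ := h1
  have h1 : (d / 2 * Real.exp (-(p * C))) ^ (2 + e) ≤ r ^ (2 + e) := by gcongr
  rw [Real.mul_rpow (by positivity) (Real.exp_pos _).le, ← Real.exp_mul] at h1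
  have h2 : p * μ ≤ σ₁ * D ^ (e - 2 * α) * (2 / d) ^ (2 + e) * Real.exp ((2 + e) * C * p) := by
    have h3 : (2 / d) ^ (2 + e) * (d / 2) ^ (2 + e) = 1 := by
      rw [← Real.mul_rpow (by positivity) (by positivity)]
      have : 2 / d * (d / 2) = 1 := by field_simp
      rw [this, Real.one_rpow]
    have h4 : Real.exp ((2 + e) * C * p) * Real.exp (-(p * C) * (2 + e)) = 1 := by
      rw [← Real.exp_add, ← Real.exp_zero]; congr 1; ring
    have h5 : D ^ (e - 2 * α) * D ^ (2 * α - e) = 1 := by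
      rw [← Real.rpow_add hD, ← Real.rpow_zero D]; congr 1; ring
    have h6 : D ^ (2 * α - e) * ((d / 2) ^ (2 + e) * Real.exp (-(p * C) * (2 + e))) * (p * μ)
        ≤ σ₁ := by
      refine le_trans ?_ hre
      gcongr
    calc p * μ = (D ^ (e - 2 * α) * D ^ (2 * α - e)) * ((2 / d) ^ (2 + e) * (d / 2) ^ (2 + e)) *
          (Real.exp ((2 + e) * C * p) * Real.exp (-(p * C) * (2 + e)))
          * (p * μ) := by rw [h3, h4, h5]; ring
      _ = D ^ (e - 2 * α) * (2 / d) ^ (2 + e) * Real.exp ((2 + e) * C * p) *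
          (D ^ (2 * α - e) * ((d / 2) ^ (2 + e) * Real.exp (-(p * C) * (2 + e))) * (p * μ)) := by
            ring
      _ ≤ D ^ (e - 2 * α) * (2 / d) ^ (2 + e) * Real.exp ((2 + e) * C * p) * σ₁ := by gcongr
      _ = _ := by ring
  refine h2.trans ?_
  gcongr
  exact le_max_right _ _

/-- Positive solutions of the Dirichlet problem for the Hénon–Lane–Emden equation. -/
structure IsHenonSolution (Ω : Set Plane) (α : ℝ) (K : Plane → ℝ) (p : ℝ) (u : Plane → ℝ) :
    Prop where
  continuousOn : ContinuousOn u (closure Ω)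
  contDiffOn : ContDiffOn ℝ 2 u (Ω \ {0})
  pos : ∀ x ∈ Ω, 0 < u x
  eq : ∀ x ∈ Ω \ {0}, -lap u x = ‖x‖ ^ (2 * α) * K x * u x ^ p
  zero : ∀ x ∈ frontier Ω, u x = 0

lemma IsHenonSolution.contDiffAt {Ω : Set Plane} {α p : ℝ} {K u : Plane → ℝ}
    (h : IsHenonSolution Ω α K p u) (hΩo : IsOpen Ω) {x : Plane} (hx : x ∈ Ω) (hx0 : x ≠ 0) :
    ContDiffAt ℝ 2 u x :=
  h.contDiffOn.contDiffAt ((hΩo.sdiff isClosed_singleton).mem_nhds ⟨hx, hx0⟩)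

lemma exists_uniform_closedBall_subset {Ω Q : Set Plane} (hΩo : IsOpen Ω) (hQ : IsCompact Q)
    (hQΩ : Q ⊆ Ω) : ∃ d > 0, ∀ x ∈ Q, closedBall x d ⊆ Ω := by
  obtain ⟨d, hd, h⟩ := hQ.exists_cthickening_subset_open hΩo hQΩ
  exact ⟨d, hd, fun x hx => (closedBall_subset_cthickening hx d).trans h⟩

/-- Solutions whose maximum is attained in a fixed compact set are uniformly bounded. -/
lemma exists_bound_of_max_mem_compact {Ω Q : Set Plane} (hΩo : IsOpen Ω)
    (hΩb : Bornology.IsBounded Ω) (h0 : (0 : Plane) ∈ Ω) {α p₀ k₀ k₁ : ℝ} (hα : -1 < α)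
    (hp₀ : 1 < p₀) {K : Plane → ℝ} (hk₀ : 0 < k₀) (hK : ∀ x ∈ Ω, k₀ ≤ K x ∧ K x ≤ k₁)
    (hQ : IsCompact Q) (hQΩ : Q ⊆ Ω) :
    ∃ C > 0, ∀ p, p₀ ≤ p → ∀ u, IsHenonSolution Ω α K p u → ∀ x₀ ∈ Q,
      (∀ x ∈ Ω, u x ≤ u x₀) → u x₀ ≤ C := by
  have hk : k₀ ≤ k₁ := (hK 0 h0).1.trans (hK 0 h0).2
  obtain ⟨d, hd, hdQ⟩ := exists_uniform_closedBall_subset hΩo (hQ.insert 0)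
    (insert_subset h0 hQΩ)
  obtain ⟨D, hD, hΩD⟩ := hΩb.subset_closedBall_lt 0 0
  obtain ⟨σ, hσ, A₁, B₁, hA₁, hB₁, near⟩ := exists_bound_near_origin hα hk₀ hk hd
  obtain ⟨A₂, B₂, hA₂, hB₂, away⟩ := exists_bound_away_origin hk₀ hα hk hd hD hσ
  set A := max A₁ A₂
  set B := max B₁ B₂
  have hA : 1 ≤ A := hA₁.trans (le_max_left _ _)
  have hB : 0 ≤ B := hB₁.trans (le_max_left _ _)
  have hlA : 0 ≤ Real.log A := Real.log_nonneg hA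
  refine ⟨Real.exp (B + (Real.log A + B) / (p₀ - 1)), Real.exp_pos _, ?_⟩
  intro p hp u hu x₀ hx₀ hmax
  have hp1 : 1 < p := hp₀.trans_le hp
  have hM : 0 < u x₀ := hu.pos x₀ (hQΩ hx₀)
  generalize hMu : u x₀ = M at *
  have hμ : 0 < M ^ (p - 1) := by positivity
  have hgball : ∀ a ∈ insert 0 Q, ContinuousOn (fun x => M⁻¹ * u x) (closedBall a d) ∧
      (∀ x ∈ closedBall a d, 0 ≤ M⁻¹ * u x ∧ M⁻¹ * u x ≤ 1) ∧
      (∀ x ∈ ball a d, x ≠ 0 → ContDiffAt ℝ 2 (fun x => M⁻¹ * u x) x) ∧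
      (∀ x ∈ ball a d, x ≠ 0 → -lap (fun x => M⁻¹ * u x) x =
        M ^ (p - 1) * ‖x‖ ^ (2 * α) * K x * (M⁻¹ * u x) ^ p) ∧
      (∀ x ∈ ball a d, k₀ ≤ K x ∧ K x ≤ k₁) := by
    intro a ha
    have hc := hdQ a ha
    have hb := ball_subset_closedBall.trans hc
    refine ⟨continuousOn_const.mul (hu.continuousOn.mono (hc.trans subset_closure)), ?_, ?_, ?_,
      fun x hx => hK x (hb hx)⟩
    · intro x hx
      have h1 := hu.pos x (hc hx)
      refine ⟨by positivity, ?_⟩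
      rw [inv_mul_le_iff₀ hM, mul_one]
      exact hmax x (hc hx)
    · exact fun x hx h => contDiffAt_const.mul (hu.contDiffAt hΩo (hb hx) h)
    · intro x hx h
      have h1 := hu.pos x (hb hx)
      rw [lap_const_mul (hu.contDiffAt hΩo (hb hx) h), ← mul_neg, hu.eq x ⟨hb hx, h⟩,
        Real.mul_rpow (by positivity) h1.le, Real.inv_rpow hM.le, Real.rpow_sub_one hM.ne']
      have : 0 < M ^ p := by positivity
      field_simp
  have hg1 : M⁻¹ * u x₀ = 1 := by rw [hMu]; exact inv_mul_cancel₀ hM.ne'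
  have hbound : p * M ^ (p - 1) ≤ A * Real.exp (B * p) := by
    rcases le_total (‖x₀‖ ^ (2 + 2 * α) * (p * M ^ (p - 1))) σ with h | h
    · obtain ⟨h1, h2, h3, h4, h5⟩ := hgball 0 (mem_insert _ _)
      refine (near p _ _ K x₀ hp1 hμ h1 h2 h3 h4 h5 h hg1).trans ?_
      gcongr
      exacts [le_max_left _ _, le_max_left _ _]
    · obtain ⟨h1, h2, h3, h4, h5⟩ := hgball x₀ (mem_insert_of_mem _ hx₀)
      have hxD : ‖x₀‖ ≤ D := by simpa using hΩD (hQΩ hx₀)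
      refine (away p _ _ K x₀ hp1 hμ h1 h2 h3 h4 h5 h hxD hg1).trans ?_
      gcongr
      exacts [le_max_right _ _, le_max_right _ _]
  have h1 : M ^ (p - 1) ≤ A * Real.exp (B * p) := by nlinarith
  have h2 : (p - 1) * Real.log M ≤ Real.log A + B * p := by
    have := Real.log_le_log hμ h1
    rwa [Real.log_rpow hM, Real.log_mul (by positivity) (Real.exp_pos _).ne', Real.log_exp] at this
  rw [← Real.log_le_iff_le_exp hM]
  have h3 : Real.log M ≤ B + (Real.log A + B) / (p - 1) := by
    have : 0 < p - 1 := by linarith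
    rw [← sub_le_iff_le_add', le_div_iff₀ this]
    linarith
  refine h3.trans ?_
  have : 0 < p₀ - 1 := by linarith
  gcongr

/-- Inversion in the circle with centre `z` and radius `ρ`. -/
def circleInv (z : Plane) (ρ : ℝ) (x : Plane) : Plane := z + (ρ ^ 2 / ‖x - z‖ ^ 2) • (x - z)

lemma circleInv_eq_conformal (z : Plane) (ρ : ℝ) (x : Plane) :
    circleInv z ρ x = z + (cToPlane.comp (Complex.conjCLE : ℂ →L[ℝ] ℂ))
      ((ρ : ℂ) ^ 2 / planeToC (x - z)) := by
  rw [circleInv, ← cToPlane_planeToC ((ρ ^ 2 / ‖x - z‖ ^ 2) • (x - z)), map_smul,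
    ← planeToC.norm_map (x - z)]
  generalize planeToC (x - z) = ζ
  have key : (ρ ^ 2 / ‖ζ‖ ^ 2) • ζ = (starRingEnd ℂ) ((ρ : ℂ) ^ 2 / ζ) := by
    simp only [map_div₀, map_pow, Complex.conj_ofReal, Complex.real_smul]
    rcases eq_or_ne ζ 0 with rfl | hζ
    · simp
    · have h1 : (starRingEnd ℂ) ζ ≠ 0 := by simpa using hζ
      have h2 : ((‖ζ‖ : ℝ) : ℂ) ^ 2 = ζ * (starRingEnd ℂ) ζ := by
        rw [Complex.mul_conj, Complex.normSq_eq_norm_sq]; push_cast; ring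
      push_cast
      rw [h2]
      field_simp
  rw [key]
  rfl

lemma contDiffAt_circleInv {z x : Plane} (ρ : ℝ) (hx : x ≠ z) :
    ContDiffAt ℝ 2 (circleInv z ρ) x := by
  have h := contDiffAt_sq_dist z x
  exact contDiffAt_const.add ((contDiffAt_const.div h (sq_dist_pos hx).ne').smul
    (contDiffAt_id.sub contDiffAt_const))

/-- Covariance of the Laplacian under inversion. -/
lemma lap_comp_circleInv {u : Plane → ℝ} {z x : Plane} {ρ : ℝ} (hx : x ≠ z)
    (hu : ContDiffAt ℝ 2 u (circleInv z ρ x)) :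
    lap (fun y => u (circleInv z ρ y)) x =
      (ρ ^ 2 / ‖x - z‖ ^ 2) ^ 2 * lap u (circleInv z ρ x) := by
  have hζ : planeToC (x - z) ≠ 0 := by
    rw [Ne, LinearIsometryEquiv.map_eq_zero_iff, sub_eq_zero]; exact hx
  simp only [circleInv_eq_conformal] at hu ⊢
  rw [lap_comp_conformal (F := fun ζ => (ρ : ℂ) ^ 2 / ζ) (F' := fun ζ => -((ρ : ℂ) ^ 2) / ζ ^ 2)
    (F'' := 2 * (ρ : ℂ) ^ 2 / planeToC (x - z) ^ 3) ?_ (Or.inr ?_) ?_ ?_ hu]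
  · rw [← planeToC.norm_map (x - z)]
    simp
  · simp [cToPlane_one]
  · simp [cToPlane_I]
  · filter_upwards [isOpen_ne.mem_nhds hζ] with ζ h
    have := (hasDerivAt_const ζ ((ρ : ℂ) ^ 2)).fun_div (hasDerivAt_id ζ) h
    simpa using this
  · have := (hasDerivAt_const (planeToC (x - z)) (-((ρ : ℂ) ^ 2))).fun_div
      ((hasDerivAt_id (planeToC (x - z))).fun_pow 2) (pow_ne_zero 2 hζ)
    refine this.congr_deriv ?_
    simp only [id]
    field_simp
    ring

lemma continuousAt_circleInv_uncurry {z x : Plane} (ρ : ℝ) (hx : x ≠ z) :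
    ContinuousAt (fun q : ℝ × Plane => circleInv z q.1 q.2) (ρ, x) := by
  unfold circleInv
  have h := (sq_dist_pos hx).ne'
  have h1 : ContinuousAt (fun q : ℝ × Plane => q.1 ^ 2 / ‖q.2 - z‖ ^ 2) (ρ, x) := by
    exact ContinuousAt.div (by fun_prop) (by fun_prop) h
  exact continuousAt_const.add (h1.smul (by fun_prop))

lemma circleInv_eq_self {z x : Plane} {ρ : ℝ} (hx : x ≠ z) (h : ‖x - z‖ ^ 2 = ρ ^ 2) :
    circleInv z ρ x = x := by
  rw [circleInv, ← h, div_self (sq_dist_pos hx).ne', one_smul]; abel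

lemma rpow_sub_rpow_le {a b M p : ℝ} (hb : 0 ≤ b) (hab : b ≤ a) (haM : a ≤ M) (hp : 1 < p) :
    a ^ p - b ^ p ≤ p * M ^ (p - 1) * (a - b) := by
  rcases hab.eq_or_lt with rfl | hlt
  · simp
  obtain ⟨c, hc, h⟩ := exists_hasDerivAt_eq_slope (fun t : ℝ => t ^ p)
    (fun t => p * t ^ (p - 1)) hlt
    (Real.continuous_rpow_const (by linarith)).continuousOn
    (fun x hx => Real.hasDerivAt_rpow_const (Or.inr hp.le))
  have hc0 : 0 < c := hb.trans_lt hc.1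
  rw [eq_div_iff (by linarith)] at h
  rw [← h]
  have h1 : c ^ (p - 1) ≤ M ^ (p - 1) :=
    Real.rpow_le_rpow hc0.le (hc.2.le.trans haM) (by linarith)
  have h2 : 0 ≤ a - b := by linarith
  have h3 : 0 ≤ p := by linarith
  gcongr

/-- Geometric conditions on a disc and on the weight under which the moving sphere method, with
spheres centred at `z` and radii in `[r, R]`, applies. -/
structure SphereAdmissible (Ω : Set Plane) (h : Plane → ℝ) (z : Plane) (r R : ℝ) : Prop where
  pos : 0 < r
  le : r ≤ R
  le_dist : ∀ x ∈ closure Ω, r ≤ ‖x - z‖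
  mem : ∀ x ∈ closure Ω, ‖x - z‖ < R → ∀ s, 1 < s → s * ‖x - z‖ ^ 2 ≤ R ^ 2 → z + s • (x - z) ∈ Ω
  ne_zero : ∀ x ∈ Ω, ‖x - z‖ < R → x ≠ 0
  ne_zero' : ∀ x ∈ Ω, ‖x - z‖ < R → ∀ s, 1 < s → s * ‖x - z‖ ^ 2 ≤ R ^ 2 → z + s • (x - z) ≠ 0
  lt : ∀ x ∈ Ω, ‖x - z‖ < R → ∀ s, 1 < s → s * ‖x - z‖ ^ 2 ≤ R ^ 2 →
    h x < s ^ 2 * h (z + s • (x - z))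

namespace SphereAdmissible

variable {Ω : Set Plane} {h : Plane → ℝ} {z : Plane} {r R : ℝ}

lemma ne_center (hS : SphereAdmissible Ω h z r R) {x : Plane} (hx : x ∈ closure Ω) : x ≠ z := by
  rintro rfl
  have := hS.le_dist x hx
  rw [sub_self, norm_zero] at this
  exact this.not_gt hS.pos

lemma ratio (hS : SphereAdmissible Ω h z r R) {x : Plane} (hx : x ∈ closure Ω) {ρ : ℝ}
    (hxρ : ‖x - z‖ < ρ) (hρ : ρ ≤ R) :
    1 < ρ ^ 2 / ‖x - z‖ ^ 2 ∧ ρ ^ 2 / ‖x - z‖ ^ 2 * ‖x - z‖ ^ 2 ≤ R ^ 2 := by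
  have h1 := sq_dist_pos (hS.ne_center hx)
  have h2 := norm_nonneg (x - z)
  constructor
  · rw [one_lt_div h1]; exact pow_lt_pow_left₀ hxρ h2 two_ne_zero
  · rw [div_mul_cancel₀ _ h1.ne']; exact pow_le_pow_left₀ (h2.trans hxρ.le) hρ 2

lemma circleInv_mem (hS : SphereAdmissible Ω h z r R) {x : Plane} (hx : x ∈ closure Ω) {ρ : ℝ}
    (hxρ : ‖x - z‖ < ρ) (hρ : ρ ≤ R) : circleInv z ρ x ∈ Ω :=
  hS.mem x hx (hxρ.trans_le hρ) _ (hS.ratio hx hxρ hρ).1 (hS.ratio hx hxρ hρ).2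

lemma circleInv_mem_closure (hS : SphereAdmissible Ω h z r R) {x : Plane} (hx : x ∈ closure Ω)
    {ρ : ℝ} (hxρ : ‖x - z‖ ≤ ρ) (hρ : ρ ≤ R) : circleInv z ρ x ∈ closure Ω := by
  rcases hxρ.eq_or_lt with h | h
  · rwa [circleInv_eq_self (hS.ne_center hx) (by rw [h])]
  · exact subset_closure (hS.circleInv_mem hx h hρ)

variable {α p : ℝ} {K u : Plane → ℝ}

lemma contDiffAt_lap (hΩo : IsOpen Ω)
    (hS : SphereAdmissible Ω (fun x => ‖x‖ ^ (2 * α) * K x) z r R)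
    (hu : IsHenonSolution Ω α K p u) {x : Plane} (hx : x ∈ Ω) {ρ : ℝ} (hxρ : ‖x - z‖ < ρ)
    (hρ : ρ ≤ R) :
    ContDiffAt ℝ 2 (fun y => u (circleInv z ρ y) - u y) x ∧
      lap (fun y => u (circleInv z ρ y) - u y) x = ‖x‖ ^ (2 * α) * K x * u x ^ p -
        (ρ ^ 2 / ‖x - z‖ ^ 2) ^ 2 * (‖circleInv z ρ x‖ ^ (2 * α) * K (circleInv z ρ x)) *
          u (circleInv z ρ x) ^ p ∧
      ‖x‖ ^ (2 * α) * K x <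
        (ρ ^ 2 / ‖x - z‖ ^ 2) ^ 2 * (‖circleInv z ρ x‖ ^ (2 * α) * K (circleInv z ρ x)) := by
  have hxc := subset_closure hx
  have hr := hS.ratio hxc hxρ hρ
  have hxR := hxρ.trans_le hρ
  have hne := hS.ne_center hxc
  have hx0 := hS.ne_zero x hx hxR
  have hm := hS.circleInv_mem hxc hxρ hρ
  have hm0 : circleInv z ρ x ≠ 0 := hS.ne_zero' x hx hxR _ hr.1 hr.2
  have h1 := hu.contDiffAt hΩo hx hx0
  have h2 := hu.contDiffAt hΩo hm hm0
  have h3 : ContDiffAt ℝ 2 (fun y => u (circleInv z ρ y)) x :=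
    h2.comp (f := circleInv z ρ) x (contDiffAt_circleInv ρ hne)
  refine ⟨h3.sub h1, ?_, hS.lt x hx hxR _ hr.1 hr.2⟩
  rw [lap_sub h3 h1, lap_comp_circleInv hne h2]
  have e1 := hu.eq x ⟨hx, hx0⟩
  have e2 := hu.eq _ ⟨hm, hm0⟩
  rw [mul_assoc _ _ (u (circleInv z ρ x) ^ p), ← e1, ← e2]; ring

lemma lt_of_forall_le (hΩo : IsOpen Ω)
    (hS : SphereAdmissible Ω (fun x => ‖x‖ ^ (2 * α) * K x) z r R)
    (hu : IsHenonSolution Ω α K p u) {ρ : ℝ} (hρ : ρ ≤ R)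
    (hle : ∀ x ∈ Ω, ‖x - z‖ < ρ → u x ≤ u (circleInv z ρ x)) {x : Plane}
    (hx : x ∈ closure Ω) (hxρ : ‖x - z‖ < ρ) : u x < u (circleInv z ρ x) := by
  have hm := hS.circleInv_mem hx hxρ hρ
  by_cases hxΩ : x ∈ Ω
  · refine (hle x hxΩ hxρ).lt_of_ne fun heq => ?_
    obtain ⟨hc, hl, hlt⟩ := contDiffAt_lap hΩo hS hu hxΩ hxρ hρ
    have hloc : IsLocalMin (fun y => u (circleInv z ρ y) - u y) x := by
      have h1 : Ω ∩ {y | ‖y - z‖ < ρ} ∈ 𝓝 x :=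
        (hΩo.inter (isOpen_lt (by fun_prop) continuous_const)).mem_nhds ⟨hxΩ, hxρ⟩
      filter_upwards [h1] with y hy
      have := hle y hy.1 hy.2
      rw [← heq]; linarith
    have h2 := lap_nonneg_of_isLocalMin hc hloc
    rw [hl, ← heq] at h2
    have h3 : 0 < u x ^ p := Real.rpow_pos_of_pos (hu.pos x hxΩ) _
    have h4 := mul_lt_mul_of_pos_right hlt h3
    linarith
  · rw [hu.zero x ⟨hx, by rwa [hΩo.interior_eq]⟩]
    exact hu.pos _ hm

lemma exists_gt (hΩo : IsOpen Ω) (hΩb : Bornology.IsBounded Ω)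
    (hS : SphereAdmissible Ω (fun x => ‖x‖ ^ (2 * α) * K x) z r R)
    {H : ℝ} (hH : ∀ x ∈ Ω, ‖x - z‖ < R → ‖x‖ ^ (2 * α) * K x ≤ H) (hK : ∀ x ∈ Ω, 0 ≤ K x)
    (hp : 1 < p) (hu : IsHenonSolution Ω α K p u) {ρ₁ : ℝ} (hrρ : r ≤ ρ₁) (hρ₁ : ρ₁ < R)
    (hle : ∀ x ∈ Ω, ‖x - z‖ < ρ₁ → u x ≤ u (circleInv z ρ₁ x)) {ρ₂ : ℝ} (hρ₂ : ρ₁ < ρ₂) :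
    ∃ ρ, ρ₁ < ρ ∧ ρ ≤ ρ₂ ∧ ∀ x ∈ Ω, ‖x - z‖ < ρ → u x ≤ u (circleInv z ρ x) := by
  have hr := hS.pos
  have hcomp := hΩb.isCompact_closure
  obtain ⟨M, hM⟩ := hcomp.bddAbove_image hu.continuousOn
  have hM : ∀ x ∈ closure Ω, u x ≤ M := fun x hx => hM (mem_image_of_mem u hx)
  have hunn : ∀ x ∈ closure Ω, 0 ≤ u x := by
    intro x hx
    by_cases hxΩ : x ∈ Ω
    · exact (hu.pos x hxΩ).le
    · rw [hu.zero x ⟨hx, by rwa [hΩo.interior_eq]⟩]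
  obtain ⟨A, hA, hAle⟩ : ∃ A > 0, H * (p * M ^ (p - 1)) ≤ A :=
    ⟨max 1 (H * (p * M ^ (p - 1))), by positivity, le_max_right _ _⟩
  set B := A / (2 * r ^ 2) with hB
  have hB0 : 0 < B := by positivity
  obtain ⟨κ, hκ0, hκr, hκB⟩ : ∃ κ > 0, κ ≤ r ^ 2 / 2 ∧ B * κ ^ 2 ≤ 1 / 2 := by
    have h1 : Tendsto (fun κ : ℝ => B * κ ^ 2) (𝓝[>] 0) (𝓝 0) := by
      have : Continuous (fun κ : ℝ => B * κ ^ 2) := by fun_prop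
      simpa using (this.tendsto 0).mono_left (nhdsWithin_le_nhds (s := Ioi 0))
    have h2 : ∀ᶠ κ in 𝓝[>] (0:ℝ), 0 < κ := self_mem_nhdsWithin
    have h3 : ∀ᶠ κ in 𝓝[>] (0:ℝ), κ < r ^ 2 / 2 :=
      nhdsWithin_le_nhds (gt_mem_nhds (by positivity))
    obtain ⟨κ, h4, h5, h6⟩ := (h2.and (h3.and (h1.eventually_lt_const
      (show (0:ℝ) < 1 / 2 by norm_num)))).exists
    exact ⟨κ, h4, h5.le, h6.le⟩
  have hQ : IsCompact (closure Ω ∩ {x | ‖x - z‖ ^ 2 ≤ ρ₁ ^ 2 - κ}) :=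
    hcomp.inter_right (isClosed_le (by fun_prop) continuous_const)
  have hlt_of : ∀ {x : Plane} {ρ : ℝ}, 0 < ρ → ‖x - z‖ ^ 2 < ρ ^ 2 → ‖x - z‖ < ρ :=
    fun hρ h => lt_of_pow_lt_pow_left₀ 2 hρ.le h
  have hρ₁0 : 0 < ρ₁ := hr.trans_le hrρ
  have hev : ∀ᶠ ρ in 𝓝 ρ₁, ∀ x ∈ closure Ω ∩ {x | ‖x - z‖ ^ 2 ≤ ρ₁ ^ 2 - κ},
      x ∈ closure Ω → u x < u (circleInv z ρ x) := by
    refine hQ.eventually_forall_of_forall_eventually fun x hx => ?_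
    have hxρ : ‖x - z‖ < ρ₁ := hlt_of hρ₁0 (by have := hx.2; simp only [mem_ofPred_eq] at this; linarith)
    obtain ⟨c, hc1, hc2⟩ := exists_between (lt_of_forall_le hΩo hS hu hρ₁.le hle hx.1 hxρ)
    have hm := hS.circleInv_mem hx.1 hxρ hρ₁.le
    have h1 : ∀ᶠ q : ℝ × Plane in 𝓝 (ρ₁, x), c < u (circleInv z q.1 q.2) := by
      have hca : ContinuousAt u (circleInv z ρ₁ x) :=
        (hu.continuousOn.mono subset_closure).continuousAt (hΩo.mem_nhds hm)
      exact (ContinuousAt.comp (g := u) (f := fun q : ℝ × Plane => circleInv z q.1 q.2)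
        (x := (ρ₁, x)) hca (continuousAt_circleInv_uncurry ρ₁ (hS.ne_center hx.1))).eventually
        (lt_mem_nhds hc2)
    have h2 : ∀ᶠ y in 𝓝 x, y ∈ closure Ω → u y < c :=
      eventually_nhdsWithin_iff.1 ((hu.continuousOn x hx.1).eventually (gt_mem_nhds hc1))
    have h3 : ∀ᶠ q : ℝ × Plane in 𝓝 (ρ₁, x), q.2 ∈ closure Ω → u q.2 < c :=
      (continuous_snd.tendsto (ρ₁, x)).eventually h2
    filter_upwards [h1, h3] with q hq1 hq3 hq
    exact (hq3 hq).trans hq1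
  have hev2 : ∀ᶠ ρ in 𝓝 ρ₁, ρ ^ 2 ≤ ρ₁ ^ 2 + κ := by
    have : Continuous (fun ρ : ℝ => ρ ^ 2) := by fun_prop
    exact ((this.tendsto ρ₁).eventually_lt_const (by linarith)).mono fun _ h => h.le
  have hpos : ∀ᶠ ρ in 𝓝[>] ρ₁, ρ₁ < ρ := self_mem_nhdsWithin
  obtain ⟨ρ, hρ1, hρQ, hρκ, hρR, hρ2⟩ := (hpos.and (nhdsWithin_le_nhds (hev.and (hev2.and
    ((gt_mem_nhds hρ₁).and (gt_mem_nhds hρ₂)))))).exists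
  refine ⟨ρ, hρ1, hρ2.le, ?_⟩
  have hρ0 : 0 < ρ := hρ₁0.trans hρ1
  set D := Ω ∩ {x | ρ₁ ^ 2 - κ < ‖x - z‖ ^ 2 ∧ ‖x - z‖ ^ 2 < ρ ^ 2} with hDdef
  have hDo : IsOpen D := hΩo.inter ((isOpen_lt continuous_const (by fun_prop)).and
    (isOpen_lt (by fun_prop) continuous_const))
  have hDcl : ∀ x ∈ closure D, x ∈ closure Ω ∧ ρ₁ ^ 2 - κ ≤ ‖x - z‖ ^ 2 ∧
      ‖x - z‖ ^ 2 ≤ ρ ^ 2 := by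
    intro x hx
    have hcl : IsClosed (closure Ω ∩ {x | ρ₁ ^ 2 - κ ≤ ‖x - z‖ ^ 2 ∧ ‖x - z‖ ^ 2 ≤ ρ ^ 2}) :=
      isClosed_closure.inter ((isClosed_le continuous_const (by fun_prop)).and
        (isClosed_le (by fun_prop) continuous_const))
    have hsub : D ⊆ closure Ω ∩ {x | ρ₁ ^ 2 - κ ≤ ‖x - z‖ ^ 2 ∧ ‖x - z‖ ^ 2 ≤ ρ ^ 2} :=
      fun y hy => ⟨subset_closure hy.1, hy.2.1.le, hy.2.2.le⟩
    exact closure_minimal hsub hcl hx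
  have hnarrow : ∀ x ∈ D, 0 ≤ u (circleInv z ρ x) - u x := by
    refine narrow_principle (φ := fun x => 1 - B * (‖x - z‖ ^ 2 - ρ₁ ^ 2) ^ 2) (A := A) hDo
      (hΩb.subset inter_subset_left) ?_ (by fun_prop) ?_ ?_ ?_ ?_ ?_ ?_
    · have hcc := hu.continuousOn.mono (fun x hx => (hDcl x hx).1)
      refine ContinuousOn.sub (hu.continuousOn.comp (t := closure Ω) (fun x hx => ?_) fun x hx => ?_)
        hcc
      · exact (contDiffAt_circleInv ρ
          (hS.ne_center (hDcl x hx).1)).continuousAt.continuousWithinAt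
      · exact hS.circleInv_mem_closure (hDcl x hx).1
          (le_of_sq_le_sq (hDcl x hx).2.2 hρ0.le) hρR.le
    · intro x hx
      exact (contDiffAt_lap hΩo hS hu hx.1 (hlt_of hρ0 hx.2.2) hρR.le).1
    · intro x _
      exact contDiffAt_const.sub (contDiffAt_const.mul
        (((contDiffAt_sq_dist z x).sub contDiffAt_const).pow 2))
    · intro x hx
      obtain ⟨-, h1, h2⟩ := hDcl x hx
      have h3 : (‖x - z‖ ^ 2 - ρ₁ ^ 2) ^ 2 ≤ κ ^ 2 := by
        apply sq_le_sq' <;> linarith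
      have := mul_le_mul_of_nonneg_left h3 hB0.le
      show 0 < 1 - B * (‖x - z‖ ^ 2 - ρ₁ ^ 2) ^ 2
      linarith
    · intro x hx
      have hxcl := hDcl x hx.1
      by_cases hxΩ : x ∈ Ω
      · have hn : ¬ (ρ₁ ^ 2 - κ < ‖x - z‖ ^ 2 ∧ ‖x - z‖ ^ 2 < ρ ^ 2) := by
          intro hn
          have := hx.2
          rw [hDo.interior_eq] at this
          exact this ⟨hxΩ, hn⟩
        by_cases h1 : ‖x - z‖ ^ 2 ≤ ρ₁ ^ 2 - κ
        · linarith [hρQ x ⟨hxcl.1, h1⟩ hxcl.1]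
        · have h2 : ‖x - z‖ ^ 2 = ρ ^ 2 :=
            le_antisymm hxcl.2.2 (not_lt.1 fun h => hn ⟨not_le.1 h1, h⟩)
          rw [circleInv_eq_self (hS.ne_center hxcl.1) h2]; simp
      · rw [hu.zero x ⟨hxcl.1, by rwa [hΩo.interior_eq]⟩, sub_zero]
        exact hunn _ (hS.circleInv_mem_closure hxcl.1 (le_of_sq_le_sq hxcl.2.2 hρ0.le) hρR.le)
    · intro x hx
      have := lap_comp_sq_dist (φ := fun s => 1 - B * (s - ρ₁ ^ 2) ^ 2)
        (φ' := fun s => -(B * (2 * (s - ρ₁ ^ 2)))) (φ'' := -(B * 2)) (a := z) (x := x) ?_ ?_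
      · rw [this]
        have h1 : r ^ 2 ≤ ‖x - z‖ ^ 2 := by
          have := hS.le_dist x (subset_closure hx.1); gcongr
        have h2 : ρ₁ ^ 2 - κ < ‖x - z‖ ^ 2 := hx.2.1
        have h4 : A = 2 * r ^ 2 * B := by rw [hB]; field_simp
        generalize ‖x - z‖ ^ 2 = s at *
        have h5 : 0 ≤ A * (B * (s - ρ₁ ^ 2) ^ 2) := by positivity
        have h6 : B * (4 * r ^ 2) ≤ B * (8 * s + 8 * (s - ρ₁ ^ 2)) := by
          gcongr; linarith
        have h7 : 0 < r ^ 2 * B := by positivity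
        nlinarith
      · refine Eventually.of_forall fun s => ?_
        have := ((((hasDerivAt_id s).sub_const (ρ₁ ^ 2)).fun_pow 2).const_mul B).const_sub 1
        simpa using this
      · have := ((((hasDerivAt_id (‖x - z‖ ^ 2)).sub_const (ρ₁ ^ 2)).const_mul 2).const_mul B).neg
        exact (this.congr_deriv (by simp)).congr_of_eventuallyEq (Eventually.of_forall fun _ => rfl)
    · intro x hx hneg
      have hxρ := hlt_of hρ0 hx.2.2
      obtain ⟨-, hl, hlt⟩ := contDiffAt_lap hΩo hS hu hx.1 hxρ hρR.le
      have hxc := subset_closure hx.1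
      have hm := hS.circleInv_mem hxc hxρ hρR.le
      have hb := (hu.pos _ hm).le
      rw [hl]
      have h1 := rpow_sub_rpow_le hb (by linarith : u (circleInv z ρ x) ≤ u x) (hM x hxc) hp
      have h2 := mul_le_mul_of_nonneg_right hlt.le (Real.rpow_nonneg hb p)
      have h3 : 0 ≤ ‖x‖ ^ (2 * α) * K x := mul_nonneg (by positivity) (hK x hx.1)
      have h4 := mul_le_mul_of_nonneg_left h1 h3
      have hM0 : 0 ≤ M := (hunn x hxc).trans (hM x hxc)
      have h5 : ‖x‖ ^ (2 * α) * K x * (p * M ^ (p - 1) * (u x - u (circleInv z ρ x))) ≤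
          H * (p * M ^ (p - 1) * (u x - u (circleInv z ρ x))) := by
        apply mul_le_mul_of_nonneg_right (hH x hx.1 (hxρ.trans hρR))
        have : 0 ≤ u x - u (circleInv z ρ x) := by linarith
        have : 0 ≤ p := by linarith
        positivity
      have h6 : H * (p * M ^ (p - 1)) * (u x - u (circleInv z ρ x)) ≤
          A * (u x - u (circleInv z ρ x)) := by
        apply mul_le_mul_of_nonneg_right hAle; linarith
      linarith
  intro x hx hxρ
  by_cases h1 : ‖x - z‖ ^ 2 ≤ ρ₁ ^ 2 - κ
  · exact (hρQ x ⟨subset_closure hx, h1⟩ (subset_closure hx)).le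
  · have := hnarrow x ⟨hx, not_le.1 h1, by gcongr⟩
    linarith

/-- The moving sphere comparison. -/
lemma le_circleInv (hΩo : IsOpen Ω) (hΩb : Bornology.IsBounded Ω)
    (hS : SphereAdmissible Ω (fun x => ‖x‖ ^ (2 * α) * K x) z r R)
    {H : ℝ} (hH : ∀ x ∈ Ω, ‖x - z‖ < R → ‖x‖ ^ (2 * α) * K x ≤ H) (hK : ∀ x ∈ Ω, 0 ≤ K x)
    (hp : 1 < p) (hu : IsHenonSolution Ω α K p u) {x : Plane} (hx : x ∈ Ω) (hxR : ‖x - z‖ < R) :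
    u x ≤ u (circleInv z R x) := by
  set S := {ρ : ℝ | ∀ x ∈ Ω, ‖x - z‖ < ρ → u x ≤ u (circleInv z ρ x)} with hSdef
  have hcl : IsClosed (S ∩ Icc r R) := by
    refine isClosed_of_closure_subset fun ρ hρ => ?_
    have hρI : ρ ∈ Icc r R := closure_minimal inter_subset_right isClosed_Icc hρ
    refine ⟨fun y hy hyρ => ?_, hρI⟩
    rw [mem_closure_iff_frequently] at hρ
    have hm := hS.circleInv_mem (subset_closure hy) hyρ hρI.2
    have hca : ContinuousAt u (circleInv z ρ y) :=
      (hu.continuousOn.mono subset_closure).continuousAt (hΩo.mem_nhds hm)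
    have hcc : ContinuousAt (fun ρ => circleInv z ρ y) ρ := by
      unfold circleInv; fun_prop
    have hc : Tendsto (fun ρ => u (circleInv z ρ y)) (𝓝 ρ) (𝓝 (u (circleInv z ρ y))) :=
      ContinuousAt.comp (g := u) (f := fun ρ => circleInv z ρ y) (x := ρ) hca hcc
    refine ge_of_tendsto_of_frequently hc ?_
    exact (hρ.and_eventually (lt_mem_nhds hyρ)).mono fun ρ' h => h.1.1 y hy h.2
  have := hcl.Icc_subset_of_forall_exists_gt (fun y hy hyr =>
      absurd (hS.le_dist y (subset_closure hy)) (not_le.2 hyr)) (fun ρ₁ hρ₁ ρ₂ hρ₂ => ?_)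
  · exact this (right_mem_Icc.2 hS.le) x hx hxR
  · obtain ⟨ρ, h1, h2, h3⟩ := exists_gt hΩo hΩb hS hH hK hp hu hρ₁.2.1 hρ₁.2.2 hρ₁.1 hρ₂
    exact ⟨ρ, h3, h1, h2⟩

end SphereAdmissible

lemma exists_norm_fderiv_sub_le {f : Plane → ℝ} {a : Plane} (hf : ContDiffAt ℝ 2 f a) :
    ∃ C > 0, ∃ ε > 0, ∀ y ∈ ball a ε, DifferentiableAt ℝ f y ∧
      ‖fderiv ℝ f y - fderiv ℝ f a‖ ≤ C * ‖y - a‖ := by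
  obtain ⟨k, t, ht, hk⟩ := (hf.fderiv_right (m := 1) (by norm_num)).exists_lipschitzOnWith
  obtain ⟨ε, hε, h⟩ := Metric.mem_nhds_iff.1 (inter_mem ht hf.eventually_differentiableAt)
  refine ⟨k + 1, by positivity, ε, hε, fun y hy => ⟨(h hy).2, ?_⟩⟩
  have h1 := hk.norm_sub_le (h hy).1 (h (mem_ball_self hε)).1
  have h2 := norm_nonneg (y - a)
  linarith

lemma exists_lipschitz_on_segments {h : Plane → ℝ} {S : Set Plane} {a : Plane}
    (hh : ContDiffWithinAt ℝ 1 h S a) (ha : a ∈ S) :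
    ∃ L ≥ 0, ∃ ε > 0, ∀ y q, segment ℝ y q ⊆ S ∩ ball a ε → |h q - h y| ≤ L * ‖q - y‖ := by
  have h1 : ContDiffWithinAt ℝ (0 + 1) h S a := by simpa using hh
  obtain ⟨t, ht, -, h', hd, hc⟩ :=
    (contDiffWithinAt_succ_iff_hasFDerivWithinAt (by norm_num)).1 h1
  rw [insert_eq_of_mem ha] at ht
  have hat : a ∈ t := mem_of_mem_nhdsWithin ha ht
  have h2 : ∀ᶠ y in 𝓝[t] a, ‖h' y‖ < ‖h' a‖ + 1 :=
    hc.continuousWithinAt.norm.eventually (gt_mem_nhds (lt_add_one _))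
  have h3 : ∀ᶠ y in 𝓝[S] a, y ∈ t ∧ ‖h' y‖ < ‖h' a‖ + 1 := by
    have h4 : 𝓝[S] a ≤ 𝓝[t] a := le_inf nhdsWithin_le_nhds (le_principal_iff.2 ht)
    exact Filter.Eventually.and ht (h4 h2)
  rw [eventually_nhdsWithin_iff] at h3
  obtain ⟨ε, hε, h4⟩ := Metric.eventually_nhds_iff_ball.1 h3
  refine ⟨‖h' a‖ + 1, by positivity, ε, hε, fun y q hyq => ?_⟩
  have h5 : ∀ x ∈ segment ℝ y q, x ∈ t ∧ ‖h' x‖ < ‖h' a‖ + 1 :=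
    fun x hx => h4 x (hyq hx).2 (hyq hx).1
  exact Convex.norm_image_sub_le_of_norm_hasFDerivWithin_le (𝕜 := ℝ)
    (fun x hx => (hd x (h5 x hx).1).mono fun x hx => (h5 x hx).1) (fun x hx => (h5 x hx).2.le)
    (convex_segment y q) (left_mem_segment ℝ y q) (right_mem_segment ℝ y q)

lemma lt_sq_mul_of_abs_sub_le {s r L m b c : ℝ} (hs : 1 < s) (hs4 : s ≤ 4) (hr : 0 ≤ r)
    (hL : 0 ≤ L) (hb : m < b) (hm : 16 * (L * r) < m)
    (hbc : |c - b| ≤ L * ((s - 1) * (2 * r))) : b < s ^ 2 * c := by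
  have h1 := (abs_le.1 hbc).1
  have hs0 : 0 < s - 1 := by linarith
  have h2 : s ^ 2 * (b - L * ((s - 1) * (2 * r))) ≤ s ^ 2 * c := by
    gcongr; linarith
  have h3 : s ^ 2 * (L * r) ≤ 16 * (L * r) := by
    have : 0 ≤ L * r := by positivity
    gcongr; nlinarith
  have h4 : 0 < (s - 1) * ((s + 1) * b - 2 * (s ^ 2 * (L * r))) := by
    apply mul_pos hs0
    have : 0 ≤ L * r := by positivity
    nlinarith
  nlinarith

set_option maxHeartbeats 800000 in
/-- A domain with smooth boundary admits small exterior spheres at each boundary point for which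
the moving sphere method applies. -/
lemma exists_sphereAdmissible {Ω : Set Plane} (hΩsm : SmoothBoundary Ω) {x₀ : Plane}
    (hx₀ : x₀ ∈ frontier Ω) (hne : x₀ ≠ 0) {h : Plane → ℝ}
    (hh : ContDiffWithinAt ℝ 1 h (closure Ω) x₀) (hpos : 0 < h x₀) :
    ∃ z r R H, SphereAdmissible Ω h z r R ∧ ‖x₀ - z‖ < R ∧
      ∀ x ∈ Ω, ‖x - z‖ < R → h x ≤ H := by
  obtain ⟨U, f, hU, hxU, hf, hfne, hfΩ, hf0⟩ := hΩsm x₀ hx₀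
  have hx₀c : x₀ ∈ closure Ω := frontier_subset_closure hx₀
  have hfx₀ : f x₀ = 0 := (hf0 ▸ ⟨hx₀, hxU⟩ : x₀ ∈ {y ∈ U | f y = 0}).2
  have hfC : ContDiffAt ℝ 2 f x₀ := (hf.contDiffAt (hU.mem_nhds hxU)).of_le 
    (WithTop.coe_le_coe.2 (le_top : (2 : ℕ∞) ≤ ⊤))
  have hneg : ∀ y ∈ U, f y < 0 → y ∈ Ω := fun y hy hfy =>
    (hfΩ ▸ (⟨hy, hfy⟩ : y ∈ {y ∈ U | f y < 0}) : y ∈ Ω ∩ U).1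
  have hnonpos : ∀ y ∈ closure Ω, y ∈ U → f y ≤ 0 := by
    intro y hy hyU
    by_cases hyΩ : y ∈ Ω
    · exact (hfΩ ▸ ⟨hyΩ, hyU⟩ : y ∈ {y ∈ U | f y < 0}).2.le
    · have hyf : y ∈ frontier Ω := ⟨hy, fun hi => hyΩ (interior_subset hi)⟩
      exact (hf0 ▸ ⟨hyf, hyU⟩ : y ∈ {y ∈ U | f y = 0}).2.le
  obtain ⟨n, a, hn, ha, hfn⟩ : ∃ (n : Plane) (a : ℝ), ‖n‖ = 1 ∧ 0 < a ∧
      ∀ w, fderiv ℝ f x₀ w = a * inner ℝ n w := by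
    set v := (InnerProductSpace.toDual ℝ Plane).symm (fderiv ℝ f x₀) with hv
    have hv0 : v ≠ 0 := by
      rw [hv, Ne, LinearIsometryEquiv.map_eq_zero_iff]; exact hfne x₀ hxU
    have hvn : ‖v‖ ≠ 0 := norm_ne_zero_iff.2 hv0
    refine ⟨‖v‖⁻¹ • v, ‖v‖, ?_, norm_pos_iff.2 hv0, fun w => ?_⟩
    · rw [norm_smul, norm_inv, norm_norm, inv_mul_cancel₀ hvn]
    · rw [real_inner_smul_left, mul_inv_cancel_left₀ hvn]
      exact InnerProductSpace.toDual_symm_apply.symm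
  obtain ⟨C, hC, ε₁, hε₁, hfd⟩ := exists_norm_fderiv_sub_le hfC
  obtain ⟨L, hL, ε₂, hε₂, hlip⟩ := exists_lipschitz_on_segments hh hx₀c
  have hval : ∀ᶠ y in 𝓝 x₀, y ∈ closure Ω → h x₀ / 2 < h y ∧ h y < h x₀ + 1 := by
    rw [← eventually_nhdsWithin_iff]
    exact hh.continuousWithinAt.eventually
      ((lt_mem_nhds (half_lt_self hpos)).and (gt_mem_nhds (lt_add_one _)))
  obtain ⟨ε₃, hε₃, hnear⟩ := Metric.eventually_nhds_iff_ball.1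
    (hval.and ((hU.eventually_mem hxU).and (isOpen_ne.eventually_mem hne)))
  set m := h x₀ / 2 with hm
  have hm0 : 0 < m := half_pos hpos
  obtain ⟨ε, hε, hε1, hε2, hε3⟩ : ∃ ε > 0, ε ≤ ε₁ ∧ ε ≤ ε₂ ∧ ε ≤ ε₃ :=
    ⟨min ε₁ (min ε₂ ε₃), by positivity, min_le_left _ _, (min_le_right _ _).trans (min_le_left _ _),
      (min_le_right _ _).trans (min_le_right _ _)⟩
  obtain ⟨r, hr, hrε, hrC, hrL⟩ : ∃ r > 0, 6 * r ≤ ε ∧ 40 * (C * r) ≤ a ∧ 16 * (L * r) < m := by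
    refine ⟨min (ε / 6) (min (a / (40 * C)) (m / (16 * (L + 1)))), by positivity, ?_, ?_, ?_⟩
    · have := min_le_left (ε / 6) (min (a / (40 * C)) (m / (16 * (L + 1))))
      linarith
    · have := (min_le_right (ε / 6) (min (a / (40 * C)) (m / (16 * (L + 1))))).trans
        (min_le_left _ _)
      rw [le_div_iff₀ (by positivity)] at this
      linarith
    · have h1 := (min_le_right (ε / 6) (min (a / (40 * C)) (m / (16 * (L + 1))))).trans
        (min_le_right _ _)
      have h2 : 0 < min (ε / 6) (min (a / (40 * C)) (m / (16 * (L + 1)))) := by positivity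
      rw [le_div_iff₀ (by positivity)] at h1
      linarith
  have hball : ∀ y ∈ ball x₀ ε, DifferentiableAt ℝ f y ∧
      ‖fderiv ℝ f y - fderiv ℝ f x₀‖ ≤ C * ‖y - x₀‖ ∧ (y ∈ closure Ω → m < h y ∧ h y < h x₀ + 1) ∧
      y ∈ U ∧ y ≠ 0 := by
    intro y hy
    have h1 := hfd y (ball_subset_ball hε1 hy)
    have h2 := hnear y (ball_subset_ball hε3 hy)
    exact ⟨h1.1, h1.2, h2.1, h2.2.1, h2.2.2⟩
  set z := x₀ + r • n with hz
  have hnz : ‖x₀ - z‖ = r := by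
    rw [hz, sub_add_cancel_left, norm_neg, norm_smul, hn, mul_one, Real.norm_of_nonneg hr.le]
  -- the quadratic separation between the closed domain and the sphere
  have hquad : ∀ y ∈ closure Ω, y ∈ ball x₀ ε → a * inner ℝ n (y - x₀) ≤ C * ‖y - x₀‖ ^ 2 := by
    intro y hy hyε
    have hsub : ∀ q ∈ closedBall x₀ ‖y - x₀‖, q ∈ ball x₀ ε := fun q hq =>
      lt_of_le_of_lt hq (by rwa [mem_ball, dist_eq_norm] at hyε)
    have h1 := Convex.norm_image_sub_le_of_norm_fderiv_le' (𝕜 := ℝ) (f := f) (x := x₀) (y := y)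
      (φ := fderiv ℝ f x₀) (C := C * ‖y - x₀‖) (fun q hq => (hball q (hsub q hq)).1)
      (fun q hq => (hball q (hsub q hq)).2.1.trans
        (mul_le_mul_of_nonneg_left (by rw [← dist_eq_norm]; exact hq) hC.le))
      (convex_closedBall x₀ ‖y - x₀‖) (mem_closedBall_self (norm_nonneg _))
      (by rw [mem_closedBall, dist_eq_norm])
    rw [hfn, hfx₀, Real.norm_eq_abs, abs_le] at h1
    have h2 := hnonpos y hy (hball y hyε).2.2.2.1
    nlinarith [h1.1]
  have hexp : ∀ y : Plane, ‖y - z‖ ^ 2 = ‖y - x₀‖ ^ 2 - 2 * (r * inner ℝ n (y - x₀)) + r ^ 2 := by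
    intro y
    rw [hz, ← sub_sub, norm_sub_sq_real, real_inner_smul_right, real_inner_comm, norm_smul, hn,
      mul_one, Real.norm_of_nonneg hr.le]
  have hsep : ∀ y ∈ closure Ω, y ∈ ball x₀ ε → r ^ 2 + ‖y - x₀‖ ^ 2 / 2 ≤ ‖y - z‖ ^ 2 := by
    intro y hy hyε
    rw [hexp]
    have h1 := hquad y hy hyε
    have h2 : 0 ≤ ‖y - x₀‖ ^ 2 := by positivity
    generalize inner ℝ n (y - x₀) = b at *
    generalize ‖y - x₀‖ ^ 2 = s at *
    have h3 : 40 * (C * r) * s ≤ a * s := by gcongr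
    have h4 : a * b * r ≤ C * s * r := by gcongr
    have h5 : a * (4 * (r * b)) ≤ a * s := by nlinarith
    have := le_of_mul_le_mul_left h5 ha
    linarith
  have htri : ∀ y, ‖y - x₀‖ ≤ ‖y - z‖ + r := by
    intro y
    have := norm_sub_le_norm_sub_add_norm_sub y z x₀
    rwa [norm_sub_rev z x₀, hnz] at this
  have hfar : ∀ y, y ∉ ball x₀ ε → 2 * r ≤ ‖y - z‖ := by
    intro y hy
    rw [mem_ball, dist_eq_norm, not_lt] at hy
    linarith [htri y]
  have hle : ∀ y ∈ closure Ω, r ≤ ‖y - z‖ := by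
    intro y hy
    by_cases hyε : y ∈ ball x₀ ε
    · refine le_of_sq_le_sq ?_ (norm_nonneg _)
      have := hsep y hy hyε
      have h2 : 0 ≤ ‖y - x₀‖ ^ 2 := by positivity
      linarith
    · linarith [hfar y hyε]
  have hin : ∀ y, ‖y - z‖ < 2 * r → y ∈ ball x₀ ε := fun y hy => by
    by_contra hcon
    linarith [hfar y hcon]
  -- control of the rays
  have hsle : ∀ y ∈ closure Ω, ∀ s, s * ‖y - z‖ ^ 2 ≤ (2 * r) ^ 2 → s ≤ 4 ∧ (1 < s →
      s * ‖y - z‖ ≤ 4 * r) := by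
    intro y hy s hs
    have h1 := hle y hy
    constructor
    · by_contra! hcon
      have h2 : r ^ 2 ≤ ‖y - z‖ ^ 2 := by gcongr
      have h3 : s * r ^ 2 ≤ s * ‖y - z‖ ^ 2 := by gcongr
      have h4 : 4 * r ^ 2 < s * r ^ 2 := by gcongr
      linarith
    · intro h2
      have h3 : s * ‖y - z‖ * r ≤ s * ‖y - z‖ * ‖y - z‖ := by
        have := norm_nonneg (y - z)
        gcongr
      nlinarith
  have hray : ∀ y ∈ closure Ω, ∀ s, 1 < s → s * ‖y - z‖ ^ 2 ≤ (2 * r) ^ 2 → ∀ t, 0 ≤ t → t ≤ s →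
      z + t • (y - z) ∈ ball x₀ ε ∧ ‖z + t • (y - z) - x₀‖ ≤ 5 * r := by
    intro y hy s hs1 hs t ht0 hts
    have h1 := (hsle y hy s hs).2 hs1
    have h2 := htri (z + t • (y - z))
    rw [add_sub_cancel_left, norm_smul, Real.norm_of_nonneg ht0] at h2
    have h3 : t * ‖y - z‖ ≤ s * ‖y - z‖ := by gcongr
    have h4 : ‖z + t • (y - z) - x₀‖ ≤ 5 * r := by linarith
    exact ⟨by rw [mem_ball, dist_eq_norm]; linarith, h4⟩
  have hmem : ∀ y ∈ closure Ω, ‖y - z‖ < 2 * r → ∀ s, 1 < s → s * ‖y - z‖ ^ 2 ≤ (2 * r) ^ 2 →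
      z + s • (y - z) ∈ Ω := by
    intro y hy hyr s hs1 hs
    have hyε := hin y hyr
    have hq := hray y hy s hs1 hs s (by linarith) le_rfl
    refine hneg _ (hball _ hq.1).2.2.2.1 ?_
    have hderiv : ∀ t, 0 ≤ t → t ≤ s → HasDerivAt (fun t : ℝ => f (z + t • (y - z)))
        (fderiv ℝ f (z + t • (y - z)) (y - z)) t := by
      intro t h0 h1
      have hl : HasDerivAt (fun t : ℝ => z + t • (y - z)) (y - z) t := by
        simpa using ((hasDerivAt_id t).smul_const (y - z)).const_add z
      exact HasFDerivAt.comp_hasDerivAt (f := fun t : ℝ => z + t • (y - z)) t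
        (hball _ (hray y hy s hs1 hs t h0 h1).1).1.hasFDerivAt hl
    obtain ⟨t, ht, hslope⟩ := exists_hasDerivAt_eq_slope (fun t : ℝ => f (z + t • (y - z)))
      (fun t => fderiv ℝ f (z + t • (y - z)) (y - z)) hs1
      (fun t ht => (hderiv t (by linarith [ht.1]) ht.2).continuousAt.continuousWithinAt)
      (fun t ht => hderiv t (by linarith [ht.1]) ht.2.le)
    have hneg' : fderiv ℝ f (z + t • (y - z)) (y - z) < 0 := by
      have hb := hray y hy s hs1 hs t (by linarith [ht.1]) ht.2.le
      have h1 : |fderiv ℝ f (z + t • (y - z)) (y - z) - fderiv ℝ f x₀ (y - z)| ≤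
          C * (5 * r) * (2 * r) := by
        have := (fderiv ℝ f (z + t • (y - z)) - fderiv ℝ f x₀).le_opNorm (y - z)
        refine this.trans ?_
        have h2 := (hball _ hb.1).2.1.trans (mul_le_mul_of_nonneg_left hb.2 hC.le)
        gcongr
      have h2 : fderiv ℝ f x₀ (y - z) = a * inner ℝ n (y - x₀) - a * r := by
        rw [hfn, hz, ← sub_sub, inner_sub_right, real_inner_smul_right, real_inner_self_eq_norm_sq,
          hn]
        ring
      have h3 := hquad y hy hyε
      have h4 := hsep y hy hyε
      have h5 : ‖y - z‖ ^ 2 ≤ (2 * r) ^ 2 := by gcongr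
      have h6 : C * ‖y - x₀‖ ^ 2 ≤ C * (6 * r ^ 2) := by
        gcongr; linarith
      have h7 : 40 * (C * r) * r ≤ a * r := by gcongr
      have h8 : 0 < a * r := by positivity
      rw [h2] at h1
      have := (abs_le.1 h1).2
      linarith
    rw [hslope, div_neg_iff] at hneg'
    have hfy := hnonpos y hy (hball y hyε).2.2.2.1
    have hone : z + (1:ℝ) • (y - z) = y := by rw [one_smul, add_sub_cancel]
    rcases hneg' with h1 | h1
    · linarith [h1.2]
    · have := h1.1
      simp only [hone] at this
      linarith
  refine ⟨z, r, 2 * r, h x₀ + 1, ⟨hr, by linarith, hle, hmem, ?_, ?_, ?_⟩, by linarith, ?_⟩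
  · intro x _ hxr
    exact (hball x (hin x hxr)).2.2.2.2
  · intro x hx hxr s hs1 hs
    exact (hball _ (hray x (subset_closure hx) s hs1 hs s (by linarith) le_rfl).1).2.2.2.2
  · intro x hx hxr s hs1 hs
    have hxc := subset_closure hx
    have hseg : segment ℝ x (z + s • (x - z)) ⊆ closure Ω ∩ ball x₀ ε₂ := by
      rw [segment_eq_image']
      rintro _ ⟨θ, hθ, rfl⟩
      have e : x + θ • (z + s • (x - z) - x) = z + (1 + θ * (s - 1)) • (x - z) := by
        module
      have hts : 1 + θ * (s - 1) ≤ s := by nlinarith [hθ.2]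
      have h1t : 0 ≤ θ * (s - 1) := mul_nonneg hθ.1 (by linarith)
      simp only [e]
      refine ⟨?_, ball_subset_ball hε2 (hray x hxc s hs1 hs _ (by linarith) hts).1⟩
      rcases h1t.eq_or_lt with h0 | h0
      · rw [← h0, add_zero, one_smul, add_sub_cancel]; exact hxc
      · refine subset_closure (hmem x hxc hxr _ (by linarith) (le_trans ?_ hs))
        gcongr
    have h1 := hlip _ _ hseg
    have e : z + s • (x - z) - x = (s - 1) • (x - z) := by module
    rw [e, norm_smul, Real.norm_of_nonneg (by linarith)] at h1
    have h2 := (hball x (hin x hxr)).2.2.1 hxc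
    have h3 := (hsle x hxc s hs).1
    refine lt_sq_mul_of_abs_sub_le hs1 h3 hr.le hL h2.1 hrL (h1.trans ?_)
    have : 0 ≤ s - 1 := by linarith
    gcongr
  · intro x hx hxr
    exact ((hball x (hin x hxr)).2.2.1 (subset_closure hx)).2.le

/-- Every solution is dominated by its values on a fixed compact subset of the domain. -/
lemma exists_compact_dominating {Ω : Set Plane} (hΩo : IsOpen Ω) (hΩb : Bornology.IsBounded Ω)
    (hΩsm : SmoothBoundary Ω) (h0 : (0 : Plane) ∈ Ω) (α : ℝ) {K : Plane → ℝ}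
    (hK : ContDiffOn ℝ 1 K (closure Ω)) (hKpos : ∀ x ∈ closure Ω, 0 < K x) :
    ∃ Q, IsCompact Q ∧ Q ⊆ Ω ∧ ∀ p, 1 < p → ∀ u, IsHenonSolution Ω α K p u →
      ∀ x ∈ Ω, ∃ y ∈ Q, u x ≤ u y := by
  have key := hΩb.isCompact_closure.induction_on
    (p := fun S => ∃ Q, IsCompact Q ∧ Q ⊆ Ω ∧ ∀ p, 1 < p → ∀ u, IsHenonSolution Ω α K p u →
      ∀ x ∈ S ∩ Ω, ∃ y ∈ Q, u x ≤ u y) ?_ ?_ ?_ ?_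
  · obtain ⟨Q, hQ, hQΩ, h⟩ := key
    exact ⟨Q, hQ, hQΩ, fun p hp u hu x hx => h p hp u hu x ⟨subset_closure hx, hx⟩⟩
  · exact ⟨∅, isCompact_empty, empty_subset _, by simp⟩
  · rintro S T hST ⟨Q, hQ, hQΩ, h⟩
    exact ⟨Q, hQ, hQΩ, fun p hp u hu x hx => h p hp u hu x ⟨hST hx.1, hx.2⟩⟩
  · rintro S T ⟨Q, hQ, hQΩ, h⟩ ⟨Q', hQ', hQΩ', h'⟩
    refine ⟨Q ∪ Q', hQ.union hQ', union_subset hQΩ hQΩ', fun p hp u hu x hx => ?_⟩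
    rcases hx.1 with h1 | h1
    · obtain ⟨y, hy, hxy⟩ := h p hp u hu x ⟨h1, hx.2⟩
      exact ⟨y, Or.inl hy, hxy⟩
    · obtain ⟨y, hy, hxy⟩ := h' p hp u hu x ⟨h1, hx.2⟩
      exact ⟨y, Or.inr hy, hxy⟩
  · intro a ha
    by_cases haΩ : a ∈ Ω
    · obtain ⟨d, hd, hda⟩ := Metric.nhds_basis_closedBall.mem_iff.1 (hΩo.mem_nhds haΩ)
      exact ⟨closedBall a d, nhdsWithin_le_nhds (closedBall_mem_nhds a hd), closedBall a d,
        isCompact_closedBall a d, hda, fun p _ u _ x hx => ⟨x, hx.1, le_rfl⟩⟩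
    · have haf : a ∈ frontier Ω := ⟨ha, fun hi => haΩ (interior_subset hi)⟩
      have ha0 : a ≠ 0 := fun h => haΩ (h ▸ h0)
      have hweight : ContDiffWithinAt ℝ 1 (fun x => ‖x‖ ^ (2 * α) * K x) (closure Ω) a :=
        (((contDiffAt_norm ℝ ha0).rpow_const_of_ne (norm_ne_zero_iff.2 ha0)).contDiffWithinAt).mul
          (hK a ha)
      obtain ⟨z, r, R, H, hS, haz, hH⟩ := exists_sphereAdmissible hΩsm haf ha0 hweight
        (mul_pos (Real.rpow_pos_of_pos (norm_pos_iff.2 ha0) _) (hKpos a ha))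
      obtain ⟨d, hd, hda⟩ := Metric.nhds_basis_closedBall.mem_iff.1
        (hΩo.mem_nhds (hS.circleInv_mem ha haz le_rfl))
      refine ⟨{x | ‖x - z‖ < R ∧ circleInv z R x ∈ closedBall (circleInv z R a) d},
        nhdsWithin_le_nhds ?_, closedBall (circleInv z R a) d, isCompact_closedBall _ _, hda,
        fun p hp u hu x hx => ⟨_, hx.1.2, ?_⟩⟩
      · have h1 : ∀ᶠ x in 𝓝 a, ‖x - z‖ < R :=
          (isOpen_lt (by fun_prop) continuous_const).mem_nhds haz
        have h2 : ∀ᶠ x in 𝓝 a, circleInv z R x ∈ closedBall (circleInv z R a) d :=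
          (contDiffAt_circleInv R (hS.ne_center ha)).continuousAt (closedBall_mem_nhds _ hd)
        exact h1.and h2
      · exact hS.le_circleInv hΩo hΩb hH (fun x hx => (hKpos x (subset_closure hx)).le) hp hu
          hx.2 hx.1.1

/-- A priori `L^∞` bound, uniform in `p ≥ p₀`, for positive solutions of the
Hénon–Lane–Emden problem on a bounded, simply connected planar domain with smooth
boundary. -/
theorem apriori_bound_henon (Ω : Set Plane) (hΩo : IsOpen Ω)
    (hΩb : Bornology.IsBounded Ω) (hΩsc : SimplyConnectedSpace Ω)
    (hΩsm : SmoothBoundary Ω) (h0 : (0 : Plane) ∈ Ω)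
    (α p₀ : ℝ) (hα : -1 < α) (hp₀ : 1 < p₀)
    (K : Plane → ℝ) (hK : ContDiffOn ℝ 1 K (closure Ω))
    (hKpos : ∀ x ∈ closure Ω, 0 < K x) :
    ∃ C₀ > 0, ∀ (p : ℝ), p₀ ≤ p → ∀ u : Plane → ℝ,
      ContinuousOn u (closure Ω) → ContDiffOn ℝ 2 u (Ω \ {0}) →
      (∀ x ∈ Ω, 0 < u x) →
      (∀ x ∈ Ω \ {0}, -lap u x = ‖x‖ ^ (2 * α) * K x * u x ^ p) →
      (∀ x ∈ frontier Ω, u x = 0) →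
      ∀ x ∈ Ω, u x ≤ C₀ := by
  have hcomp := hΩb.isCompact_closure
  obtain ⟨a, ha, hmin⟩ := hcomp.exists_isMinOn ⟨0, subset_closure h0⟩ hK.continuousOn
  obtain ⟨k₁, hk₁⟩ := hcomp.bddAbove_image hK.continuousOn
  have hKb : ∀ x ∈ Ω, K a ≤ K x ∧ K x ≤ k₁ := fun x hx =>
    ⟨hmin (subset_closure hx), hk₁ (mem_image_of_mem K (subset_closure hx))⟩
  obtain ⟨Q, hQ, hQΩ, hdom⟩ := exists_compact_dominating hΩo hΩb hΩsm h0 α hK hKpos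
  obtain ⟨C, hC, hbound⟩ := exists_bound_of_max_mem_compact hΩo hΩb h0 hα hp₀ (hKpos a ha) hKb
    hQ hQΩ
  refine ⟨C, hC, fun p hp u hu1 hu2 hu3 hu4 hu5 x hx => ?_⟩
  have hu : IsHenonSolution Ω α K p u := ⟨hu1, hu2, hu3, hu4, hu5⟩
  have hdom' := hdom p (hp₀.trans_le hp) u hu
  obtain ⟨y₀, hy₀, -⟩ := hdom' 0 h0
  obtain ⟨y, hyQ, hy⟩ := hQ.exists_isMaxOn ⟨y₀, hy₀⟩
    (hu1.mono (hQΩ.trans subset_closure))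
  have hmax : ∀ x ∈ Ω, u x ≤ u y := by
    intro x hx
    obtain ⟨w, hw, hxw⟩ := hdom' x hx
    exact hxw.trans (hy hw)
  exact (hmax x hx).trans (hbound p hp u hu y hyQ hmax)
end
end

section
/- Let α > -1. Then there exists a constant C > 0, depending only on α, such that for every y in the open unit disk 𝔻 ⊂ ℝ² with y ≠ 0 one has ∫_𝔻 |η|^{2α} / |y − η| dη ≤ C / |y|. -/
open MeasureTheory Real Set Metric

noncomputable section

/-- A power of the norm with exponent larger than `-2` is integrable near the origin of the
plane. -/
theorem integrable_indicator_ball_norm_rpow {s : ℝ} (hs : -2 < s) :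
    Integrable ((ball (0 : Plane) 1).indicator fun x => ‖x‖ ^ s) := by
  rw [integrable_indicator_iff measurableSet_ball]
  refine integrableOn_ball_of_norm_le_rpow (C := 1) (α := -s) (by simp) ?_
    (.of_forall fun x => ?_) (measurable_norm.pow_const s).aestronglyMeasurable
  · rw [finrank_euclideanSpace_fin]
    push_cast
    linarith
  · rw [norm_of_nonneg (by positivity), one_mul, neg_neg]

/-- Powers of two numbers within a factor `2` of each other are comparable. -/
theorem rpow_le_two_rpow_abs_mul {a b : ℝ} (p : ℝ) (hb : 0 < b) (h₁ : b / 2 ≤ a)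
    (h₂ : a ≤ 2 * b) : a ^ p ≤ 2 ^ |p| * b ^ p := by
  rcases le_total 0 p with hp | hp
  · rw [abs_of_nonneg hp, ← mul_rpow two_pos.le hb.le]
    exact rpow_le_rpow (by linarith) h₂ hp
  · calc a ^ p ≤ (b / 2) ^ p := rpow_le_rpow_of_nonpos (by positivity) h₁ hp
      _ = 2 ^ |p| * b ^ p := by
        rw [abs_of_nonpos hp, div_rpow hb.le two_pos.le, rpow_neg two_pos.le]
        ring

/-- Pointwise bound of the integrand by functions whose integrals do not depend on `y`. -/
theorem norm_rpow_div_norm_sub_le (α : ℝ) {y η : Plane} (hy : y ∈ ball (0 : Plane) 1)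
    (hy0 : y ≠ 0) (hη : η ∈ ball (0 : Plane) 1) :
    ‖η‖ ^ (2 * α) / ‖y - η‖ ≤
      (2 * (ball (0 : Plane) 1).indicator (fun x => ‖x‖ ^ (2 * α)) η +
        2 ^ |2 * α| * (ball (0 : Plane) 1).indicator
          (fun x => ‖x‖ ^ (min (2 * α + 1) 0 - 1)) (y - η)) / ‖y‖ := by
  have hyp : 0 < ‖y‖ := norm_pos_iff.2 hy0
  have hy1 : ‖y‖ < 1 := mem_ball_zero_iff.1 hy
  have hg : 0 ≤ (ball (0 : Plane) 1).indicator
      (fun x => ‖x‖ ^ (min (2 * α + 1) 0 - 1)) (y - η) :=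
    indicator_nonneg (fun x _ => by positivity) _
  rw [indicator_of_mem hη]
  rcases (norm_nonneg (y - η)).eq_or_lt with h0 | h0
  · rw [← h0, div_zero]
    positivity
  rw [div_le_div_iff₀ h0 hyp]
  have hη0 : 0 ≤ ‖η‖ ^ (2 * α) := by positivity
  rcases le_total (‖y‖ / 2) ‖y - η‖ with hd | hd
  · have h1 : ‖η‖ ^ (2 * α) * ‖y‖ ≤ ‖η‖ ^ (2 * α) * (2 * ‖y - η‖) :=
      mul_le_mul_of_nonneg_left (by linarith) hη0
    have h2 := mul_nonneg (mul_nonneg (rpow_nonneg two_pos.le |2 * α|) hg) h0.le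
    linarith
  · have hm : y - η ∈ ball (0 : Plane) 1 := mem_ball_zero_iff.2 (by linarith)
    rw [indicator_of_mem hm]
    have ha : ‖y‖ ≤ ‖y - η‖ + ‖η‖ := by simpa using norm_add_le (y - η) η
    have hb : ‖η‖ ≤ ‖y‖ + ‖y - η‖ := by simpa using norm_sub_le y (y - η)
    have hc : ‖η‖ ^ (2 * α) ≤ 2 ^ |2 * α| * ‖y‖ ^ (2 * α) :=
      rpow_le_two_rpow_abs_mul _ hyp (by linarith) (by linarith)
    have he : ‖y‖ ^ (2 * α) * ‖y‖ ≤ ‖y - η‖ ^ min (2 * α + 1) 0 :=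
      calc ‖y‖ ^ (2 * α) * ‖y‖ = ‖y‖ ^ (2 * α + 1) := (rpow_add_one hyp.ne' _).symm
        _ ≤ ‖y‖ ^ min (2 * α + 1) 0 :=
          rpow_le_rpow_of_exponent_ge hyp hy1.le (min_le_left _ _)
        _ ≤ ‖y - η‖ ^ min (2 * α + 1) 0 :=
          rpow_le_rpow_of_nonpos h0 (by linarith) (min_le_right _ _)
    calc ‖η‖ ^ (2 * α) * ‖y‖ ≤ 2 ^ |2 * α| * ‖y‖ ^ (2 * α) * ‖y‖ := by gcongr
      _ = 2 ^ |2 * α| * (‖y‖ ^ (2 * α) * ‖y‖) := by ring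
      _ ≤ 2 ^ |2 * α| * ‖y - η‖ ^ min (2 * α + 1) 0 := by gcongr
      _ = 2 ^ |2 * α| * ‖y - η‖ ^ (min (2 * α + 1) 0 - 1) * ‖y - η‖ := by
        rw [mul_assoc, ← rpow_add_one h0.ne', sub_add_cancel]
      _ ≤ _ := by
        gcongr
        linarith

/-- For `α > -1`, the Newtonian-type potential of `|η|^{2α}` on the unit disk is bounded
by `C/|y|`. -/
theorem potential_bound (α : ℝ) (hα : -1 < α) :
    ∃ C > 0, ∀ y ∈ ball (0 : Plane) 1, y ≠ 0 →
      ∫ η in ball (0 : Plane) 1, ‖η‖ ^ (2 * α) / ‖y - η‖ ≤ C / ‖y‖ := by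
  set f := (ball (0 : Plane) 1).indicator fun x => ‖x‖ ^ (2 * α)
  set g := (ball (0 : Plane) 1).indicator fun x => ‖x‖ ^ (min (2 * α + 1) 0 - 1)
  have hfi : Integrable f := integrable_indicator_ball_norm_rpow (by linarith)
  have hgi : Integrable g := integrable_indicator_ball_norm_rpow <| by
    have : -1 < min (2 * α + 1) 0 := lt_min (by linarith) (by norm_num)
    linarith
  have hf0 : ∀ x, 0 ≤ f x := indicator_nonneg fun x _ => by positivity
  have hg0 : ∀ x, 0 ≤ g x := indicator_nonneg fun x _ => by positivity
  have hF := integral_nonneg (μ := volume) (f := f) hf0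
  have hG := integral_nonneg (μ := volume) (f := g) hg0
  refine ⟨2 * (∫ x, f x) + 2 ^ |2 * α| * (∫ x, g x) + 1, by positivity, fun y hy hy0 => ?_⟩
  have hgy : Integrable fun η => g (y - η) := hgi.comp_sub_left y
  have hi : Integrable fun η => (2 * f η + 2 ^ |2 * α| * g (y - η)) / ‖y‖ :=
    ((hfi.const_mul _).add (hgy.const_mul _)).div_const _
  calc ∫ η in ball (0 : Plane) 1, ‖η‖ ^ (2 * α) / ‖y - η‖
      ≤ ∫ η in ball (0 : Plane) 1, (2 * f η + 2 ^ |2 * α| * g (y - η)) / ‖y‖ := by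
        refine integral_mono_of_nonneg (.of_forall fun η => by positivity) hi.integrableOn ?_
        filter_upwards [ae_restrict_mem measurableSet_ball] with η hη
        exact norm_rpow_div_norm_sub_le α hy hy0 hη
    _ ≤ ∫ η, (2 * f η + 2 ^ |2 * α| * g (y - η)) / ‖y‖ := by
        refine setIntegral_le_integral hi (.of_forall fun η => ?_)
        have := hf0 η
        have := hg0 (y - η)
        positivity
    _ = (2 * (∫ x, f x) + 2 ^ |2 * α| * (∫ x, g x)) / ‖y‖ := by
        rw [integral_div, integral_add (hfi.const_mul _) (hgy.const_mul _),
          integral_const_mul, integral_const_mul, integral_sub_left_eq_self g]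
    _ ≤ _ := by
        exact div_le_div_of_nonneg_right (by linarith) (norm_nonneg y)
end
end

section
/- Let 𝔻 ⊂ ℝ² be the open unit disk, α ∈ (-1, 0), and let v ∈ C(𝔻̄) ∩ C²(𝔻 ∖ {0}) satisfy v = 0 on ∂𝔻 and |Δv(y)| ≤ C |y|^{2α} for all y ∈ 𝔻 ∖ {0}, for some constant C > 0. Then there exists a constant C' > 0, depending only on C and α, such that |∇v(y)| ≤ C' / |y| for all y ∈ 𝔻 ∖ {0}; in particular the function y ↦ |∇v(y)| |y| is bounded on 𝔻 ∖ {0}. -/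
open MeasureTheory Real Set Metric

noncomputable section

section

open Filter Topology

/-- The real function `f` is differentiable near `x` and has second derivative `a` at `x`. -/
def HasSecondDerivAt (f : ℝ → ℝ) (a x : ℝ) : Prop :=
  ∃ f' : ℝ → ℝ, (∀ᶠ t in 𝓝 x, HasDerivAt f (f' t) t) ∧ HasDerivAt f' a x

namespace HasSecondDerivAt

variable {f g : ℝ → ℝ} {a b x : ℝ}

theorem add (hf : HasSecondDerivAt f a x) (hg : HasSecondDerivAt g b x) :
    HasSecondDerivAt (fun t => f t + g t) (a + b) x := by
  obtain ⟨f', hf, hf'⟩ := hf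
  obtain ⟨g', hg, hg'⟩ := hg
  exact ⟨fun t => f' t + g' t, by filter_upwards [hf, hg] with t h₁ h₂ using h₁.add h₂,
    hf'.add hg'⟩

theorem const_mul (c : ℝ) (hf : HasSecondDerivAt f a x) :
    HasSecondDerivAt (fun t => c * f t) (c * a) x := by
  obtain ⟨f', hf, hf'⟩ := hf
  exact ⟨fun t => c * f' t, by filter_upwards [hf] with t h using h.const_mul c,
    hf'.const_mul c⟩

theorem comp_const_add (c : ℝ) (hf : HasSecondDerivAt f a (c + x)) :
    HasSecondDerivAt (fun t => f (c + t)) a x := by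
  obtain ⟨f', hf, hf'⟩ := hf
  have hc : Tendsto (fun t => c + t) (𝓝 x) (𝓝 (c + x)) :=
    (continuous_const.add continuous_id).tendsto x
  exact ⟨fun t => f' (c + t),
    by filter_upwards [hc.eventually hf] with t h using h.comp_const_add c t,
    hf'.comp_const_add c x⟩

theorem comp_const_sub (c : ℝ) (hf : HasSecondDerivAt f a (c - x)) :
    HasSecondDerivAt (fun t => f (c - t)) a x := by
  obtain ⟨f', hf, hf'⟩ := hf
  have hc : Tendsto (fun t => c - t) (𝓝 x) (𝓝 (c - x)) :=
    (continuous_const.sub continuous_id).tendsto x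
  refine ⟨fun t => -f' (c - t),
    by filter_upwards [hc.eventually hf] with t h using h.comp_const_sub c t, ?_⟩
  exact (hf'.comp_const_sub c x).neg.congr_deriv (neg_neg a)

theorem nonneg_of_isLocalMin (hf : HasSecondDerivAt f a x) (hmin : IsLocalMin f x) :
    0 ≤ a := by
  by_contra! ha
  obtain ⟨f', hf, hf'⟩ := hf
  have h_deriv : deriv f =ᶠ[𝓝 x] f' := hf.mono fun t h => h.deriv
  have h_max : IsLocalMax f x := by
    apply isLocalMax_of_deriv_deriv_neg
    · rwa [h_deriv.deriv_eq, hf'.deriv]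
    · exact hmin.deriv_eq_zero
    · exact hf.self_of_nhds.continuousAt
  have h_const : f =ᶠ[𝓝 x] fun _ => f x := by
    filter_upwards [hmin, h_max] with t h₁ h₂ using le_antisymm h₂ h₁
  have h_zero : deriv f =ᶠ[𝓝 x] fun _ => 0 := by
    simpa using h_const.deriv
  have : deriv f' x = 0 := by
    rw [(h_deriv.symm.trans h_zero).deriv_eq]; simp
  rw [hf'.deriv] at this
  exact ha.ne this

end HasSecondDerivAt

theorem hasSecondDerivAt_quadratic (k m n x : ℝ) :
    HasSecondDerivAt (fun t => k * t ^ 2 + m * t + n) (2 * k) x := by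
  refine ⟨fun t => k * (2 * t) + m, Eventually.of_forall fun t => ?_, ?_⟩
  · simpa using (((hasDerivAt_pow 2 t).const_mul k).add
      ((hasDerivAt_id t).const_mul m)).add_const n
  · have := (((hasDerivAt_id x).const_mul 2).const_mul k).add_const m
    simp only [id, mul_one] at this
    rwa [mul_comm] at this

/-- Second derivative along a coordinate line of the radial function `h (t ^ 2 + c ^ 2)`. -/
theorem hasSecondDerivAt_comp_sq_add {h h' : ℝ → ℝ} {h'' c x : ℝ}
    (hh : ∀ᶠ s in 𝓝 (x ^ 2 + c), HasDerivAt h (h' s) s)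
    (hh' : HasDerivAt h' h'' (x ^ 2 + c)) :
    HasSecondDerivAt (fun t => h (t ^ 2 + c))
      (4 * x ^ 2 * h'' + 2 * h' (x ^ 2 + c)) x := by
  have hs : ∀ t : ℝ, HasDerivAt (fun t => t ^ 2 + c) (2 * t) t := fun t => by
    simpa using (hasDerivAt_pow 2 t).add_const c
  refine ⟨fun t => h' (t ^ 2 + c) * (2 * t), ?_, ?_⟩
  · filter_upwards [(hs x).continuousAt.eventually hh] with t ht
    exact ht.comp t (hs t)
  · have := (hh'.comp x (hs x)).mul ((hasDerivAt_id x).const_mul 2)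
    refine this.congr_deriv ?_
    simp only [Function.comp, id]
    ring

/-- A function on a compact planar set that is nonnegative wherever its Laplacian is not
negative is nonnegative. -/
theorem nonneg_of_laplacian_neg {K : Set (ℝ × ℝ)} (hK : IsCompact K) {g : ℝ → ℝ → ℝ}
    (hg : ContinuousOn (Function.uncurry g) K)
    (h : ∀ x y, (x, y) ∈ K → 0 ≤ g x y ∨ (K ∈ 𝓝 (x, y) ∧ ∃ a b,
      HasSecondDerivAt (fun s => g s y) a x ∧ HasSecondDerivAt (fun s => g x s) b y ∧
      a + b < 0)) {x y : ℝ} (hxy : (x, y) ∈ K) : 0 ≤ g x y := by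
  obtain ⟨⟨p, q⟩, hpq, hmin⟩ := hK.exists_isMinOn ⟨_, hxy⟩ hg
  refine le_trans ?_ (hmin hxy)
  rcases h p q hpq with h | ⟨hnhds, a, b, ha, hb, hab⟩
  · exact h
  · exfalso
    have hloc : ∀ᶠ z in 𝓝 (p, q), g p q ≤ Function.uncurry g z := by
      filter_upwards [hnhds] with z hz using hmin hz
    have h₁ : Tendsto (fun s : ℝ => (s, q)) (𝓝 p) (𝓝 (p, q)) :=
      (continuous_id.prodMk continuous_const).tendsto p
    have h₂ : Tendsto (fun s : ℝ => (p, s)) (𝓝 q) (𝓝 (p, q)) :=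
      (continuous_const.prodMk continuous_id).tendsto q
    have := ha.nonneg_of_isLocalMin (h₁.eventually hloc)
    have := hb.nonneg_of_isLocalMin (h₂.eventually hloc)
    linarith

theorem HasDerivAt.nonneg_of_right {f : ℝ → ℝ} {a d : ℝ} (hd : 0 < d)
    (hf : HasDerivAt f a 0) (h0 : f 0 = 0) (h : ∀ t ∈ Icc 0 d, 0 ≤ f t) : 0 ≤ a := by
  have := hf.tendsto_slope_zero_right
  refine ge_of_tendsto this ?_
  filter_upwards [Ioc_mem_nhdsGT hd] with t ht
  have := h t ⟨ht.1.le, ht.2⟩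
  simp only [zero_add, h0, sub_zero, smul_eq_mul]
  exact mul_nonneg (inv_nonneg.2 ht.1.le) this

/-- Interior gradient estimate on a square, upper bound for the second partial derivative. -/
theorem partial_deriv_le_of_square {u : ℝ → ℝ → ℝ} {x₀ y₀ d M N D : ℝ} (hd : 0 < d)
    (hu : ContinuousOn (Function.uncurry u) (Icc (x₀ - d) (x₀ + d) ×ˢ Icc (y₀ - d) (y₀ + d)))
    (hM : ∀ x ∈ Icc (x₀ - d) (x₀ + d), ∀ y ∈ Icc (y₀ - d) (y₀ + d), |u x y| ≤ M)
    (hN : ∀ x ∈ Icc (x₀ - d) (x₀ + d), ∀ y ∈ Icc (y₀ - d) (y₀ + d), ∃ a b,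
      HasSecondDerivAt (fun s => u s y) a x ∧ HasSecondDerivAt (fun s => u x s) b y ∧
      |a + b| < N)
    (hD : HasDerivAt (fun s => u x₀ s) D y₀) : D ≤ 2 * M / d + d * N / 2 := by
  have hM0 : 0 ≤ M := (abs_nonneg _).trans
    (hM x₀ ⟨by linarith, by linarith⟩ y₀ ⟨by linarith, by linarith⟩)
  have hN0 : 0 < N := by
    obtain ⟨a, b, -, -, h⟩ := hN x₀ ⟨by linarith, by linarith⟩ y₀ ⟨by linarith, by linarith⟩
    exact (abs_nonneg _).trans_lt h
  set g : ℝ → ℝ → ℝ := fun x y =>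
    (M / d ^ 2 * ((x - x₀) ^ 2 + y * (2 * d - y)) + N / 2 * (y * (d - y))) +
      (-(1 / 2) * u x (y₀ + y) + 1 / 2 * u x (y₀ - y)) with hg
  have hcont : ContinuousOn (Function.uncurry g) (Icc (x₀ - d) (x₀ + d) ×ˢ Icc 0 d) := by
    have h₁ : ContinuousOn (fun z : ℝ × ℝ => u z.1 (y₀ + z.2))
        (Icc (x₀ - d) (x₀ + d) ×ˢ Icc 0 d) :=
      hu.comp (f := fun z : ℝ × ℝ => (z.1, y₀ + z.2)) (by fun_prop)
        fun z hz => ⟨hz.1, by linarith [hz.2.1], by linarith [hz.2.2]⟩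
    have h₂ : ContinuousOn (fun z : ℝ × ℝ => u z.1 (y₀ - z.2))
        (Icc (x₀ - d) (x₀ + d) ×ˢ Icc 0 d) :=
      hu.comp (f := fun z : ℝ × ℝ => (z.1, y₀ - z.2)) (by fun_prop)
        fun z hz => ⟨hz.1, by linarith [hz.2.2], by linarith [hz.2.1]⟩
    exact ContinuousOn.add (by fun_prop) ((h₁.const_mul _).add (h₂.const_mul _))
  have hpos : ∀ t ∈ Icc 0 d, 0 ≤ g x₀ t := by
    intro t ht
    refine nonneg_of_laplacian_neg (isCompact_Icc.prod isCompact_Icc) hcont ?_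
      (⟨⟨by linarith, by linarith⟩, ht⟩ :
        (x₀, t) ∈ Icc (x₀ - d) (x₀ + d) ×ˢ Icc 0 d)
    rintro x y ⟨hx, hy⟩
    simp only at hx hy
    have hy₁ : y₀ + y ∈ Icc (y₀ - d) (y₀ + d) := ⟨by linarith [hy.1], by linarith [hy.2]⟩
    have hy₂ : y₀ - y ∈ Icc (y₀ - d) (y₀ + d) := ⟨by linarith [hy.2], by linarith [hy.1]⟩
    have hu₁ := abs_le.1 (hM x hx _ hy₁)
    have hu₂ := abs_le.1 (hM x hx _ hy₂)
    have hbdry : 1 ≤ ((x - x₀) ^ 2 + y * (2 * d - y)) / d ^ 2 → 0 ≤ g x y := by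
      intro h
      have h₁ : M ≤ M / d ^ 2 * ((x - x₀) ^ 2 + y * (2 * d - y)) := by
        have := mul_le_mul_of_nonneg_left h hM0
        rw [mul_one] at this
        refine this.trans_eq (by ring)
      have h₂ : 0 ≤ N / 2 * (y * (d - y)) :=
        mul_nonneg (by linarith) (mul_nonneg hy.1 (by linarith [hy.2]))
      simp only [hg]
      linarith
    have hd2 : 0 < d ^ 2 := by positivity
    have hyd : 0 ≤ y * (2 * d - y) := mul_nonneg hy.1 (by linarith [hy.2])
    rcases hy.1.eq_or_lt with rfl | hy0
    · left
      simp only [hg]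
      have : 0 ≤ M / d ^ 2 * ((x - x₀) ^ 2) := by positivity
      simp only [add_zero, sub_zero, zero_mul, mul_zero]
      linarith
    rcases hy.2.eq_or_lt with rfl | hy1
    · left
      apply hbdry
      rw [one_le_div hd2]
      nlinarith [sq_nonneg (x - x₀)]
    rcases hx.1.eq_or_lt with hx0 | hx0
    · left
      apply hbdry
      rw [one_le_div hd2, ← hx0]
      nlinarith
    rcases hx.2.eq_or_lt with hx1 | hx1
    · left
      apply hbdry
      rw [one_le_div hd2, hx1]
      nlinarith
    right
    refine ⟨prod_mem_nhds (Icc_mem_nhds hx0 hx1) (Icc_mem_nhds hy0 hy1), ?_⟩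
    obtain ⟨a₁, b₁, ha₁, hb₁, hab₁⟩ := hN x hx _ hy₁
    obtain ⟨a₂, b₂, ha₂, hb₂, hab₂⟩ := hN x hx _ hy₂
    have hx' := (hasSecondDerivAt_quadratic (M / d ^ 2) (-2 * x₀ * (M / d ^ 2))
      (M / d ^ 2 * (x₀ ^ 2 + y * (2 * d - y)) + N / 2 * (y * (d - y))) x).add
      ((ha₁.const_mul (-(1 / 2))).add (ha₂.const_mul (1 / 2)))
    have hy' := (hasSecondDerivAt_quadratic (-(M / d ^ 2) - N / 2)
      (2 * d * (M / d ^ 2) + N / 2 * d) (M / d ^ 2 * (x - x₀) ^ 2) y).add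
      (((hb₁.comp_const_add y₀).const_mul (-(1 / 2))).add
        ((hb₂.comp_const_sub y₀).const_mul (1 / 2)))
    refine ⟨2 * (M / d ^ 2) + (-(1 / 2) * a₁ + 1 / 2 * a₂),
      2 * (-(M / d ^ 2) - N / 2) + (-(1 / 2) * b₁ + 1 / 2 * b₂), ?_, ?_, ?_⟩
    · convert hx' using 2
      simp only [hg]
      ring
    · convert hy' using 2
      simp only [hg]
      ring
    · have := abs_lt.1 hab₁
      have := abs_lt.1 hab₂
      linarith
  have hderiv : HasDerivAt (fun t => g x₀ t) (2 * M / d + d * N / 2 - D) 0 := by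
    have h₁ : HasDerivAt (fun t => u x₀ (y₀ + t)) D 0 :=
      HasDerivAt.comp_const_add y₀ 0 (by simpa using hD)
    have h₂ : HasDerivAt (fun t => u x₀ (y₀ - t)) (-D) 0 :=
      HasDerivAt.comp_const_sub y₀ 0 (by simpa using hD)
    have hid := hasDerivAt_id (0 : ℝ)
    have h₃ := (((hid.mul (hid.const_sub (2 * d))).const_add ((x₀ - x₀) ^ 2)).const_mul
      (M / d ^ 2)).add ((hid.mul (hid.const_sub d)).const_mul (N / 2))
    refine (h₃.add ((h₁.const_mul (-(1 / 2))).add (h₂.const_mul (1 / 2)))).congr_deriv ?_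
    simp only [id]
    field_simp
    ring
  have := hderiv.nonneg_of_right hd (by simp [hg]) hpos
  linarith

/-- Interior gradient estimate on a square. -/
theorem abs_partial_deriv_le_of_square {u : ℝ → ℝ → ℝ} {x₀ y₀ d M N D : ℝ} (hd : 0 < d)
    (hu : ContinuousOn (Function.uncurry u) (Icc (x₀ - d) (x₀ + d) ×ˢ Icc (y₀ - d) (y₀ + d)))
    (hM : ∀ x ∈ Icc (x₀ - d) (x₀ + d), ∀ y ∈ Icc (y₀ - d) (y₀ + d), |u x y| ≤ M)
    (hN : ∀ x ∈ Icc (x₀ - d) (x₀ + d), ∀ y ∈ Icc (y₀ - d) (y₀ + d), ∃ a b,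
      HasSecondDerivAt (fun s => u s y) a x ∧ HasSecondDerivAt (fun s => u x s) b y ∧
      |a + b| < N)
    (hD : HasDerivAt (fun s => u x₀ s) D y₀) : |D| ≤ 2 * M / d + d * N / 2 := by
  rw [abs_le]
  refine ⟨?_, partial_deriv_le_of_square hd hu hM hN hD⟩
  have := partial_deriv_le_of_square (u := fun x y => -u x y) (N := N) (D := -D) hd hu.neg
    (by simpa using hM) (fun x hx y hy => ?_) hD.neg
  · linarith
  · obtain ⟨a, b, ha, hb, hab⟩ := hN x hx y hy
    refine ⟨-a, -b, ?_, ?_, ?_⟩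
    · simpa using ha.const_mul (-1)
    · simpa using hb.const_mul (-1)
    · rwa [← neg_add, abs_neg]

/-- Upper barrier on the disk for a function vanishing on the unit circle whose Laplacian is
controlled by a power of the distance to the center. -/
theorem le_power_barrier {V : ℝ → ℝ → ℝ} {α C : ℝ} (hα : -1 < α) (hC : 0 < C)
    (hcont : ContinuousOn (Function.uncurry V) {z | z.1 ^ 2 + z.2 ^ 2 ≤ 1})
    (hzero : ∀ x y, x ^ 2 + y ^ 2 = 1 → V x y = 0)
    (hlap : ∀ x y, 0 < x ^ 2 + y ^ 2 → x ^ 2 + y ^ 2 < 1 → ∃ a b,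
      HasSecondDerivAt (fun s => V s y) a x ∧ HasSecondDerivAt (fun s => V x s) b y ∧
      |a + b| ≤ C * (x ^ 2 + y ^ 2) ^ α)
    {x y : ℝ} (h0 : 0 < x ^ 2 + y ^ 2) (h1 : x ^ 2 + y ^ 2 ≤ 1) :
    V x y ≤ C / (1 + α) ^ 2 * (1 - (x ^ 2 + y ^ 2) ^ (1 + α)) := by
  have hβ : 0 < 1 + α := by linarith
  have hK : 0 ≤ C / (1 + α) ^ 2 := by positivity
  have hcompact : IsCompact {z : ℝ × ℝ | z.1 ^ 2 + z.2 ^ 2 ≤ 1} := by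
    refine (isCompact_Icc.prod isCompact_Icc : IsCompact (Icc (-1 : ℝ) 1 ×ˢ Icc (-1 : ℝ) 1))
      |>.of_isClosed_subset (isClosed_le (by fun_prop) continuous_const) ?_
    rintro ⟨p, q⟩ h
    simp only [mem_ofPred_eq] at h
    exact ⟨⟨by nlinarith, by nlinarith⟩, ⟨by nlinarith, by nlinarith⟩⟩
  obtain ⟨M, hM⟩ := hcompact.exists_bound_of_continuousOn hcont
  suffices H : ∀ ε > 0, V x y ≤ C / (1 + α) ^ 2 * (1 - (x ^ 2 + y ^ 2) ^ (1 + α)) +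
      ε * -log (x ^ 2 + y ^ 2) by
    refine ge_of_tendsto (f := fun ε => C / (1 + α) ^ 2 * (1 - (x ^ 2 + y ^ 2) ^ (1 + α)) +
      ε * -log (x ^ 2 + y ^ 2)) (x := 𝓝[>] 0) ?_ (eventually_mem_nhdsWithin.mono H)
    refine (Continuous.tendsto' (by fun_prop) _ _ (by simp)).mono_left nhdsWithin_le_nhds
  intro ε hε
  set h : ℝ → ℝ := fun s => C / (1 + α) ^ 2 * (1 - s ^ (1 + α)) + ε * -log s with hh
  set h' : ℝ → ℝ := fun s => C / (1 + α) ^ 2 * -((1 + α) * s ^ α) + ε * -s⁻¹ with hh'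
  have hderiv : ∀ s, 0 < s → HasDerivAt h (h' s) s := by
    intro s hs
    have := (((hasDerivAt_rpow_const (p := 1 + α) (Or.inl hs.ne')).const_sub 1).const_mul
      (C / (1 + α) ^ 2)).add ((hasDerivAt_log hs.ne').neg.const_mul ε)
    refine this.congr_deriv ?_
    rw [add_sub_cancel_left]
  have hderiv' : ∀ s, 0 < s → HasDerivAt h'
      (C / (1 + α) ^ 2 * -((1 + α) * (α * s ^ (α - 1))) + ε * -(-(s ^ 2)⁻¹)) s := by
    intro s hs
    exact (((hasDerivAt_rpow_const (p := α) (Or.inl hs.ne')).const_mul (1 + α)).neg.const_mul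
      (C / (1 + α) ^ 2)).add ((hasDerivAt_inv hs.ne').neg.const_mul ε)
  set δ := min (x ^ 2 + y ^ 2) (exp (-M / ε)) with hδ
  have hδ0 : 0 < δ := lt_min h0 (exp_pos _)
  have hlog : M ≤ ε * -log δ := by
    have := log_le_log hδ0 (min_le_right (x ^ 2 + y ^ 2) (exp (-M / ε)))
    rw [log_exp, le_div_iff₀ hε] at this
    linarith
  have hsub : {z : ℝ × ℝ | δ ≤ z.1 ^ 2 + z.2 ^ 2 ∧ z.1 ^ 2 + z.2 ^ 2 ≤ 1} ⊆
    {z | z.1 ^ 2 + z.2 ^ 2 ≤ 1} := fun z hz => hz.2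
  have hclosed : IsClosed {z : ℝ × ℝ | δ ≤ z.1 ^ 2 + z.2 ^ 2 ∧ z.1 ^ 2 + z.2 ^ 2 ≤ 1} :=
    (isClosed_Icc (a := δ) (b := 1)).preimage
      (by fun_prop : Continuous fun z : ℝ × ℝ => z.1 ^ 2 + z.2 ^ 2)
  have key : 0 ≤ h (x ^ 2 + y ^ 2) + -1 * V x y := by
    refine nonneg_of_laplacian_neg (g := fun p q => h (p ^ 2 + q ^ 2) + -1 * V p q)
      (hcompact.of_isClosed_subset hclosed hsub) ?_ ?_ ⟨min_le_left _ _, h1⟩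
    · refine ContinuousOn.add (f := fun z : ℝ × ℝ => h (z.1 ^ 2 + z.2 ^ 2)) ?_
        ((hcont.mono hsub).const_mul _)
      intro z hz
      exact ((hderiv _ (hδ0.trans_le hz.1)).continuousAt.comp (f := fun z : ℝ × ℝ =>
        z.1 ^ 2 + z.2 ^ 2) (by fun_prop)).continuousWithinAt
    · rintro p q ⟨hp, hq⟩
      simp only at hp hq
      have hs : 0 < p ^ 2 + q ^ 2 := hδ0.trans_le hp
      rcases hq.eq_or_lt with hq1 | hq1
      · left
        simp [hh, hq1, hzero p q hq1]
      rcases hp.eq_or_lt with hp1 | hp1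
      · left
        have hV := (le_abs_self _).trans (hM (p, q) hq)
        simp only [Function.uncurry] at hV
        have : (p ^ 2 + q ^ 2) ^ (1 + α) ≤ 1 := rpow_le_one hs.le hq hβ.le
        have := mul_nonneg hK (sub_nonneg.2 this)
        rw [hp1] at hlog
        simp only [hh]
        linarith
      right
      refine ⟨?_, ?_⟩
      · have hopen : IsOpen {z : ℝ × ℝ | δ < z.1 ^ 2 + z.2 ^ 2 ∧ z.1 ^ 2 + z.2 ^ 2 < 1} :=
          (isOpen_Ioo (a := δ) (b := 1)).preimage
            (by fun_prop : Continuous fun z : ℝ × ℝ => z.1 ^ 2 + z.2 ^ 2)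
        exact mem_of_superset (hopen.mem_nhds ⟨hp1, hq1⟩) fun z hz => ⟨hz.1.le, hz.2.le⟩
      obtain ⟨a, b, ha, hb, hab⟩ := hlap p q hs hq1
      have hev := (eventually_gt_nhds hs).mono hderiv
      have hx := (hasSecondDerivAt_comp_sq_add hev (hderiv' _ hs)).add (ha.const_mul (-1))
      have hs' := add_comm (p ^ 2) (q ^ 2)
      have hy := (hasSecondDerivAt_comp_sq_add (hs' ▸ hev) (hderiv' (q ^ 2 + p ^ 2)
        (hs' ▸ hs))).add (hb.const_mul (-1))
      simp only [add_comm _ (p ^ 2)] at hy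
      refine ⟨_, _, hx, hy, ?_⟩
      have hab' := abs_le.1 hab
      have hpow : (p ^ 2 + q ^ 2) * (p ^ 2 + q ^ 2) ^ (α - 1) = (p ^ 2 + q ^ 2) ^ α := by
        rw [rpow_sub_one hs.ne']
        field_simp
      have hpos : 0 < C * (p ^ 2 + q ^ 2) ^ α := by positivity
      have hinv : (p ^ 2 + q ^ 2) * ((p ^ 2 + q ^ 2) ^ 2)⁻¹ = (p ^ 2 + q ^ 2)⁻¹ := by
        field_simp
      have hCβ : C / (1 + α) ^ 2 * (1 + α) * (1 + α) = C := by field_simp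
      simp only [hh']
      generalize (p ^ 2 + q ^ 2)⁻¹ = i at *
      generalize ((p ^ 2 + q ^ 2) ^ 2)⁻¹ = j at *
      generalize (p ^ 2 + q ^ 2) ^ (α - 1) = A at *
      generalize (p ^ 2 + q ^ 2) ^ α = B at *
      generalize C / (1 + α) ^ 2 = K at *
      have : 4 * p ^ 2 * (K * -((1 + α) * (α * A)) + ε * - -j) +
          2 * (K * -((1 + α) * B) + ε * -i) + -1 * a +
          (4 * q ^ 2 * (K * -((1 + α) * (α * A)) + ε * - -j) +
          2 * (K * -((1 + α) * B) + ε * -i) + -1 * b) = -4 * (C * B) - (a + b) := by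
        linear_combination (-4 * K * (1 + α) * α) * hpow + 4 * ε * hinv - 4 * B * hCβ
      rw [this]
      linarith
  linarith

theorem abs_le_power_barrier {V : ℝ → ℝ → ℝ} {α C : ℝ} (hα : -1 < α) (hC : 0 < C)
    (hcont : ContinuousOn (Function.uncurry V) {z | z.1 ^ 2 + z.2 ^ 2 ≤ 1})
    (hzero : ∀ x y, x ^ 2 + y ^ 2 = 1 → V x y = 0)
    (hlap : ∀ x y, 0 < x ^ 2 + y ^ 2 → x ^ 2 + y ^ 2 < 1 → ∃ a b,
      HasSecondDerivAt (fun s => V s y) a x ∧ HasSecondDerivAt (fun s => V x s) b y ∧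
      |a + b| ≤ C * (x ^ 2 + y ^ 2) ^ α)
    {x y : ℝ} (h0 : 0 < x ^ 2 + y ^ 2) (h1 : x ^ 2 + y ^ 2 ≤ 1) :
    |V x y| ≤ C / (1 + α) ^ 2 * (1 - (x ^ 2 + y ^ 2) ^ (1 + α)) := by
  refine abs_le'.2 ⟨le_power_barrier hα hC hcont hzero hlap h0 h1, ?_⟩
  refine le_power_barrier (V := fun x y => -V x y) hα hC hcont.neg
    (fun x y h => by simp [hzero x y h]) (fun x y h₀ h₁ => ?_) h0 h1
  obtain ⟨a, b, ha, hb, hab⟩ := hlap x y h₀ h₁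
  refine ⟨-a, -b, ?_, ?_, ?_⟩
  · simpa using ha.const_mul (-1)
  · simpa using hb.const_mul (-1)
  · rwa [← neg_add, abs_neg]

theorem hasDerivAt_comp_line {E : Type*} [NormedAddCommGroup E] [NormedSpace ℝ E]
    {v : E → ℝ} {c e : E} {s : ℝ} (hv : DifferentiableAt ℝ v (c + s • e)) :
    HasDerivAt (fun t : ℝ => v (c + t • e)) (fderiv ℝ v (c + s • e) e) s := by
  have h_line : HasDerivAt (fun t : ℝ => c + t • e) e s := by
    simpa using ((hasDerivAt_id s).smul_const e).const_add c
  exact hv.hasFDerivAt.comp_hasDerivAt s h_line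

theorem ContDiffAt.hasSecondDerivAt_comp_line {E : Type*} [NormedAddCommGroup E]
    [NormedSpace ℝ E] {v : E → ℝ} {c e : E} {s : ℝ} (hv : ContDiffAt ℝ 2 v (c + s • e)) :
    HasSecondDerivAt (fun t : ℝ => v (c + t • e))
      (fderiv ℝ (fun y => fderiv ℝ v y e) (c + s • e) e) s := by
  refine ⟨fun t => fderiv ℝ v (c + t • e) e, ?_, ?_⟩
  · have h_line : Tendsto (fun t : ℝ => c + t • e) (𝓝 s) (𝓝 (c + s • e)) :=
      Continuous.tendsto (by fun_prop) s
    filter_upwards [h_line.eventually (hv.eventually (by simp))] with t ht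
    exact hasDerivAt_comp_line (ht.differentiableAt (by simp))
  · have h₁ : DifferentiableAt ℝ (fderiv ℝ v) (c + s • e) :=
      (hv.fderiv_right (m := 1) (by norm_num)).differentiableAt (by simp)
    exact hasDerivAt_comp_line (v := fun y => fderiv ℝ v y e)
      (h₁.clm_apply (differentiableAt_const e))

theorem plane_eq_add_smul_zero (p q : ℝ) :
    (!₂[p, q] : Plane) = !₂[0, q] + p • EuclideanSpace.single 0 1 := by
  ext i; fin_cases i <;> simp

theorem plane_eq_add_smul_one (p q : ℝ) :
    (!₂[p, q] : Plane) = !₂[p, 0] + q • EuclideanSpace.single 1 1 := by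
  ext i; fin_cases i <;> simp

theorem hasDerivAt_plane_zero {v : Plane → ℝ} {p q : ℝ} (hv : DifferentiableAt ℝ v !₂[p, q]) :
    HasDerivAt (fun s => v !₂[s, q])
      (fderiv ℝ v !₂[p, q] (EuclideanSpace.single 0 1)) p := by
  rw [plane_eq_add_smul_zero p q] at hv ⊢
  rw [funext fun s => congrArg v (plane_eq_add_smul_zero s q)]
  exact hasDerivAt_comp_line hv

theorem hasDerivAt_plane_one {v : Plane → ℝ} {p q : ℝ} (hv : DifferentiableAt ℝ v !₂[p, q]) :
    HasDerivAt (fun s => v !₂[p, s])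
      (fderiv ℝ v !₂[p, q] (EuclideanSpace.single 1 1)) q := by
  rw [plane_eq_add_smul_one p q] at hv ⊢
  rw [funext fun s => congrArg v (plane_eq_add_smul_one p s)]
  exact hasDerivAt_comp_line hv

theorem ContDiffAt.exists_hasSecondDerivAt_lap {v : Plane → ℝ} {p q : ℝ}
    (hv : ContDiffAt ℝ 2 v !₂[p, q]) : ∃ a b,
      HasSecondDerivAt (fun s => v !₂[s, q]) a p ∧ HasSecondDerivAt (fun s => v !₂[p, s]) b q ∧
      lap v !₂[p, q] = a + b := by
  refine ⟨_, _, ?_, ?_, Fin.sum_univ_two _⟩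
  · rw [plane_eq_add_smul_zero p q] at hv ⊢
    rw [funext fun s => congrArg v (plane_eq_add_smul_zero s q)]
    exact hv.hasSecondDerivAt_comp_line
  · rw [plane_eq_add_smul_one p q] at hv ⊢
    rw [funext fun s => congrArg v (plane_eq_add_smul_one p s)]
    exact hv.hasSecondDerivAt_comp_line

theorem plane_norm_sq (p q : ℝ) : ‖(!₂[p, q] : Plane)‖ ^ 2 = p ^ 2 + q ^ 2 := by
  simp [EuclideanSpace.norm_sq_eq]

theorem norm_gradient_le (v : Plane → ℝ) (y : Plane) :
    ‖gradient v y‖ ≤ |fderiv ℝ v y (EuclideanSpace.single 0 1)| +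
      |fderiv ℝ v y (EuclideanSpace.single 1 1)| := by
  have h : ∀ i, fderiv ℝ v y (EuclideanSpace.single i 1) = gradient v y i := by
    intro i
    rw [gradient, ← InnerProductSpace.toDual_symm_apply, EuclideanSpace.inner_single_right]
    simp
  rw [h, h, EuclideanSpace.norm_eq, Fin.sum_univ_two]
  refine sqrt_le_iff.2 ⟨by positivity, ?_⟩
  simp only [Real.norm_eq_abs]
  nlinarith [mul_nonneg (abs_nonneg (gradient v y 0)) (abs_nonneg (gradient v y 1))]

/-- Points of the square of half-side `r (1 - r) / 2` around a point at distance `r` from the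
center stay away from the center and from the unit circle. -/
theorem norm_bounds_of_mem_square {p q x y r : ℝ} (hr0 : 0 < r) (hr1 : r < 1)
    (hr : ‖(!₂[p, q] : Plane)‖ = r) (hx : |x - p| ≤ r * (1 - r) / 2)
    (hy : |y - q| ≤ r * (1 - r) / 2) :
    r / 4 ≤ ‖(!₂[x, y] : Plane)‖ ∧ ‖(!₂[x, y] : Plane)‖ < 1 ∧
      1 - ‖(!₂[x, y] : Plane)‖ ≤ 2 * (1 - r) := by
  have hd : 0 < r * (1 - r) := mul_pos hr0 (by linarith)
  have hdist : ‖(!₂[x, y] : Plane) - !₂[p, q]‖ ≤ 3 / 4 * (r * (1 - r)) := by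
    refine abs_le_of_sq_le_sq' ?_ (by positivity) |>.2
    have : (!₂[x, y] : Plane) - !₂[p, q] = !₂[x - p, y - q] := by
      ext i; fin_cases i <;> simp
    rw [this, plane_norm_sq]
    have h₁ := sq_le_sq' (abs_le.1 hx).1 (abs_le.1 hx).2
    have h₂ := sq_le_sq' (abs_le.1 hy).1 (abs_le.1 hy).2
    nlinarith [sq_nonneg (r * (1 - r))]
  have h := abs_le.1 ((abs_norm_sub_norm_le _ _).trans hdist)
  rw [hr] at h
  refine ⟨?_, ?_, ?_⟩ <;> nlinarith [h.1, h.2]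

end

/-- Gradient bound for functions on the unit disk whose Laplacian is controlled by
`C|y|^{2α}`, with `α ∈ (-1, 0)`: the gradient is bounded by `C'/|y|`. -/
theorem gradient_bound (α C : ℝ) (hα : α ∈ Ioo (-1 : ℝ) 0) (hC : 0 < C) :
    ∃ C' > 0, ∀ v : Plane → ℝ,
      ContinuousOn v (closedBall (0 : Plane) 1) →
      ContDiffOn ℝ 2 v (ball (0 : Plane) 1 \ {0}) →
      (∀ y ∈ sphere (0 : Plane) 1, v y = 0) →
      (∀ y ∈ ball (0 : Plane) 1 \ {0}, |lap v y| ≤ C * ‖y‖ ^ (2 * α)) →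
      ∀ y ∈ ball (0 : Plane) 1 \ {0}, ‖gradient v y‖ ≤ C' / ‖y‖ := by
  obtain ⟨hα1, hα0⟩ := hα
  have hβ : 0 < 1 + α := by linarith
  set K := C / (1 + α) ^ 2 with hK
  have hK0 : 0 < K := by positivity
  refine ⟨32 * K + 17 * C, by positivity, ?_⟩
  intro v hcont hdiff hzero hlap y hy
  have hmem : ∀ z : Plane, 0 < ‖z‖ → ‖z‖ < 1 → z ∈ ball (0 : Plane) 1 \ {0} := fun z h₀ h₁ =>
    ⟨by simpa using h₁, by simpa using h₀⟩
  have hcd : ∀ z : Plane, 0 < ‖z‖ → ‖z‖ < 1 → ContDiffAt ℝ 2 v z := fun z h₀ h₁ =>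
    hdiff.contDiffAt ((isOpen_ball.sdiff isClosed_singleton).mem_nhds (hmem z h₀ h₁))
  have hpow : ∀ x y : ℝ, ‖(!₂[x, y] : Plane)‖ ^ (2 * α) = (x ^ 2 + y ^ 2) ^ α := by
    intro x y
    rw [rpow_mul (norm_nonneg _), rpow_two, plane_norm_sq]
  have hlap' : ∀ x y : ℝ, 0 < ‖(!₂[x, y] : Plane)‖ → ‖(!₂[x, y] : Plane)‖ < 1 → ∃ a b,
      HasSecondDerivAt (fun s => v !₂[s, y]) a x ∧
      HasSecondDerivAt (fun s => v !₂[x, s]) b y ∧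
      |a + b| ≤ C * (x ^ 2 + y ^ 2) ^ α := by
    intro x y h₀ h₁
    obtain ⟨a, b, ha, hb, hab⟩ := (hcd _ h₀ h₁).exists_hasSecondDerivAt_lap
    exact ⟨a, b, ha, hb, hab ▸ hpow x y ▸ hlap _ (hmem _ h₀ h₁)⟩
  have hmk : Continuous fun z : ℝ × ℝ => (!₂[z.1, z.2] : Plane) := by fun_prop
  have hV : ∀ x y : ℝ, 0 < ‖(!₂[x, y] : Plane)‖ → ‖(!₂[x, y] : Plane)‖ < 1 →
      |v !₂[x, y]| ≤ 2 * K * (1 - ‖(!₂[x, y] : Plane)‖) := by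
    intro x y h₀ h₁
    have hs := plane_norm_sq x y
    have hs0 : 0 < x ^ 2 + y ^ 2 := hs ▸ by positivity
    have hs1 : x ^ 2 + y ^ 2 ≤ 1 := hs ▸ by nlinarith
    have hb := abs_le_power_barrier (V := fun x y => v !₂[x, y]) hα1 hC
      (hcont.comp hmk.continuousOn fun z hz => ?_) (fun x y h => hzero _ ?_)
      (fun x y h h' => hlap' x y ?_ ?_) hs0 hs1
    · have hle : x ^ 2 + y ^ 2 ≤ (x ^ 2 + y ^ 2) ^ (1 + α) := by
        simpa using rpow_le_rpow_of_exponent_ge hs0 hs1 (by linarith : 1 + α ≤ 1)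
      refine hb.trans ?_
      rw [← hK, mul_comm 2 K, mul_assoc]
      gcongr
      nlinarith
    · rw [mem_closedBall_zero_iff, ← sq_le_one_iff₀ (norm_nonneg _), plane_norm_sq]
      exact hz
    · rw [mem_sphere_zero_iff_norm, ← sq_eq_sq₀ (norm_nonneg _) zero_le_one, plane_norm_sq, h,
        one_pow]
    · exact (norm_nonneg _).lt_of_ne' fun h_eq => by simp [← plane_norm_sq, h_eq] at h
    · rw [← sq_lt_one_iff₀ (norm_nonneg _), plane_norm_sq]
      exact h'
  obtain ⟨p, q, rfl⟩ : ∃ p q : ℝ, y = !₂[p, q] :=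
    ⟨y 0, y 1, by ext i; fin_cases i <;> simp⟩
  set r := ‖(!₂[p, q] : Plane)‖ with hr
  have hr0 : 0 < r := norm_pos_iff.2 hy.2
  have hr1 : r < 1 := by simpa using hy.1
  set d := r * (1 - r) / 2 with hd
  have hd0 : 0 < d := by have := sub_pos.2 hr1; positivity
  have hsq : ∀ x ∈ Icc (p - d) (p + d), ∀ y ∈ Icc (q - d) (q + d),
      r / 4 ≤ ‖(!₂[x, y] : Plane)‖ ∧ ‖(!₂[x, y] : Plane)‖ < 1 ∧
        1 - ‖(!₂[x, y] : Plane)‖ ≤ 2 * (1 - r) := fun x hx y hy =>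
    norm_bounds_of_mem_square hr0 hr1 rfl (abs_le.2 ⟨by linarith [hx.1], by linarith [hx.2]⟩)
      (abs_le.2 ⟨by linarith [hy.1], by linarith [hy.2]⟩)
  have hsup : ∀ x ∈ Icc (p - d) (p + d), ∀ y ∈ Icc (q - d) (q + d),
      |v !₂[x, y]| ≤ 4 * K * (1 - r) := by
    intro x hx y hy
    obtain ⟨h₁, h₂, h₃⟩ := hsq x hx y hy
    refine (hV x y (by linarith) h₂).trans ?_
    nlinarith
  have hN : ∀ x ∈ Icc (p - d) (p + d), ∀ y ∈ Icc (q - d) (q + d), ∃ a b,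
      HasSecondDerivAt (fun s => v !₂[s, y]) a x ∧
      HasSecondDerivAt (fun s => v !₂[x, s]) b y ∧ |a + b| < 17 * C / r ^ 2 := by
    intro x hx y hy
    obtain ⟨h₁, h₂, -⟩ := hsq x hx y hy
    obtain ⟨a, b, ha, hb, hab⟩ := hlap' x y (by linarith) h₂
    refine ⟨a, b, ha, hb, hab.trans_lt ?_⟩
    have hs := plane_norm_sq x y
    have hs0 : r ^ 2 / 16 ≤ x ^ 2 + y ^ 2 := hs ▸ by nlinarith
    have hs1 : x ^ 2 + y ^ 2 ≤ 1 := hs ▸ by nlinarith [norm_nonneg (!₂[x, y] : Plane)]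
    have hr2 : 0 < r ^ 2 := by positivity
    have hle : (x ^ 2 + y ^ 2) ^ α ≤ 16 / r ^ 2 := by
      calc (x ^ 2 + y ^ 2) ^ α ≤ (x ^ 2 + y ^ 2) ^ (-1 : ℝ) :=
            rpow_le_rpow_of_exponent_ge (by linarith) hs1 hα1.le
        _ = (x ^ 2 + y ^ 2)⁻¹ := rpow_neg_one _
        _ ≤ (r ^ 2 / 16)⁻¹ := inv_anti₀ (by positivity) hs0
        _ = 16 / r ^ 2 := inv_div _ _
    calc C * (x ^ 2 + y ^ 2) ^ α ≤ C * (16 / r ^ 2) := by gcongr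
      _ = 16 * C / r ^ 2 := by ring
      _ < 17 * C / r ^ 2 := by gcongr; norm_num
  have hVcont : ContinuousOn (Function.uncurry fun x y : ℝ => v !₂[x, y])
      (Icc (p - d) (p + d) ×ˢ Icc (q - d) (q + d)) :=
    hcont.comp hmk.continuousOn fun z hz =>
      mem_closedBall_zero_iff.2 (hsq _ hz.1 _ hz.2).2.1.le
  have hv := (hcd _ hr0 hr1).differentiableAt (by simp)
  have h_one := abs_partial_deriv_le_of_square hd0 hVcont hsup hN (hasDerivAt_plane_one hv)
  have h_zero := abs_partial_deriv_le_of_square (u := fun x y => v !₂[y, x]) hd0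
    (hVcont.comp continuous_swap.continuousOn fun z hz => ⟨hz.2, hz.1⟩)
    (fun x hx y hy => hsup y hy x hx)
    (fun x hx y hy => by
      obtain ⟨a, b, ha, hb, hab⟩ := hN y hy x hx
      exact ⟨b, a, hb, ha, add_comm a b ▸ hab⟩)
    (hasDerivAt_plane_zero hv)
  have hM : 2 * (4 * K * (1 - r)) / d = 16 * K / r := by
    have := (sub_pos.2 hr1).ne'
    rw [hd]
    field_simp
    ring
  have hdN : d * (17 * C / r ^ 2) / 2 ≤ 17 * C / 2 / r := by
    have : d * (17 * C / r ^ 2) / 2 = 17 * C / 4 / r * (1 - r) := by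
      rw [hd]
      field_simp
      ring
    rw [this]
    have hpos : 0 < 17 * C / 4 / r := by positivity
    have : 17 * C / 2 / r = 17 * C / 4 / r * 2 := by ring
    rw [this]
    gcongr
    linarith
  have hsum : (32 * K + 17 * C) / r = 2 * (16 * K / r + 17 * C / 2 / r) := by ring
  rw [hsum]
  linarith [norm_gradient_le v !₂[p, q]]
end
end
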